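/- arXiv:2604.15887 — 8 statements merged into one kernel-verified Lean document; each statement's English description precedes it below -/
import Mathlib

section
/- If S ⊆ ℝ² is a compact, purely 1-unrectifiable set with H¹(S) < ∞, then there exists a sequence of 1-Lipschitz maps f_i : ℝ² → ℝ² converging uniformly to the identity such that f_i(S) is a finite set for each i ∈ ℕ. -/
open MeasureTheory Filter
open scoped Topology

/-- A compact subset of the line of measure less than `ε` is collapsed to a locally constant image
by a `1`-Lipschitz map moving points by at most `ε`. -/
lemma exists_collapse {K : Set ℝ} (hK : IsCompact K) {ε : ℝ}
    (hKε : volume K < ENNReal.ofReal ε) :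
    ∃ φ : ℝ → ℝ, (∀ s t, |φ s - φ t| ≤ |s - t|) ∧ (∀ t, φ t ≤ t ∧ t ≤ φ t + ε) ∧
      ∃ r > 0, ∀ k ∈ K, ∀ t, |t - k| < r → φ t = φ k := by
  obtain ⟨V, hKV, hVo, hV⟩ := K.exists_isOpen_lt_of_lt _ hKε
  have hε : 0 < ε := ENNReal.ofReal_pos.1 (bot_le.trans_lt hV)
  obtain ⟨r, hr, hrV⟩ := hK.exists_thickening_subset_open hVo hKV
  have hfin : ∀ A : Set ℝ, volume (V ∩ A) ≠ ⊤ := fun A =>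
    ((measure_mono Set.inter_subset_left).trans_lt (hV.trans ENNReal.ofReal_lt_top)).ne
  have key : ∀ s t, s ≤ t → volume.real (V ∩ Set.Iic t) =
      volume.real (V ∩ Set.Iic s) + volume.real (V ∩ Set.Ioc s t) := by
    intro s t hst
    rw [← measureReal_union _ (hVo.measurableSet.inter measurableSet_Ioc) (hfin _) (hfin _),
      ← Set.inter_union_distrib_left, Set.Iic_union_Ioc_eq_Iic hst]
    exact (Set.disjoint_left.2 fun x hx hx' => not_lt.2 hx.2 hx'.2.1)
  have upper : ∀ s t, s ≤ t → volume.real (V ∩ Set.Ioc s t) ≤ t - s := by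
    intro s t hst
    have := measureReal_mono (μ := volume) (Set.inter_subset_right (s := V) (t := Set.Ioc s t))
      measure_Ioc_lt_top.ne
    simpa [Real.volume_real_Ioc_of_le hst] using this
  have full : ∀ s t, s ≤ t → Set.Icc s t ⊆ V → volume.real (V ∩ Set.Ioc s t) = t - s := by
    intro s t hst h
    rw [Set.inter_eq_right.2 (Set.Ioc_subset_Icc_self.trans h), Real.volume_real_Ioc_of_le hst]
  refine ⟨fun t => t - volume.real (V ∩ Set.Iic t), ?_, ?_, r, hr, ?_⟩
  · have mono : ∀ s t, s ≤ t → |(s - volume.real (V ∩ Set.Iic s)) -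
        (t - volume.real (V ∩ Set.Iic t))| ≤ |s - t| := by
      intro s t hst
      have h0 : 0 ≤ volume.real (V ∩ Set.Ioc s t) := measureReal_nonneg
      have h1 := upper s t hst
      have h2 := key s t hst
      rw [abs_of_nonpos (by linarith : s - t ≤ 0), abs_le]
      constructor <;> linarith
    intro s t
    rcases le_total s t with h | h
    · exact mono s t h
    · rw [abs_sub_comm, abs_sub_comm s]
      exact mono t s h
  · intro t
    have h0 : 0 ≤ volume.real (V ∩ Set.Iic t) := measureReal_nonneg
    have h1 : volume.real (V ∩ Set.Iic t) ≤ ε := by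
      refine ENNReal.toReal_le_of_le_ofReal hε.le ?_
      exact (measure_mono Set.inter_subset_left).trans hV.le
    constructor <;> linarith
  · intro k hk t ht
    have hball : Metric.ball k r ⊆ V := (Metric.ball_subset_thickening hk r).trans hrV
    have hkr : k ∈ Metric.ball k r := Metric.mem_ball_self hr
    have htr : t ∈ Metric.ball k r := by simpa [Real.dist_eq] using ht
    have hconv : (Metric.ball k r).OrdConnected := (convex_ball k r).ordConnected
    rcases le_total k t with h | h
    · have h1 := full k t h ((hconv.out hkr htr).trans hball)
      have h2 := key k t h
      simp only
      linarith
    · have h1 := full t k h ((hconv.out htr hkr).trans hball)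
      have h2 := key t k h
      simp only
      linarith

/-- A map that is `C`-Lipschitz at small scales on a compact set multiplies its
one-dimensional measure by at most `C`. -/
lemma hausdorffMeasure_image_le_of_local {X : Type*} [MetricSpace X] [MeasurableSpace X]
    [BorelSpace X] {S : Set X} (hS : IsCompact S) {g : X → ℝ} {C : NNReal} {δ : ℝ} (hδ : 0 < δ)
    (hg : ∀ x ∈ S, ∀ y ∈ S, dist x y ≤ δ → |g x - g y| ≤ C * dist x y) :
    μH[1] (g '' S) ≤ C * μH[1] S := by
  obtain ⟨t, -, ht, hcov⟩ := hS.finite_cover_balls (half_pos hδ)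
  suffices ∀ T ⊆ S, T ⊆ ⋃ x ∈ t, Metric.ball x (δ / 2) → μH[1] (g '' T) ≤ C * μH[1] T from
    this S subset_rfl hcov
  clear hcov
  induction t, ht using Set.Finite.induction_on with
  | empty =>
    intro T _ hT
    simp only [Set.mem_empty_iff_false, Set.iUnion_of_empty, Set.iUnion_empty,
      Set.subset_empty_iff] at hT
    simp [hT]
  | @insert z t _ _ ih =>
    intro T hTS hT
    have h1 : μH[1] (g '' (T ∩ Metric.ball z (δ / 2))) ≤
        C * μH[1] (T ∩ Metric.ball z (δ / 2)) := by
      have hl : LipschitzOnWith C g (T ∩ Metric.ball z (δ / 2)) := by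
        refine LipschitzOnWith.of_dist_le_mul fun x hx y hy => ?_
        refine hg x (hTS hx.1) y (hTS hy.1) ?_
        have h1 := Metric.mem_ball.1 hx.2
        have h2 := Metric.mem_ball.1 hy.2
        have h3 := dist_triangle_right x y z
        linarith
      simpa using hl.hausdorffMeasure_image_le zero_le_one
    have h2 := ih (T \ Metric.ball z (δ / 2)) (Set.sdiff_subset.trans hTS) (by
      intro x hx
      have := hT hx.1
      rw [Set.biUnion_insert] at this
      exact this.resolve_left hx.2)
    calc μH[1] (g '' T)
        = μH[1] (g '' (T ∩ Metric.ball z (δ / 2)) ∪ g '' (T \ Metric.ball z (δ / 2))) := by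
          rw [← Set.image_union, Set.inter_union_sdiff]
      _ ≤ _ := measure_union_le _ _
      _ ≤ C * μH[1] (T ∩ Metric.ball z (δ / 2)) + C * μH[1] (T \ Metric.ball z (δ / 2)) :=
          add_le_add h1 h2
      _ = C * μH[1] T := by
          rw [← mul_add, measure_inter_add_sdiff _ Metric.isOpen_ball.measurableSet]

/-- Graphs of `1`-Lipschitz partial curves in a compact purely unrectifiable set accumulate on a
set with null image under any Lipschitz function. -/
lemma exists_null_limit {X : Type*} [MetricSpace X] [MeasurableSpace X] [BorelSpace X]
    {S : Set X} (hS : IsCompact S)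
    (hpu : ∀ (A : Set ℝ) (γ : ℝ → X) (K : NNReal),
      LipschitzOnWith K γ A → μH[1] (γ '' A ∩ S) = 0)
    {u : X → ℝ} {B : NNReal} (hu : LipschitzWith B u) {L : ℝ} (G : ℕ → Set (ℝ × X))
    (hGS : ∀ m, G m ⊆ Set.Icc 0 L ×ˢ S)
    (hG : ∀ m, ∀ p ∈ G m, ∀ q ∈ G m, dist p.2 q.2 ≤ |p.1 - q.1|) :
    ∃ K : Set ℝ, IsCompact K ∧ volume K = 0 ∧
      ∀ r > 0, ∀ᶠ m in hyperfilter ℕ, ∀ p ∈ G m, ∃ k ∈ K, |u p.2 - k| < r := by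
  set H : Set (ℝ × X) := {p | ∀ U ∈ 𝓝 p, ∀ᶠ m in hyperfilter ℕ, (G m ∩ U).Nonempty} with hH
  have hQ : IsCompact (Set.Icc 0 L ×ˢ S) := isCompact_Icc.prod hS
  have hHc : IsClosed H := by
    rw [← isOpen_compl_iff, isOpen_iff_mem_nhds]
    intro p hp
    simp only [hH, Set.mem_compl_iff, Set.mem_ofPred_eq, not_forall] at hp
    obtain ⟨U, hU, hpU⟩ := hp
    filter_upwards [eventually_mem_nhds_iff.2 hU] with q hq hqH
    exact hpU (hqH U hq)
  have hHQ : H ⊆ Set.Icc 0 L ×ˢ S := by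
    intro p hp
    rw [← hQ.isClosed.closure_eq, mem_closure_iff_nhds]
    intro U hU
    obtain ⟨m, q, hq, hqU⟩ := (hp U hU).exists
    exact ⟨q, hqU, hGS m hq⟩
  have hHcomp : IsCompact H := hQ.of_isClosed_subset hHc hHQ
  have hHlip : ∀ p ∈ H, ∀ q ∈ H, dist p.2 q.2 ≤ |p.1 - q.1| := by
    intro p hp q hq
    refine le_of_forall_pos_le_add fun e he => ?_
    obtain ⟨m, ⟨p', hp', hpp⟩, ⟨q', hq', hqq⟩⟩ :=
      ((hp _ (Metric.ball_mem_nhds p (by positivity : 0 < e / 4))).and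
        (hq _ (Metric.ball_mem_nhds q (by positivity : 0 < e / 4)))).exists
    rw [Metric.mem_ball, Prod.dist_eq, max_lt_iff] at hpp hqq
    have h1 := hG m p' hp' q' hq'
    have h2 := dist_triangle4 p.2 p'.2 q'.2 q.2
    have h3 := dist_triangle4 p'.1 p.1 q.1 q'.1
    rw [dist_comm p.2 p'.2] at h2
    rw [dist_comm q.1 q'.1] at h3
    rw [← Real.dist_eq] at h1 ⊢
    linarith [hpp.1, hpp.2, hqq.1, hqq.2]
  have hnull : μH[1] (Prod.snd '' H) = 0 := by
    rcases H.eq_empty_or_nonempty with h | ⟨p₀, hp₀⟩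
    · simp [h]
    have : Nonempty X := ⟨p₀.2⟩
    choose! γ hγ using fun (t : ℝ) (ht : t ∈ Prod.fst '' H) =>
      (show ∃ x, (t, x) ∈ H by obtain ⟨p, hp, rfl⟩ := ht; exact ⟨p.2, hp⟩)
    have hγlip : LipschitzOnWith 1 γ (Prod.fst '' H) :=
      LipschitzOnWith.of_dist_le_mul fun s hs t ht => by
        simpa [Real.dist_eq] using hHlip _ (hγ s hs) _ (hγ t ht)
    refine measure_mono_null ?_ (hpu _ γ 1 hγlip)
    rintro _ ⟨p, hp, rfl⟩
    refine ⟨⟨p.1, ⟨p, hp, rfl⟩, ?_⟩, (hHQ hp).2⟩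
    simpa using hHlip _ (hγ p.1 ⟨p, hp, rfl⟩) _ hp
  refine ⟨u '' (Prod.snd '' H), (hHcomp.image continuous_snd).image hu.continuous, ?_, ?_⟩
  · have h1 := (hu.lipschitzOnWith (s := Prod.snd '' H)).hausdorffMeasure_image_le
      (zero_le_one (α := ℝ))
    rw [hnull, mul_zero, hausdorffMeasure_real] at h1
    exact le_antisymm h1 bot_le
  · intro r hr
    by_contra hcon
    rw [← Ultrafilter.eventually_not] at hcon
    push Not at hcon
    have hne : Nonempty (ℝ × X) := by
      obtain ⟨m, p, -⟩ := hcon.exists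
      exact ⟨p⟩
    choose! p hp using fun (m : ℕ) (hm : ∃ p ∈ G m, ∀ k ∈ u '' (Prod.snd '' H), r ≤ |u p.2 - k|)
      => hm
    have hev : ∀ᶠ m in hyperfilter ℕ, p m ∈ G m ∧
        ∀ k ∈ u '' (Prod.snd '' H), r ≤ |u (p m).2 - k| := hcon.mono hp
    obtain ⟨q, -, hq⟩ := hQ.ultrafilter_le_nhds ((hyperfilter ℕ).map p)
      (le_principal_iff.2 (hev.mono fun m hm => hGS m hm.1))
    have hq' : Tendsto p (hyperfilter ℕ) (𝓝 q) := hq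
    have hqH : q ∈ H := fun U hU => by
      filter_upwards [hev, hq' hU] with m hm hmU
      exact ⟨p m, hm.1, hmU⟩
    have hlim : Tendsto (fun m => u (p m).2) (hyperfilter ℕ) (𝓝 (u q.2)) :=
      ((hu.continuous.comp continuous_snd).tendsto q).comp hq'
    obtain ⟨m, hm, hm'⟩ := (hev.and (hlim (Metric.ball_mem_nhds _ hr))).exists
    have h1 := hm.2 (u q.2) ⟨_, ⟨q, hqH, rfl⟩, rfl⟩
    have h2 : |u (p m).2 - u q.2| < r := by simpa [Real.dist_eq] using hm'
    linarith

/-- The cost of a step, discounted by the factor `η` when the step has length at most `δ`. -/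
noncomputable def discountedCost {X : Type*} [MetricSpace X] (c : X → X → ℝ) (η δ : ℝ)
    (x y : X) : ℝ :=
  open Classical in if dist x y ≤ δ then η * c x y else c x y

/-- In a compact purely unrectifiable set, discounting short steps of a chain saves little. -/
lemma exists_discount_scale {X : Type*} [MetricSpace X] [MeasurableSpace X] [BorelSpace X]
    {S : Set X} (hS : IsCompact S)
    (hpu : ∀ (A : Set ℝ) (γ : ℝ → X) (K : NNReal),
      LipschitzOnWith K γ A → μH[1] (γ '' A ∩ S) = 0)
    {u : X → ℝ} {c : X → X → ℝ} {a : ℝ} {B : NNReal} (ha : 0 < a)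
    (hac : ∀ x y, a * dist x y ≤ c x y) (hcB : ∀ x y, c x y ≤ B * dist x y)
    (huc : ∀ x y, |u x - u y| ≤ c x y) {η : ℝ} (hη : 0 < η) (hη1 : η ≤ 1)
    {ε : ℝ} (hε : 0 < ε) :
    ∃ δ > 0, ∀ (x : ℕ → X) (n : ℕ), (∀ i, x i ∈ S) →
      u (x n) ≤ u (x 0) + ∑ i ∈ Finset.range n, discountedCost c η δ (x i) (x (i + 1)) + ε := by
  have hu : LipschitzWith B u := LipschitzWith.of_dist_le_mul fun x y => by
    rw [Real.dist_eq]
    exact (huc x y).trans (hcB x y)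
  have hc0 : ∀ x y, 0 ≤ c x y := fun x y => (abs_nonneg _).trans (huc x y)
  have hw : ∀ δ x y, η * c x y ≤ discountedCost c η δ x y := by
    intro δ x y
    unfold discountedCost
    split_ifs
    · exact le_rfl
    · exact mul_le_of_le_one_left (hc0 x y) hη1
  by_contra! hcon
  choose x n hxS hlt using fun m : ℕ => hcon (1 / ((m : ℝ) + 1)) (by positivity)
  obtain ⟨M, hM⟩ := hS.exists_bound_of_continuousOn hu.continuous.continuousOn
  set t : ℕ → ℕ → ℝ := fun m i => ∑ j ∈ Finset.range i, dist (x m j) (x m (j + 1)) with ht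
  have htmono : ∀ m, Monotone (t m) := fun m i j hij =>
    Finset.sum_le_sum_of_subset_of_nonneg (Finset.range_mono hij) fun _ _ _ => dist_nonneg
  have htdist : ∀ m i j, i ≤ j → dist (x m i) (x m j) ≤ t m j - t m i := by
    intro m i j hij
    rw [ht, ← Finset.sum_Ico_eq_sub _ hij]
    exact dist_le_Ico_sum_dist _ hij
  have htL : ∀ m, t m (n m) ≤ 2 * M / (η * a) := by
    intro m
    rw [le_div_iff₀ (by positivity)]
    have h1 : t m (n m) * (η * a) ≤ ∑ i ∈ Finset.range (n m),
        discountedCost c η (1 / ((m : ℝ) + 1)) (x m i) (x m (i + 1)) := by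
      rw [ht, Finset.sum_mul]
      refine Finset.sum_le_sum fun i _ => ?_
      refine le_trans ?_ (hw _ _ _)
      have := mul_le_mul_of_nonneg_left (hac (x m i) (x m (i + 1))) hη.le
      linarith
    have h2 := abs_le.1 (hM _ (hxS m 0))
    have h3 := abs_le.1 (hM _ (hxS m (n m)))
    linarith [hlt m, h2.1, h3.2]
  obtain ⟨K, hK, hK0, hKG⟩ := exists_null_limit hS hpu hu (L := 2 * M / (η * a))
    (fun m => (fun i => (t m i, x m i)) '' Set.Iic (n m))
    (by
      rintro m _ ⟨i, hi, rfl⟩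
      refine ⟨⟨?_, (htmono m hi).trans (htL m)⟩, hxS m i⟩
      exact (Finset.sum_nonneg fun _ _ => dist_nonneg : 0 ≤ t m i))
    (by
      rintro m _ ⟨i, -, rfl⟩ _ ⟨j, -, rfl⟩
      rcases le_total i j with h | h
      · rw [abs_sub_comm]
        exact (htdist m i j h).trans (le_abs_self _)
      · rw [dist_comm]
        exact (htdist m j i h).trans (le_abs_self _))
  obtain ⟨φ, hφ, hφε, r, hr, hφr⟩ := exists_collapse hK (ε := ε) (by simpa [hK0] using hε)
  have hsmall : ∀ᶠ m : ℕ in hyperfilter ℕ, B * (1 / ((m : ℝ) + 1)) < r / 2 := by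
    have h : Tendsto (fun m : ℕ => (B : ℝ) * (1 / ((m : ℝ) + 1))) atTop (𝓝 (B * 0)) :=
      tendsto_one_div_add_atTop_nhds_zero_nat.const_mul _
    rw [mul_zero] at h
    exact (h.eventually_lt_const (half_pos hr)).filter_mono Nat.hyperfilter_le_atTop
  obtain ⟨m, hm, hmr⟩ := ((hKG (r / 2) (half_pos hr)).and hsmall).exists
  have hstep : ∀ i ≤ n m, φ (u (x m i)) ≤ φ (u (x m 0)) + ∑ j ∈ Finset.range i,
      discountedCost c η (1 / ((m : ℝ) + 1)) (x m j) (x m (j + 1)) := by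
    intro i
    induction i with
    | zero => simp
    | succ i ih =>
      intro hi
      have hi' := ih (by omega)
      rw [Finset.sum_range_succ]
      suffices φ (u (x m (i + 1))) ≤ φ (u (x m i)) +
          discountedCost c η (1 / ((m : ℝ) + 1)) (x m i) (x m (i + 1)) by linarith
      by_cases hd : dist (x m i) (x m (i + 1)) ≤ 1 / ((m : ℝ) + 1)
      · obtain ⟨k, hk, hik⟩ := hm _ ⟨i, by simp; omega, rfl⟩
        simp only at hik
        have h1 : |u (x m (i + 1)) - u (x m i)| < r / 2 := by
          rw [abs_sub_comm]
          refine lt_of_le_of_lt ((huc _ _).trans (hcB _ _)) (lt_of_le_of_lt ?_ hmr)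
          gcongr
        have h2 := abs_sub_le (u (x m (i + 1))) (u (x m i)) k
        rw [hφr k hk _ (by linarith), hφr k hk (u (x m i)) (by linarith)]
        have := (mul_nonneg hη.le (hc0 _ _)).trans
          (hw (1 / ((m : ℝ) + 1)) (x m i) (x m (i + 1)))
        linarith
      · rw [discountedCost, if_neg hd]
        have h1 := (hφ (u (x m i)) (u (x m (i + 1)))).trans (huc _ _)
        linarith [(abs_le.1 h1).1]
  have h1 := hstep (n m) le_rfl
  have h2 := (hφε (u (x m (n m)))).2
  have h3 := (hφε (u (x m 0))).1
  linarith [hlt m]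

/-- On a compact purely unrectifiable set of finite measure, a function that is Lipschitz for an
auxiliary distance `c` is uniformly approximated by such functions with finite image. -/
lemma exists_finite_image_approx {X : Type*} [MetricSpace X] [MeasurableSpace X] [BorelSpace X]
    {S : Set X} (hS : IsCompact S) (hfin : μH[1] S < ⊤)
    (hpu : ∀ (A : Set ℝ) (γ : ℝ → X) (K : NNReal),
      LipschitzOnWith K γ A → μH[1] (γ '' A ∩ S) = 0)
    {u : X → ℝ} {c : X → X → ℝ} {a : ℝ} {B : NNReal} (ha : 0 < a)
    (hac : ∀ x y, a * dist x y ≤ c x y) (hcB : ∀ x y, c x y ≤ B * dist x y)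
    (hsymm : ∀ x y, c x y = c y x) (htri : ∀ x y z, c x z ≤ c x y + c y z)
    (huc : ∀ x y, |u x - u y| ≤ c x y) {ε : ℝ} (hε : 0 < ε) :
    ∃ g : X → ℝ, (∀ x y, |g x - g y| ≤ c x y) ∧ (∀ x ∈ S, |g x - u x| ≤ ε) ∧
      (g '' S).Finite := by
  rcases S.eq_empty_or_nonempty with rfl | hne
  · exact ⟨u, huc, by simp, by simp⟩
  have hc0 : ∀ x y, 0 ≤ c x y := fun x y => (abs_nonneg _).trans (huc x y)
  obtain ⟨η, hη, hη1, hηε⟩ : ∃ η : ℝ, 0 < η ∧ η ≤ 1 ∧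
      η * B * (μH[1] S).toReal < ε / 2 := by
    set D : ℝ := B * (μH[1] S).toReal with hD
    have hD0 : 0 ≤ D := by positivity
    refine ⟨min 1 (ε / 4 / (D + 1)), by positivity, min_le_left _ _, ?_⟩
    have h1 : min 1 (ε / 4 / (D + 1)) * (D + 1) ≤ ε / 4 :=
      (mul_le_mul_of_nonneg_right (min_le_right _ _) (by positivity)).trans_eq (by field_simp)
    have h2 : 0 < min 1 (ε / 4 / (D + 1)) := by positivity
    rw [mul_assoc, ← hD]
    linarith
  obtain ⟨δ, hδ, hchain⟩ := exists_discount_scale hS hpu ha hac hcB huc hη hη1 (half_pos hε)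
  have hwc : ∀ x y, discountedCost c η δ x y ≤ c x y := by
    intro x y
    unfold discountedCost
    split_ifs
    · exact mul_le_of_le_one_left (hc0 x y) hη1
    · exact le_rfl
  have : Nonempty S := hne.to_subtype
  set F : (ℕ → S) × ℕ → X → ℝ := fun p y => u (p.1 0) +
    ∑ i ∈ Finset.range p.2, discountedCost c η δ (p.1 i) (p.1 (i + 1)) + c (p.1 p.2) y with hF
  have hFlow : ∀ p y, u y - ε / 2 ≤ F p y := by
    intro p y
    have h1 := hchain (fun i => p.1 i) p.2 fun i => (p.1 i).2
    have h2 := (abs_le.1 (huc (p.1 p.2) y)).1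
    simp only [hF]
    linarith
  have hbdd : ∀ y, BddBelow (Set.range fun p => F p y) := fun y =>
    ⟨u y - ε / 2, by rintro _ ⟨p, rfl⟩; exact hFlow p y⟩
  set g : X → ℝ := fun y => ⨅ p, F p y with hg
  have glow : ∀ y, u y - ε / 2 ≤ g y := fun y => le_ciInf fun p => hFlow p y
  have gup : ∀ y ∈ S, g y ≤ u y := by
    intro y hy
    refine (ciInf_le (hbdd y) (fun _ => ⟨y, hy⟩, 0)).trans ?_
    have := hcB y y
    simp only [dist_self, mul_zero] at this
    simpa [hF] using this
  have gle : ∀ x y, g y ≤ g x + c x y := by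
    intro x y
    rw [← sub_le_iff_le_add]
    refine le_ciInf fun p => ?_
    have h1 := ciInf_le (hbdd y) p
    have h2 := htri (p.1 p.2) x y
    simp only [hF, hg] at h1 h2 ⊢
    linarith
  have gshort : ∀ x ∈ S, ∀ y ∈ S, dist x y ≤ δ → g y ≤ g x + η * c x y := by
    intro x hx y hy hxy
    rw [← sub_le_iff_le_add]
    refine le_ciInf fun p => ?_
    have h1 := ciInf_le (hbdd y) (fun i => if i ≤ p.2 then p.1 i else
      if i = p.2 + 1 then ⟨x, hx⟩ else ⟨y, hy⟩, p.2 + 2)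
    have h2 : ∀ i ∈ Finset.range p.2, i ≤ p.2 ∧ i + 1 ≤ p.2 := fun i hi => by
      have := Finset.mem_range.1 hi
      omega
    have h3 := hcB y y
    have h4 := hwc (p.1 p.2) x
    have h5 : discountedCost c η δ x y = η * c x y := if_pos hxy
    simp only [dist_self, mul_zero] at h3
    simp only [hF] at h1
    rw [Finset.sum_range_succ, Finset.sum_range_succ, Finset.sum_congr rfl fun i hi => by
      rw [if_pos (h2 i hi).1, if_pos (h2 i hi).2]] at h1
    simp [h5] at h1
    simp only [hF, hg]
    linarith
  have gabs : ∀ x y, |g x - g y| ≤ c x y := by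
    intro x y
    have h1 := gle x y
    have h2 := gle y x
    rw [hsymm y x] at h2
    rw [abs_le]
    constructor <;> linarith
  have gcont : Continuous g :=
    (LipschitzWith.of_dist_le_mul (K := B) fun x y => by
      rw [Real.dist_eq]
      exact (gabs x y).trans (hcB x y)).continuous
  have gvol : volume (g '' S) < ENNReal.ofReal (ε / 2) := by
    have h1 := hausdorffMeasure_image_le_of_local hS (g := g) (C := ⟨η, hη.le⟩ * B) hδ (by
      intro x hx y hy hxy
      have h1 := gshort x hx y hy hxy
      have h2 := gshort y hy x hx (by rwa [dist_comm])
      rw [hsymm y x] at h2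
      have h3 := mul_le_mul_of_nonneg_left (hcB x y) hη.le
      rw [← mul_assoc] at h3
      refine le_trans (abs_le.2 ?_) h3
      constructor <;> linarith)
    rw [hausdorffMeasure_real] at h1
    refine h1.trans_lt ?_
    rw [← ENNReal.ofReal_toReal hfin.ne, ← ENNReal.ofReal_coe_nnreal,
      ← ENNReal.ofReal_mul (NNReal.coe_nonneg _)]
    exact (ENNReal.ofReal_lt_ofReal_iff (half_pos hε)).2 hηε
  obtain ⟨φ, hφ, hφε, r, hr, hφr⟩ := exists_collapse (hS.image gcont) gvol
  refine ⟨φ ∘ g, fun x y => (hφ _ _).trans (gabs x y), fun x hx => ?_, ?_⟩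
  · have h1 := hφε (g x)
    have h2 := glow x
    have h3 := gup x hx
    rw [Function.comp_apply, abs_le]
    constructor <;> linarith
  · obtain ⟨t, htK, ht, hcov⟩ := (hS.image gcont).finite_cover_balls hr
    rw [Set.image_comp]
    refine (ht.image φ).subset ?_
    rintro _ ⟨z, hz, rfl⟩
    obtain ⟨k, hk, hzk⟩ := Set.mem_iUnion₂.1 (hcov hz)
    exact ⟨k, hk, (hφr k (htK hk) z (by simpa [Real.dist_eq] using hzk)).symm⟩

/-- A map of the plane that is `1`-Lipschitz on a closed square and agrees with a `1`-Lipschitz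
map outside its interior is `1`-Lipschitz. -/
lemma lipschitzWith_one_of_eq_outside_square
    {f Φ : EuclideanSpace ℝ (Fin 2) → EuclideanSpace ℝ (Fin 2)} {R : ℝ}
    (hΦ : LipschitzWith 1 Φ)
    (hin : ∀ x y, max |x 0| |x 1| ≤ R → max |y 0| |y 1| ≤ R → dist (f x) (f y) ≤ dist x y)
    (hout : ∀ x, R ≤ max |x 0| |x 1| → f x = Φ x) : LipschitzWith 1 f := by
  have hΦ' : ∀ x y, dist (Φ x) (Φ y) ≤ dist x y := fun x y => by simpa using hΦ.dist_le_mul x y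
  have hmixed : ∀ x y, max |x 0| |x 1| ≤ R → R ≤ max |y 0| |y 1| →
      dist (f x) (f y) ≤ dist x y := by
    intro x y hx hy
    have hcont : Continuous fun z : EuclideanSpace ℝ (Fin 2) => max |z 0| |z 1| := by fun_prop
    obtain ⟨z, hz, hzR⟩ := (convex_segment x y).isPreconnected.intermediate_value
      (left_mem_segment ℝ x y) (right_mem_segment ℝ x y) hcont.continuousOn ⟨hx, hy⟩
    simp only at hzR
    calc dist (f x) (f y) ≤ dist (f x) (f z) + dist (f z) (f y) := dist_triangle _ _ _
      _ ≤ dist x z + dist z y := by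
          refine add_le_add (hin x z hx hzR.le) ?_
          rw [hout z hzR.ge, hout y hy]
          exact hΦ' z y
      _ = dist x y := dist_add_dist_of_mem_segment hz
  refine LipschitzWith.of_dist_le_mul fun x y => ?_
  rw [NNReal.coe_one, one_mul]
  rcases le_total (max |x 0| |x 1|) R with hx | hx <;>
    rcases le_total (max |y 0| |y 1|) R with hy | hy
  · exact hin x y hx hy
  · exact hmixed x y hx hy
  · rw [dist_comm, dist_comm x]
    exact hmixed y x hy hx
  · rw [hout x hx, hout y hy]
    exact hΦ' x y

lemma abs_clamp_sub_clamp_le {l u h l' u' h' d : ℝ} (hl : |l - l'| ≤ d) (hu : |u - u'| ≤ d)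
    (hh : |h - h'| ≤ d) : |max l (min u h) - max l' (min u' h')| ≤ d :=
  (abs_max_sub_max_le_max _ _ _ _).trans
    (max_le hl ((abs_min_sub_min_le_max _ _ _ _).trans (max_le hu hh)))

/-- A single coordinate of the approximating map: nearly the `i`-th coordinate, with finite image
on `S`, and equal to a function of the `i`-th coordinate away from `S`. -/
lemma exists_coordinate_approx {S : Set (EuclideanSpace ℝ (Fin 2))} (hS : IsCompact S)
    (hfin : μH[1] S < ⊤)
    (hpu : ∀ (A : Set ℝ) (γ : ℝ → EuclideanSpace ℝ (Fin 2)) (K : NNReal),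
      LipschitzOnWith K γ A → μH[1] (γ '' A ∩ S) = 0)
    {R β : ℝ} (hβ : 0 < β) (hβ2 : β < 1 / 2)
    (hSR : ∀ x ∈ S, max |x 0| |x 1| ≤ R - 1) (hR : 0 ≤ R) {i j : Fin 2} (hij : i ≠ j) :
    ∃ F : EuclideanSpace ℝ (Fin 2) → ℝ,
      (∀ x y, max |x 0| |x 1| ≤ R → max |y 0| |y 1| ≤ R →
        |F x - F y| ≤ (1 - β) * |x i - y i| + β * |x j - y j|) ∧
      (∀ x, R ≤ max |x 0| |x 1| → F x = x i - 2 * β * max (-R) (min R (x i))) ∧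
      (∀ x, |F x - x i| ≤ 3 * β * R) ∧ (F '' S).Finite := by
  have hmax : ∀ x : EuclideanSpace ℝ (Fin 2), max |x 0| |x 1| = max |x i| |x j| := by
    intro x
    fin_cases i <;> fin_cases j <;> first | exact absurd rfl hij | simp [max_comm]
  simp only [hmax] at hSR ⊢
  have hcoord : ∀ (k : Fin 2) (x y : EuclideanSpace ℝ (Fin 2)), |x k - y k| ≤ dist x y := by
    intro k x y
    simpa [dist_eq_norm] using PiLp.norm_apply_le (x - y) k
  have hdist : ∀ x y : EuclideanSpace ℝ (Fin 2), dist x y ≤ |x i - y i| + |x j - y j| := by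
    intro x y
    have hsum : |x i - y i| + |x j - y j| = |x 0 - y 0| + |x 1 - y 1| := by
      fin_cases i <;> fin_cases j <;> first | exact absurd rfl hij | simp [add_comm]
    rw [hsum, EuclideanSpace.dist_eq, Fin.sum_univ_two, Real.dist_eq, Real.dist_eq]
    refine Real.sqrt_le_iff.2 ⟨by positivity, ?_⟩
    nlinarith [mul_nonneg (abs_nonneg (x 0 - y 0)) (abs_nonneg (x 1 - y 1))]
  obtain ⟨h, hh, hhS, hhfin⟩ := exists_finite_image_approx hS hfin hpu
    (u := fun x => (1 - 2 * β) * x i)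
    (c := fun x y => (1 - 2 * β) * |x i - y i| + β * |x j - y j|)
    (a := min (1 - 2 * β) β) (B := 1) (lt_min (by linarith) hβ)
    (by
      intro x y
      have h1 := mul_le_mul_of_nonneg_left (hdist x y)
        (lt_min (by linarith : 0 < 1 - 2 * β) hβ).le
      have h2 := mul_le_mul_of_nonneg_right (min_le_left (1 - 2 * β) β) (abs_nonneg (x i - y i))
      have h3 := mul_le_mul_of_nonneg_right (min_le_right (1 - 2 * β) β) (abs_nonneg (x j - y j))
      linarith)
    (by
      intro x y
      have h1 := mul_le_mul_of_nonneg_left (hcoord i x y) (by linarith : 0 ≤ 1 - 2 * β)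
      have h2 := mul_le_mul_of_nonneg_left (hcoord j x y) hβ.le
      have h3 := mul_nonneg hβ.le (dist_nonneg (x := x) (y := y))
      rw [NNReal.coe_one]
      linarith)
    (by
      intro x y
      simp only [abs_sub_comm])
    (by
      intro x y z
      have h1 := mul_le_mul_of_nonneg_left (abs_sub_le (x i) (y i) (z i))
        (by linarith : 0 ≤ 1 - 2 * β)
      have h2 := mul_le_mul_of_nonneg_left (abs_sub_le (x j) (y j) (z j)) hβ.le
      linarith)
    (by
      intro x y
      rw [← mul_sub, abs_mul, abs_of_pos (by linarith : 0 < 1 - 2 * β)]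
      exact le_add_of_nonneg_right (by positivity))
    hβ
  set ψ : ℝ → ℝ := fun t => t - 2 * β * max (-R) (min R t) with hψ
  set b : EuclideanSpace ℝ (Fin 2) → ℝ := fun x => max 0 (β * (R - max |x i| |x j|)) with hb
  have hb0 : ∀ x, 0 ≤ b x := fun x => le_max_left _ _
  have hbR : ∀ x, b x ≤ β * R := fun x => max_le (by positivity)
    (mul_le_mul_of_nonneg_left (by linarith [(abs_nonneg (x i)).trans (le_max_left _ |x j|)]) hβ.le)
  have hblip : ∀ x y, |b x - b y| ≤ β * |x i - y i| + β * |x j - y j| := by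
    intro x y
    have h1 : |max |x i| |x j| - (max |y i| |y j|)| ≤ |x i - y i| + |x j - y j| :=
      (abs_max_sub_max_le_max _ _ _ _).trans (max_le
        ((abs_abs_sub_abs_le _ _).trans (le_add_of_nonneg_right (abs_nonneg _)))
        ((abs_abs_sub_abs_le _ _).trans (le_add_of_nonneg_left (abs_nonneg _))))
    refine (abs_max_sub_max_le_max _ _ _ _).trans (max_le (by simp; positivity) ?_)
    rw [← mul_sub, abs_mul, abs_of_pos hβ, ← mul_add]
    refine mul_le_mul_of_nonneg_left ?_ hβ.le
    rw [sub_sub_sub_cancel_left, abs_sub_comm]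
    exact h1
  have hψin : ∀ t, |t| ≤ R → ψ t = (1 - 2 * β) * t := by
    intro t ht
    rw [abs_le] at ht
    simp only [hψ]
    rw [min_eq_right ht.2, max_eq_right ht.1]
    ring
  have hψid : ∀ t, |ψ t - t| ≤ 2 * β * R := by
    intro t
    have h1 : |max (-R) (min R t)| ≤ R :=
      abs_le.2 ⟨le_max_left _ _, max_le (by linarith) (min_le_left _ _)⟩
    have h2 : ψ t - t = -(2 * β * max (-R) (min R t)) := by simp only [hψ]; ring
    rw [h2, abs_neg, abs_mul, abs_of_pos (by positivity : 0 < 2 * β)]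
    exact mul_le_mul_of_nonneg_left h1 (by positivity)
  refine ⟨fun x => max (ψ (x i) - b x) (min (ψ (x i) + b x) (h x)), ?_, ?_, ?_, ?_⟩
  · intro x y hx hy
    have h1 := hblip x y
    have h2 : |ψ (x i) - ψ (y i)| = (1 - 2 * β) * |x i - y i| := by
      rw [hψin _ ((le_max_left _ _).trans hx), hψin _ ((le_max_left _ _).trans hy), ← mul_sub,
        abs_mul, abs_of_pos (by linarith : 0 < 1 - 2 * β)]
    have h3 := mul_nonneg hβ.le (abs_nonneg (x i - y i))
    refine abs_clamp_sub_clamp_le ?_ ?_ ?_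
    · rw [sub_sub_sub_comm]
      linarith [abs_sub (ψ (x i) - ψ (y i)) (b x - b y)]
    · rw [add_sub_add_comm]
      linarith [abs_add_le (ψ (x i) - ψ (y i)) (b x - b y)]
    · linarith [hh x y]
  · intro x hx
    have h1 : b x = 0 := max_eq_left (mul_nonpos_of_nonneg_of_nonpos hβ.le (by linarith))
    simp only [h1, sub_zero, add_zero]
    exact max_eq_left (min_le_left _ _)
  · intro x
    have h1 := abs_le.1 (hψid (x i))
    have h2 := hbR x
    have h3 := hb0 x
    rw [abs_le]
    constructor
    · linarith [le_max_left (ψ (x i) - b x) (min (ψ (x i) + b x) (h x))]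
    · have : max (ψ (x i) - b x) (min (ψ (x i) + b x) (h x)) ≤ ψ (x i) + b x :=
        max_le (by linarith) (min_le_left _ _)
      linarith
  · convert hhfin using 1
    refine Set.image_congr fun x hx => ?_
    have h1 := hSR x hx
    have h2 := abs_le.1 (hhS x hx)
    have h3 : β ≤ b x := by
      refine le_trans ?_ (le_max_right _ _)
      nlinarith
    have h4 := hψin (x i) ((le_max_left _ _).trans (h1.trans (by linarith)))
    rw [min_eq_right (by linarith), max_eq_right (by linarith)]

/-- A single member of the approximating sequence. -/
lemma exists_lipschitz_finite_image {S : Set (EuclideanSpace ℝ (Fin 2))} (hS : IsCompact S)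
    (hfin : μH[1] S < ⊤)
    (hpu : ∀ (A : Set ℝ) (γ : ℝ → EuclideanSpace ℝ (Fin 2)) (K : NNReal),
      LipschitzOnWith K γ A → μH[1] (γ '' A ∩ S) = 0) {ε : ℝ} (hε : 0 < ε) :
    ∃ f : EuclideanSpace ℝ (Fin 2) → EuclideanSpace ℝ (Fin 2), LipschitzWith 1 f ∧
      (∀ x, dist (f x) x ≤ ε) ∧ (f '' S).Finite := by
  obtain ⟨M, hM⟩ := hS.exists_bound_of_continuousOn (f := fun x => x) continuousOn_id
  set R : ℝ := max M 0 + 1 with hRdef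
  have hR : 0 < R := by positivity
  have hSR : ∀ x ∈ S, max |x 0| |x 1| ≤ R - 1 := by
    intro x hx
    have h1 : ‖x‖ ≤ R - 1 := (hM x hx).trans (by simp [hRdef])
    exact max_le ((PiLp.norm_apply_le x 0).trans h1) ((PiLp.norm_apply_le x 1).trans h1)
  set β : ℝ := min (1 / 4) (ε / (6 * R)) with hβdef
  have hβ : 0 < β := by positivity
  have hβ2 : β < 1 / 2 := (min_le_left _ _).trans_lt (by norm_num)
  have hβR : 3 * β * R ≤ ε / 2 := by
    have := mul_le_mul_of_nonneg_right (min_le_right (1 / 4) (ε / (6 * R)))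
      (by positivity : 0 ≤ 3 * R)
    have h2 : ε / (6 * R) * (3 * R) = ε / 2 := by field_simp; norm_num
    linarith
  obtain ⟨F, hFin, hFout, hFid, hFS⟩ := exists_coordinate_approx hS hfin hpu hβ hβ2 hSR hR.le
    (zero_ne_one (α := Fin 2))
  obtain ⟨G, hGin, hGout, hGid, hGS⟩ := exists_coordinate_approx hS hfin hpu hβ hβ2 hSR hR.le
    (one_ne_zero (α := Fin 2))
  have hψ : ∀ s t : ℝ, |(s - 2 * β * max (-R) (min R s)) - (t - 2 * β * max (-R) (min R t))| ≤
      |s - t| := by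
    have mono : ∀ s t : ℝ, s ≤ t → |(s - 2 * β * max (-R) (min R s)) -
        (t - 2 * β * max (-R) (min R t))| ≤ |s - t| := by
      intro s t hst
      have h1 : max (-R) (min R s) ≤ max (-R) (min R t) := by gcongr
      have h2 := (le_abs_self _).trans ((abs_clamp_sub_clamp_le (l := -R) (l' := -R) (u := R)
        (u' := R) (d := |t - s|) (by simp) (by simp) le_rfl))
      rw [abs_of_nonneg (by linarith)] at h2
      rw [abs_of_nonpos (by linarith : s - t ≤ 0), abs_le]
      constructor <;> nlinarith
    intro s t
    rcases le_total s t with h | h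
    · exact mono s t h
    · rw [abs_sub_comm, abs_sub_comm s]
      exact mono t s h
  refine ⟨fun x => !₂[F x, G x], ?_, ?_, ?_⟩
  · refine lipschitzWith_one_of_eq_outside_square (R := R)
      (Φ := fun x => !₂[x 0 - 2 * β * max (-R) (min R (x 0)),
        x 1 - 2 * β * max (-R) (min R (x 1))]) ?_ ?_ ?_
    · refine LipschitzWith.of_dist_le_mul fun x y => ?_
      rw [NNReal.coe_one, one_mul, EuclideanSpace.dist_eq, EuclideanSpace.dist_eq,
        Fin.sum_univ_two, Fin.sum_univ_two]
      refine Real.sqrt_le_sqrt (add_le_add ?_ ?_)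
      · exact pow_le_pow_left₀ dist_nonneg (hψ (x 0) (y 0)) 2
      · exact pow_le_pow_left₀ dist_nonneg (hψ (x 1) (y 1)) 2
    · intro x y hx hy
      rw [EuclideanSpace.dist_eq, EuclideanSpace.dist_eq, Fin.sum_univ_two, Fin.sum_univ_two]
      refine Real.sqrt_le_sqrt ?_
      have h1 := pow_le_pow_left₀ (abs_nonneg _) (hFin x y hx hy) 2
      have h2 := pow_le_pow_left₀ (abs_nonneg _) (hGin x y hx hy) 2
      have h3 : 0 ≤ 2 * (β * (1 - β)) * (|x 0 - y 0| - |x 1 - y 1|) ^ 2 :=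
        mul_nonneg (mul_nonneg zero_le_two (mul_nonneg hβ.le (by linarith))) (sq_nonneg _)
      simp only [Real.dist_eq, Matrix.cons_val_zero, Matrix.cons_val_one]
      linarith
    · intro x hx
      rw [hFout x hx, hGout x hx]
  · intro x
    rw [EuclideanSpace.dist_eq, Fin.sum_univ_two]
    refine Real.sqrt_le_iff.2 ⟨hε.le, ?_⟩
    have h1 := pow_le_pow_left₀ (abs_nonneg _) ((hFid x).trans hβR) 2
    have h2 := pow_le_pow_left₀ (abs_nonneg _) ((hGid x).trans hβR) 2
    simp only [Real.dist_eq, Matrix.cons_val_zero, Matrix.cons_val_one]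
    nlinarith [sq_nonneg ε]
  · refine ((hFS.prod hGS).image fun p : ℝ × ℝ => !₂[p.1, p.2]).subset ?_
    rintro _ ⟨x, hx, rfl⟩
    exact ⟨(F x, G x), ⟨⟨x, hx, rfl⟩, ⟨x, hx, rfl⟩⟩, rfl⟩

/-- If `S ⊆ ℝ²` is a compact, purely 1-unrectifiable set with `H¹(S) < ∞`, then there exists a
sequence of 1-Lipschitz maps `fᵢ : ℝ² → ℝ²` converging uniformly to the identity such that
`fᵢ(S)` is a finite set for each `i`. -/
theorem stmt_0 (S : Set (EuclideanSpace ℝ (Fin 2))) (hScomp : IsCompact S)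
    (hSfin : μH[1] S < ⊤)
    (hpu : ∀ (A : Set ℝ) (γ : ℝ → EuclideanSpace ℝ (Fin 2)) (K : NNReal),
      LipschitzOnWith K γ A → μH[1] (γ '' A ∩ S) = 0) :
    ∃ f : ℕ → EuclideanSpace ℝ (Fin 2) → EuclideanSpace ℝ (Fin 2),
      (∀ i, LipschitzWith 1 (f i)) ∧
      TendstoUniformly f id atTop ∧
      ∀ i, (f i '' S).Finite := by
  choose f hlip hclose hfinite using fun n : ℕ => exists_lipschitz_finite_image hScomp hSfin hpu
    (Nat.one_div_pos_of_nat (α := ℝ) (n := n))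
  refine ⟨f, hlip, Metric.tendstoUniformly_iff.2 fun ε hε => ?_, hfinite⟩
  filter_upwards [tendsto_one_div_add_atTop_nhds_zero_nat.eventually_lt_const hε] with n hn x
  rw [dist_comm]
  exact (hclose n x).trans_lt hn
end

section
/- Let X be a complete metric space and S ⊆ X a separable, purely 1-unrectifiable subset. Then for every finite Borel measure μ on X with μ(X ∖ S) = 0 and every m ∈ ℕ, the set {f ∈ Lip₁(X, ℝ^m) : there exists N ⊆ S with μ(N) = 0 and the Hausdorff dimension of f(S ∖ N) equal to 0} is residual in Lip₁(X, ℝ^m). -/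
open MeasureTheory Filter

open Topology in
/-- A sequence with values in a compact set converges along every ultrafilter. -/
theorem IsCompact.exists_tendsto_ultrafilter {Y ι : Type*} [TopologicalSpace Y] {K : Set Y}
    (hK : IsCompact K) (U : Ultrafilter ι) {x : ι → Y} (hx : ∀ k, x k ∈ K) :
    ∃ p ∈ K, Tendsto x U (𝓝 p) := by
  obtain ⟨p, hp, h⟩ := hK.ultrafilter_le_nhds' (U.map x)
    (Ultrafilter.mem_map.2 (Eventually.of_forall hx))
  exact ⟨p, hp, h⟩

/-- Discrete intermediate value theorem: the steps of a finite real sequence cover the interval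
between its endpoints. -/
theorem exists_mem_uIcc_succ_of_mem_uIcc (a : ℕ → ℝ) (n : ℕ) {z : ℝ}
    (hz : z ∈ Set.uIcc (a 0) (a n)) :
    z = a 0 ∨ ∃ i < n, z ∈ Set.uIcc (a i) (a (i + 1)) := by
  induction n with
  | zero => left; simpa using hz
  | succ n ih =>
    rcases Set.uIcc_subset_uIcc_union_uIcc (b := a n) hz with h | h
    · rcases ih h with h | ⟨i, hi, h⟩
      · exact Or.inl h
      · exact Or.inr ⟨i, by omega, h⟩
    · exact Or.inr ⟨n, by omega, h⟩

/-- The distance between two points of a chain is at most the length of the part of the chain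
between them. -/
theorem dist_le_abs_chain_length_sub {X : Type*} [PseudoMetricSpace X] (x : ℕ → X) (i j : ℕ) :
    dist (x i) (x j) ≤ |∑ l ∈ Finset.range i, dist (x l) (x (l + 1)) -
      ∑ l ∈ Finset.range j, dist (x l) (x (l + 1))| := by
  wlog hij : i ≤ j generalizing i j
  · rw [dist_comm, abs_sub_comm]
    exact this j i (by omega)
  rw [abs_sub_comm, ← Finset.sum_Ico_eq_sub _ hij]
  exact (dist_le_Ico_sum_dist x hij).trans (le_abs_self _)

/-- A finite family of closed intervals of small total length leaves uncovered a set of definite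
measure. -/
theorem le_volume_Icc_diff_biUnion_uIcc {ι : Type*} (s : Finset ι) (a b : ι → ℝ) {p q η : ℝ}
    (hη : 0 ≤ η) (h : η + ∑ i ∈ s, |a i - b i| ≤ q - p) :
    ENNReal.ofReal η ≤ volume (Set.Icc p q \ ⋃ i ∈ s, Set.uIcc (a i) (b i)) := by
  have h1 : volume (⋃ i ∈ s, Set.uIcc (a i) (b i)) ≤ ENNReal.ofReal (∑ i ∈ s, |a i - b i|) := by
    refine (measure_biUnion_finset_le _ _).trans ?_
    rw [ENNReal.ofReal_sum_of_nonneg (fun _ _ => abs_nonneg _)]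
    refine Finset.sum_le_sum fun i _ => ?_
    rw [Real.volume_interval, abs_sub_comm]
  refine le_trans ?_ le_measure_sdiff
  rw [Real.volume_Icc]
  refine ENNReal.le_sub_of_add_le_right (ne_top_of_le_ne_top ENNReal.ofReal_ne_top h1) ?_
  calc _ ≤ ENNReal.ofReal η + ENNReal.ofReal (∑ i ∈ s, |a i - b i|) := by gcongr
    _ = ENNReal.ofReal (η + ∑ i ∈ s, |a i - b i|) :=
      (ENNReal.ofReal_add hη (Finset.sum_nonneg fun _ _ => abs_nonneg _)).symm
    _ ≤ _ := ENNReal.ofReal_le_ofReal h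

open Topology in
/-- If every Lipschitz curve fragment in the compact set `K` has zero length, then a bounded
Lipschitz function remains almost `1`-Lipschitz for the chain distance in which short jumps close
to `K` are made cheap. -/
theorem exists_radius_chain_lower_bound {X : Type*} [MetricSpace X] [MeasurableSpace X]
    [BorelSpace X] {K : Set X} (hK : IsCompact K)
    (hpu : ∀ (A : Set ℝ) (γ : ℝ → X) (C : NNReal),
      LipschitzOnWith C γ A → γ '' A ⊆ K → μH[1] (γ '' A) = 0)
    {φ : X → ℝ} {C : NNReal} (hφ : LipschitzWith C φ) {M : ℝ} (hM : ∀ x, |φ x| ≤ M)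
    {κ η : ℝ} (hκ : 0 < κ) (hη : 0 < η) :
    ∃ r > 0, ∀ c : X → X → ℝ, (∀ x y, κ * dist x y ≤ c x y) →
      (∀ x y, ¬ (x ∈ Metric.thickening r K ∧ dist x y < r) → |φ x - φ y| ≤ c x y) →
      ∀ (x : ℕ → X) (n : ℕ),
        φ (x 0) ≤ φ (x n) + ∑ i ∈ Finset.range n, c (x i) (x (i + 1)) + η := by
  classical
  by_contra! hcon
  have hr : ∀ k : ℕ, (0 : ℝ) < 1 / ((k : ℝ) + 1) := fun k => by positivity
  choose c hcκ hcφ x n hlt using fun k : ℕ => hcon _ (hr k)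
  set r : ℕ → ℝ := fun k => 1 / ((k : ℝ) + 1) with hrdef
  set len : ℕ → ℕ → ℝ := fun k i => ∑ l ∈ Finset.range i, dist (x k l) (x k (l + 1)) with hlen
  set U : Ultrafilter ℕ := hyperfilter ℕ
  have hrU : Tendsto r U (𝓝 0) :=
    tendsto_one_div_add_atTop_nhds_zero_nat.mono_left
      (Nat.cofinite_eq_atTop ▸ hyperfilter_le_cofinite)
  have hc0 : ∀ k a b, 0 ≤ c k a b := fun k a b =>
    (mul_nonneg hκ.le dist_nonneg).trans (hcκ k a b)
  have hlenmem : ∀ k, ∀ i ≤ n k, len k i ∈ Set.Icc 0 (2 * M / κ) := by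
    intro k i hi
    refine ⟨Finset.sum_nonneg fun _ _ => dist_nonneg, ?_⟩
    rw [le_div_iff₀ hκ]
    have h1 : len k i ≤ len k (n k) :=
      Finset.sum_le_sum_of_subset_of_nonneg (Finset.range_mono hi) fun _ _ _ => dist_nonneg
    have h2 : κ * len k (n k) ≤ ∑ i ∈ Finset.range (n k), c k (x k i) (x k (i + 1)) := by
      rw [hlen, Finset.mul_sum]
      exact Finset.sum_le_sum fun i _ => hcκ k _ _
    have h3 := hlt k
    have h4 := abs_le.1 (hM (x k 0))
    have h5 := abs_le.1 (hM (x k (n k)))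
    nlinarith
  -- the times at which the chains accumulate at points of `K`
  let IsLimit : ℝ → X → (ℕ → ℕ) → Prop := fun s p i =>
    (∀ k, i k ≤ n k) ∧ p ∈ K ∧ Tendsto (fun k => len k (i k)) U (𝓝 s) ∧
      Tendsto (fun k => x k (i k)) U (𝓝 p)
  have hlim : ∀ {s p i s' p' i'}, IsLimit s p i → IsLimit s' p' i' → dist p p' ≤ dist s s' := by
    rintro s p i s' p' i' ⟨-, -, h1, h2⟩ ⟨-, -, h3, h4⟩
    refine le_of_tendsto_of_tendsto' (h2.dist h4) (h1.dist h3) fun k => ?_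
    rw [Real.dist_eq]
    exact dist_le_abs_chain_length_sub (x k) _ _
  let A : Set ℝ := {s | ∃ p i, IsLimit s p i}
  have hγ : ∀ s, ∃ p, s ∈ A → ∃ i, IsLimit s p i := by
    intro s
    by_cases hs : s ∈ A
    · obtain ⟨p, i, h⟩ := hs
      exact ⟨p, fun _ => ⟨i, h⟩⟩
    · exact ⟨x 0 0, fun h => absurd h hs⟩
  choose γ hγ using hγ
  have hγlip : LipschitzOnWith 1 γ A := by
    refine LipschitzOnWith.of_dist_le_mul fun s hs s' hs' => ?_
    obtain ⟨i, hi⟩ := hγ s hs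
    obtain ⟨i', hi'⟩ := hγ s' hs'
    simpa using hlim hi hi'
  have hγK : γ '' A ⊆ K := by
    rintro _ ⟨s, hs, rfl⟩
    obtain ⟨i, hi⟩ := hγ s hs
    exact hi.2.1
  have hnull : volume (φ '' (γ '' A)) = 0 := by
    rw [← hausdorffMeasure_real]
    refine le_antisymm ?_ zero_le
    simpa [hpu A γ 1 hγlip hγK] using hφ.hausdorffMeasure_image_le zero_le_one (γ '' A)
  obtain ⟨V, hVsub, hVo, hV⟩ := Set.exists_isOpen_lt_of_lt (φ '' (γ '' A)) (ENNReal.ofReal η)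
    (by rw [hnull]; exact ENNReal.ofReal_pos.2 hη)
  -- values that are attained only on cheap jumps, and avoid `V`
  have hz : ∀ k, ∃ z ∉ V, ∃ i ≤ n k, x k i ∈ Metric.thickening (r k) K ∧
      |φ (x k i) - z| ≤ C * r k := by
    intro k
    let s := (Finset.range (n k)).filter fun i =>
      ¬ (x k i ∈ Metric.thickening (r k) K ∧ dist (x k i) (x k (i + 1)) < r k)
    have hs : η + ∑ i ∈ s, |φ (x k i) - φ (x k (i + 1))| ≤ φ (x k 0) - φ (x k (n k)) := by
      have h1 : ∑ i ∈ s, |φ (x k i) - φ (x k (i + 1))| ≤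
          ∑ i ∈ Finset.range (n k), c k (x k i) (x k (i + 1)) :=
        (Finset.sum_le_sum fun i (hi : i ∈ s) =>
          hcφ k (x k i) (x k (i + 1)) fun h =>
            not_lt.1 fun h' => (Finset.mem_filter.1 hi).2 ⟨h, h'⟩).trans
          (Finset.sum_le_sum_of_subset_of_nonneg (Finset.filter_subset _ _) fun _ _ _ => hc0 _ _ _)
      linarith [hlt k]
    have hvol := le_volume_Icc_diff_biUnion_uIcc s _ _ hη.le hs
    have hnot : ¬ ((Set.Icc (φ (x k (n k))) (φ (x k 0)) \
        ⋃ i ∈ s, Set.uIcc (φ (x k i)) (φ (x k (i + 1)))) ⊆ V ∪ {φ (x k 0)}) := by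
      intro hsub
      refine (hvol.trans ((measure_mono hsub).trans (measure_union_le _ _))).not_gt ?_
      simpa using hV
    obtain ⟨z, ⟨hzI, hzs⟩, hzV⟩ := Set.not_subset.1 hnot
    simp only [Set.mem_union, Set.mem_singleton_iff, not_or] at hzV
    refine ⟨z, hzV.1, ?_⟩
    rcases exists_mem_uIcc_succ_of_mem_uIcc (fun i => φ (x k i)) (n k)
      (Set.Icc_subset_uIcc' hzI) with h | ⟨i, hi, hzi⟩
    · exact absurd h hzV.2
    have his : i ∉ s := fun h => hzs (Set.mem_biUnion (Finset.mem_coe.2 h) hzi)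
    have hcheap : x k i ∈ Metric.thickening (r k) K ∧ dist (x k i) (x k (i + 1)) < r k := by
      by_contra h
      exact his (Finset.mem_filter.2 ⟨Finset.mem_range.2 hi, h⟩)
    refine ⟨i, hi.le, hcheap.1, ?_⟩
    have h1 := Set.abs_sub_left_of_mem_uIcc hzi
    have h2 := hφ.dist_le_mul (x k i) (x k (i + 1))
    rw [Real.dist_eq, abs_sub_comm] at h2
    rw [abs_sub_comm]
    calc _ ≤ _ := h1
      _ ≤ _ := h2
      _ ≤ _ := by gcongr; exact hcheap.2.le
  choose z hzV i hi hiK hzi using hz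
  obtain ⟨s, -, hs⟩ := (isCompact_Icc (a := (0 : ℝ)) (b := 2 * M / κ)).exists_tendsto_ultrafilter U
    fun k => hlenmem k (i k) (hi k)
  choose y hyK hy using fun k => Metric.mem_thickening_iff.1 (hiK k)
  obtain ⟨p, hpK, hp⟩ := hK.exists_tendsto_ultrafilter U hyK
  have hxp : Tendsto (fun k => x k (i k)) U (𝓝 p) := by
    refine hp.congr_dist (squeeze_zero (fun _ => dist_nonneg) (fun k => ?_) hrU)
    rw [dist_comm]
    exact (hy k).le
  have hsp : IsLimit s p i := ⟨hi, hpK, hs, hxp⟩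
  have hsA : s ∈ A := ⟨p, i, hsp⟩
  obtain ⟨i', hi'⟩ := hγ s hsA
  have hpγ : p = γ s := dist_le_zero.1 (by simpa using hlim hsp hi')
  have hzp : Tendsto z U (𝓝 (φ p)) := by
    refine ((hφ.continuous.tendsto p).comp hxp).congr_dist
      (squeeze_zero (fun _ => dist_nonneg) (fun k => ?_) (by simpa using hrU.const_mul (C : ℝ)))
    rw [Real.dist_eq]
    exact hzi k
  have hev := hzp.eventually (hVo.mem_nhds (hVsub ⟨γ s, ⟨s, hsA, rfl⟩, congrArg φ hpγ.symm⟩))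
  obtain ⟨k, hk⟩ := hev.exists
  exact hzV k hk

/-- A function which is constant on long intervals, close to the identity there, and
`N`-Lipschitz overall. -/
theorem exists_lipschitz_staircase {N : ℕ} (hN : 0 < N) {τ : ℝ} (hτ : 0 < τ) (j : ℤ) :
    ∃ h : ℝ → ℝ, LipschitzWith N h ∧ ∀ z, ⌊z / τ⌋ % N ≠ j % N →
      |h z - z| ≤ N * τ ∧ h z = N * τ * ((⌊z / τ⌋ - j) / (N : ℤ) : ℤ) + j * τ := by
  have hN' : (0 : ℤ) < N := by exact_mod_cast hN
  let G : Set ℝ := {z | ⌊z / τ⌋ % N ≠ j % N}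
  let h : ℝ → ℝ := fun z => N * τ * ((⌊z / τ⌋ - j) / (N : ℤ) : ℤ) + j * τ
  have hfl : ∀ z : ℝ, (⌊z / τ⌋ : ℝ) * τ ≤ z ∧ z < (⌊z / τ⌋ + 1 : ℝ) * τ := fun z =>
    ⟨(le_div_iff₀ hτ).1 (Int.floor_le _), (div_lt_iff₀ hτ).1 (Int.lt_floor_add_one _)⟩
  -- on `G` the remainder is positive
  have hrem : ∀ z ∈ G, ∃ e : ℤ, 1 ≤ e ∧ e ≤ N - 1 ∧
      ⌊z / τ⌋ = N * ((⌊z / τ⌋ - j) / (N : ℤ)) + e + j := by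
    intro z hz
    refine ⟨(⌊z / τ⌋ - j) % N, ?_, ?_, ?_⟩
    · have h0 := Int.emod_nonneg (⌊z / τ⌋ - j) hN'.ne'
      have h1 : (⌊z / τ⌋ - j) % N ≠ 0 := fun h1 =>
        hz (Int.emod_eq_emod_iff_emod_sub_eq_zero.2 h1)
      omega
    · have := Int.emod_lt_of_pos (⌊z / τ⌋ - j) hN'
      omega
    · have := Int.mul_ediv_add_emod (⌊z / τ⌋ - j) N
      omega
  have hmono : ∀ z ∈ G, ∀ w ∈ G, z ≤ w → |h z - h w| ≤ N * |z - w| := by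
    intro z hz w hw hzw
    obtain ⟨e, he1, he2, he⟩ := hrem z hz
    obtain ⟨e', he1', he2', he'⟩ := hrem w hw
    set q := (⌊z / τ⌋ - j) / (N : ℤ)
    set q' := (⌊w / τ⌋ - j) / (N : ℤ)
    have hqq : q ≤ q' := Int.ediv_le_ediv hN'
      (sub_le_sub_right (Int.floor_le_floor (by gcongr)) _)
    have hh : h w - h z = N * τ * ((q' - q : ℤ) : ℝ) := by
      simp only [h]; push_cast; ring
    rw [abs_sub_comm, abs_sub_comm z w, hh, abs_of_nonneg (sub_nonneg.2 hzw), abs_of_nonneg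
      (by have : (0 : ℤ) ≤ q' - q := by omega
          positivity), mul_assoc]
    refine mul_le_mul_of_nonneg_left ?_ (by positivity)
    rcases hqq.eq_or_lt with heq | hlt
    · simp [heq, hzw]
    · have h1 : q' - q ≤ ⌊w / τ⌋ - ⌊z / τ⌋ - 1 := by
        have : (0 : ℤ) ≤ (N - 1) * (q' - q - 1) :=
          mul_nonneg (by omega) (by omega)
        nlinarith
      have h2 : ((q' - q : ℤ) : ℝ) ≤ ⌊w / τ⌋ - ⌊z / τ⌋ - 1 := by exact_mod_cast h1
      have h3 := (hfl z).2
      have h4 := (hfl w).1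
      nlinarith
  have hlip : LipschitzOnWith N h G := by
    refine LipschitzOnWith.of_dist_le_mul fun z hz w hw => ?_
    simp only [Real.dist_eq, NNReal.coe_natCast]
    rcases le_total z w with hzw | hzw
    · exact hmono z hz w hw hzw
    · rw [abs_sub_comm, abs_sub_comm z]
      exact hmono w hw z hz hzw
  obtain ⟨g, hg, hgh⟩ := hlip.extend_real
  refine ⟨g, hg, fun z hz => ?_⟩
  rw [← hgh hz]
  refine ⟨?_, rfl⟩
  obtain ⟨e, he1, he2, he⟩ := hrem z hz
  have he : (⌊z / τ⌋ : ℝ) = N * ((⌊z / τ⌋ - j) / (N : ℤ) : ℤ) + e + j := by exact_mod_cast he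
  have he1 : (1 : ℝ) ≤ e := by exact_mod_cast he1
  have he2 : (e : ℝ) ≤ N - 1 := by exact_mod_cast he2
  have h3 := hfl z
  rw [he] at h3
  simp only [h]
  rw [abs_le]
  constructor <;> nlinarith

/-- The largest function below `φ` whose increments are bounded by the symmetric cost `c`; it stays
close to `φ` if `φ` is almost compatible with the cost of chains. -/
theorem exists_le_of_chain_lower_bound {X : Type*} {φ : X → ℝ} {c : X → X → ℝ}
    (hsymm : ∀ x y, c x y = c y x) {η : ℝ}
    (hchain : ∀ (x : ℕ → X) (n : ℕ),
        φ (x 0) ≤ φ (x n) + ∑ i ∈ Finset.range n, c (x i) (x (i + 1)) + η) :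
    ∃ u : X → ℝ, (∀ x, φ x - η ≤ u x) ∧ (∀ x, u x ≤ φ x) ∧ ∀ x y, |u x - u y| ≤ c x y := by
  let P : X → Set ℝ := fun a => {s | ∃ (x : ℕ → X) (n : ℕ), x 0 = a ∧
    s = φ (x n) + ∑ i ∈ Finset.range n, c (x i) (x (i + 1))}
  have hlow : ∀ a, ∀ s ∈ P a, φ a - η ≤ s := by
    rintro a s ⟨x, n, rfl, rfl⟩
    linarith [hchain x n]
  have hself : ∀ a, φ a ∈ P a := fun a => ⟨fun _ => a, 0, rfl, by simp⟩
  have hbdd : ∀ a, BddBelow (P a) := fun a => ⟨_, fun s hs => hlow a s hs⟩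
  have hstep : ∀ a b, sInf (P a) ≤ c a b + sInf (P b) := by
    intro a b
    rw [← sub_le_iff_le_add']
    refine le_csInf ⟨_, hself b⟩ ?_
    rintro s ⟨x, n, rfl, rfl⟩
    rw [sub_le_iff_le_add']
    refine csInf_le (hbdd a) ⟨fun i => Nat.casesOn i a x, n + 1, rfl, ?_⟩
    rw [Finset.sum_range_succ']
    change c a (x 0) + (φ (x n) + _) = φ (x n) + (_ + c a (x 0))
    ring
  refine ⟨fun a => sInf (P a), fun a => le_csInf ⟨_, hself a⟩ (hlow a),
    fun a => csInf_le (hbdd a) (hself a), fun a b => abs_le.2 ⟨?_, ?_⟩⟩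
  · linarith [hstep b a, hsymm a b]
  · linarith [hstep a b]

/-- Among the `N` residue classes of an integer-valued measurable function, one has small
measure. -/
theorem exists_measure_emod_eq_le {X : Type*} [MeasurableSpace X] (μ : Measure X) {N : ℕ}
    (hN : 0 < N) {ε : ENNReal} (hε : μ Set.univ ≤ N * ε) {p : X → ℤ} (hp : Measurable p) :
    ∃ j : ℤ, μ {x | p x % N = j % N} ≤ ε := by
  by_contra! hcon
  have hmeas : ∀ j : ℕ, MeasurableSet {x | p x % N = (j : ℤ) % N} := fun j =>
    hp (MeasurableSet.of_discrete (s := {a : ℤ | a % N = (j : ℤ) % N}))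
  have hdisj : Set.PairwiseDisjoint (Finset.range N : Set ℕ)
      fun j : ℕ => {x | p x % N = (j : ℤ) % N} := by
    intro i hi j hj hij
    refine Set.disjoint_left.2 fun x hxi hxj => hij ?_
    have hi' : i < N := Finset.mem_range.1 hi
    have hj' : j < N := Finset.mem_range.1 hj
    have h : (i : ℤ) % N = (j : ℤ) % N := Eq.trans (Eq.symm hxi) hxj
    rw [Int.emod_eq_of_lt (by omega) (by omega), Int.emod_eq_of_lt (by omega) (by omega)] at h
    exact_mod_cast h
  have h1 : ∑ j ∈ Finset.range N, μ {x | p x % N = ((j : ℕ) : ℤ) % N} ≤ μ Set.univ := by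
    rw [← measure_biUnion_finset hdisj fun j _ => hmeas j]
    exact measure_mono (Set.subset_univ _)
  have h2 : ∑ _j ∈ Finset.range N, ε < ∑ j ∈ Finset.range N, μ {x | p x % N = ((j : ℕ) : ℤ) % N} :=
    ENNReal.sum_lt_sum_of_nonempty (Finset.nonempty_range_iff.2 hN.ne') fun j _ => hcon j
  simp only [Finset.sum_const, Finset.card_range, nsmul_eq_mul] at h2
  exact (h2.trans_le (h1.trans hε)).false

/-- Let `K` be a compact set in which every Lipschitz curve fragment has zero length. A bounded
function whose increments are strictly dominated by `ρ` can be perturbed, keeping its increments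
below `ρ`, to take only finitely many values on most of `K`. -/
theorem exists_perturbation_finite_image {X : Type*} [MetricSpace X] [MeasurableSpace X]
    [BorelSpace X] (μ : Measure X) [IsFiniteMeasure μ] {K : Set X} (hK : IsCompact K)
    (hpu : ∀ (A : Set ℝ) (γ : ℝ → X) (C : NNReal),
      LipschitzOnWith C γ A → γ '' A ⊆ K → μH[1] (γ '' A) = 0)
    {φ : X → ℝ} {M : ℝ} (hM : ∀ x, |φ x| ≤ M) {ρ : X → X → ℝ} (hsymm : ∀ x y, ρ x y = ρ y x)
    {a b θ : ℝ} (ha : 0 < a) (hρa : ∀ x y, a * dist x y ≤ ρ x y)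
    (hρb : ∀ x y, ρ x y ≤ b * dist x y) (hθ0 : 0 < θ) (hθ1 : θ < 1)
    (hφ : ∀ x y, |φ x - φ y| ≤ θ * ρ x y) {η : ℝ} (hη : 0 < η) {ε : ENNReal} (hε : ε ≠ 0) :
    ∃ (v : X → ℝ) (B : Set X), (∀ x, |v x - φ x| ≤ η) ∧ (∀ x y, |v x - v y| ≤ ρ x y) ∧
      (v '' B).Finite ∧ μ Bᶜ ≤ μ Kᶜ + ε := by
  classical
  have hρ0 : ∀ x y, 0 ≤ ρ x y := fun x y => (mul_nonneg ha.le dist_nonneg).trans (hρa x y)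
  rcases K.eq_empty_or_nonempty with rfl | hKne
  · exact ⟨φ, ∅, by simp [hη.le], fun x y => (hφ x y).trans
      (mul_le_of_le_one_left (hρ0 x y) hθ1.le), by simp, by simp⟩
  obtain ⟨N, hN, hNε⟩ : ∃ N : ℕ, 0 < N ∧ μ Set.univ ≤ N * ε := by
    obtain ⟨N, hN⟩ := ENNReal.exists_nat_mul_gt hε (measure_ne_top μ Set.univ)
    refine ⟨N + 1, N.succ_pos, hN.le.trans ?_⟩
    gcongr
    exact_mod_cast N.le_succ
  have hN1 : (1 : ℝ) ≤ N := by exact_mod_cast hN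
  have hlip : ∀ {w : X → ℝ}, (∀ x y, |w x - w y| ≤ θ * ρ x y) →
      LipschitzWith (θ * b).toNNReal w := fun {w} hw =>
    LipschitzWith.of_dist_le_mul fun x y => by
      calc dist (w x) (w y) ≤ θ * ρ x y := hw x y
        _ ≤ θ * (b * dist x y) := by gcongr; exact hρb x y
        _ = θ * b * dist x y := by ring
        _ ≤ _ := by gcongr; exact Real.le_coe_toNNReal _
  obtain ⟨r, hr, hchain⟩ := exists_radius_chain_lower_bound hK hpu (hlip hφ) hM
    (κ := θ / N * a) (η := η / 2) (by positivity) (by positivity)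
  let c : X → X → ℝ := fun x y =>
    if x ∈ Metric.thickening r K ∧ y ∈ Metric.thickening r K ∧ dist x y < r then θ / N * ρ x y
    else θ * ρ x y
  have hθN : θ / N ≤ θ := div_le_self hθ0.le hN1
  have hcθ : ∀ x y, c x y ≤ θ * ρ x y := by
    intro x y
    simp only [c]
    split_ifs
    · exact mul_le_mul_of_nonneg_right hθN (hρ0 x y)
    · exact le_rfl
  have hcN : ∀ x y, θ / N * ρ x y ≤ c x y := by
    intro x y
    simp only [c]
    split_ifs
    · exact le_rfl
    · exact mul_le_mul_of_nonneg_right hθN (hρ0 x y)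
  have hcsymm : ∀ x y, c x y = c y x := by
    intro x y
    simp only [c, hsymm x y, dist_comm x y]
    congr 1
    exact propext ⟨fun h => ⟨h.2.1, h.1, h.2.2⟩, fun h => ⟨h.2.1, h.1, h.2.2⟩⟩
  obtain ⟨u, hu1, hu2, huc⟩ := exists_le_of_chain_lower_bound hcsymm (hchain c
    (fun x y => by
      calc _ = θ / N * (a * dist x y) := by ring
        _ ≤ θ / N * ρ x y := by gcongr; exact hρa x y
        _ ≤ _ := hcN x y)
    (fun x y hxy => by
      have : c x y = θ * ρ x y := by
        refine if_neg fun h => hxy ⟨h.1, h.2.2⟩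
      rw [this]
      exact hφ x y))
  have huθ : ∀ x y, |u x - u y| ≤ θ * ρ x y := fun x y => (huc x y).trans (hcθ x y)
  have hum : Measurable u := (hlip huθ).continuous.measurable
  set l : ℝ := (1 - θ) * a with hl
  have hl0 : 0 < l := mul_pos (by linarith) ha
  have hlρ : ∀ x y, l * dist x y ≤ (1 - θ) * ρ x y := fun x y => by
    rw [hl, mul_assoc]
    exact mul_le_mul_of_nonneg_left (hρa x y) (by linarith)
  obtain ⟨t, ht0, htη, htr⟩ : ∃ t : ℝ, 0 < t ∧ t ≤ η / 2 ∧ 4 * t ≤ l * r :=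
    ⟨min (η / 2) (l * r / 4), by positivity, min_le_left _ _, by
      linarith [min_le_right (η / 2) (l * r / 4)]⟩
  have hτ : 0 < t / N := by positivity
  obtain ⟨j, hj⟩ := exists_measure_emod_eq_le μ hN hNε (p := fun x => ⌊u x / (t / N)⌋)
    (hum.div_const _).floor
  obtain ⟨h, hh, hhj⟩ := exists_lipschitz_staircase hN hτ j
  have hNt : (N : ℝ) * (t / N) = t := by field_simp
  rw [hNt] at hhj
  let σ : X → ℝ := fun x => max 0 (t - l * Metric.infDist x K)
  have hσt : ∀ x, σ x ≤ t := fun x =>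
    max_le ht0.le (by nlinarith [Metric.infDist_nonneg (x := x) (s := K)])
  have hσ0 : ∀ x, 0 ≤ σ x := fun x => le_max_left _ _
  have hσlip : ∀ x y, |σ x - σ y| ≤ (1 - θ) * ρ x y := by
    intro x y
    have h1 := abs_max_sub_max_le_max 0 (t - l * Metric.infDist x K) 0 (t - l * Metric.infDist y K)
    have h2 : |t - l * Metric.infDist x K - (t - l * Metric.infDist y K)| ≤ l * dist x y := by
      rw [show t - l * Metric.infDist x K - (t - l * Metric.infDist y K) =
        l * (Metric.infDist y K - Metric.infDist x K) by ring, abs_mul, abs_of_pos hl0]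
      refine mul_le_mul_of_nonneg_left (abs_le.2 ⟨?_, ?_⟩) hl0.le
      · linarith [Metric.infDist_le_infDist_add_dist (s := K) (x := x) (y := y)]
      · linarith [Metric.infDist_le_infDist_add_dist (s := K) (x := y) (y := x), dist_comm x y]
    refine h1.trans ((max_le ?_ h2).trans (hlρ x y))
    simpa using mul_nonneg hl0.le dist_nonneg
  let v : X → ℝ := fun x => max (u x - σ x) (min (u x + σ x) (h (u x)))
  have hvu : ∀ x, |v x - u x| ≤ σ x := by
    intro x
    rw [abs_le]
    constructor
    · linarith [le_max_left (u x - σ x) (min (u x + σ x) (h (u x)))]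
    · have : v x ≤ u x + σ x := max_le (by linarith [hσ0 x]) (min_le_left _ _)
      linarith
  have hnear : ∀ x y, 0 < σ x → dist x y < r / 2 → |v x - v y| ≤ ρ x y := by
    intro x y hx hxy
    have hxK : Metric.infDist x K < r / 2 := by
      have : 0 < t - l * Metric.infDist x K := by
        by_contra hcon
        exact hx.ne' (max_eq_left (not_lt.1 hcon))
      by_contra hcon
      nlinarith
    have hyK : Metric.infDist y K < r := by
      linarith [Metric.infDist_le_infDist_add_dist (s := K) (x := y) (y := x), dist_comm x y]
    have hxT : x ∈ Metric.thickening r K :=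
      (Metric.mem_thickening_iff_infDist_lt hKne).2 (by linarith)
    have hyT : y ∈ Metric.thickening r K := (Metric.mem_thickening_iff_infDist_lt hKne).2 hyK
    have hcc : c x y = θ / N * ρ x y := if_pos ⟨hxT, hyT, by linarith⟩
    have h1 : |h (u x) - h (u y)| ≤ ρ x y := by
      have := hh.dist_le_mul (u x) (u y)
      simp only [Real.dist_eq, NNReal.coe_natCast] at this
      calc _ ≤ _ := this
        _ ≤ N * (θ / N * ρ x y) := by gcongr; exact hcc ▸ huc x y
        _ = θ * ρ x y := by field_simp
        _ ≤ ρ x y := mul_le_of_le_one_left (hρ0 x y) hθ1.le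
    have h2 := abs_le.1 (hσlip x y)
    have h3 := abs_le.1 (huθ x y)
    refine (abs_max_sub_max_le_max _ _ _ _).trans (max_le ?_
      ((abs_min_sub_min_le_max _ _ _ _).trans (max_le ?_ h1)))
    · exact abs_le.2 ⟨by linarith, by linarith⟩
    · exact abs_le.2 ⟨by linarith, by linarith⟩
  refine ⟨v, K ∩ {x | ⌊u x / (t / N)⌋ % N ≠ j % N}, fun x => ?_, fun x y => ?_, ?_, ?_⟩
  · have h1 := abs_le.1 ((hvu x).trans (hσt x))
    exact abs_le.2 ⟨by linarith [hu1 x], by linarith [hu2 x]⟩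
  · rcases lt_or_ge (dist x y) (r / 2) with hxy | hxy
    · rcases (hσ0 x).lt_or_eq with hx | hx
      · exact hnear x y hx hxy
      rcases (hσ0 y).lt_or_eq with hy | hy
      · rw [abs_sub_comm, hsymm]
        exact hnear y x hy (by rwa [dist_comm])
      have h1 := hvu x
      have h2 := hvu y
      rw [← hx, abs_nonpos_iff, sub_eq_zero] at h1
      rw [← hy, abs_nonpos_iff, sub_eq_zero] at h2
      rw [h1, h2]
      exact (huθ x y).trans (mul_le_of_le_one_left (hρ0 x y) hθ1.le)
    · have h1 := abs_le.1 ((hvu x).trans (hσt x))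
      have h2 := abs_le.1 ((hvu y).trans (hσt y))
      have h3 := abs_le.1 (huθ x y)
      have h4 := hlρ x y
      have h5 : l * (r / 2) ≤ l * dist x y := by gcongr
      exact abs_le.2 ⟨by linarith, by linarith⟩
  · let R : ℝ := M + η
    have hfin : (Set.Icc ⌈(-R - j * (t / N)) / t⌉ ⌊(R - j * (t / N)) / t⌋).Finite :=
      Set.finite_Icc _ _
    refine (hfin.image fun q : ℤ => t * (q : ℝ) + j * (t / N)).subset ?_
    rintro _ ⟨x, ⟨hxK, hxj⟩, rfl⟩
    obtain ⟨h1, h2⟩ := hhj (u x) hxj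
    have hσx : σ x = t := by
      simp only [σ, Metric.infDist_zero_of_mem hxK, mul_zero, sub_zero]
      exact max_eq_right ht0.le
    have h1' := abs_le.1 h1
    have hv : v x = h (u x) := by
      simp only [v, hσx]
      rw [min_eq_right (by linarith), max_eq_right (by linarith)]
    have h3 := abs_le.1 (hM x)
    have h4 : |v x| ≤ R := by
      have := abs_le.1 ((hvu x).trans (hσt x))
      exact abs_le.2 ⟨by linarith [hu1 x], by linarith [hu2 x]⟩
    have h4 := abs_le.1 h4
    rw [hv, h2] at h4 ⊢
    refine ⟨_, ⟨?_, ?_⟩, rfl⟩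
    · rw [Int.ceil_le, div_le_iff₀ ht0]
      linarith
    · rw [Int.le_floor, le_div_iff₀ ht0]
      linarith
  · rw [Set.compl_inter]
    refine (measure_union_le _ _).trans (add_le_add le_rfl ?_)
    exact (measure_mono fun x hx => not_not.1 hx).trans hj

/-- A finite measure concentrated on a separable subset of a complete metric space is concentrated,
up to arbitrarily small measure, on a compact part of it. -/
theorem exists_isCompact_subset_measure_compl_le {X : Type*} [MetricSpace X] [CompleteSpace X]
    [MeasurableSpace X] [BorelSpace X] {S : Set X} (hS : TopologicalSpace.IsSeparable S)
    (μ : Measure X) [IsFiniteMeasure μ] (hμS : μ Sᶜ = 0) {ε : ENNReal} (hε : ε ≠ 0) :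
    ∃ K ⊆ S, IsCompact K ∧ μ Kᶜ ≤ ε := by
  have hε2 : ε / 2 ≠ 0 := (ENNReal.half_pos hε).ne'
  obtain ⟨F, hFS, hFc, hF⟩ := (measurableSet_toMeasurable μ Sᶜ).compl.exists_isClosed_sdiff_lt
    (measure_ne_top μ _) hε2
  have hFS' : F ⊆ S := hFS.trans (Set.compl_subset_comm.1 (subset_toMeasurable μ Sᶜ))
  have : CompleteSpace F := hFc.completeSpace_coe
  have : TopologicalSpace.SeparableSpace F := (hS.mono hFS').separableSpace
  have : SecondCountableTopology F := UniformSpace.secondCountable_of_separable F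
  have : IsFiniteMeasure (μ.comap (Subtype.val : F → X)) :=
    ⟨by
      rw [(MeasurableEmbedding.subtype_coe hFc.measurableSet).comap_apply]
      exact measure_lt_top μ _⟩
  obtain ⟨Q, -, hQ, hQε⟩ := (MeasurableSet.univ (α := F)).exists_isCompact_sdiff_lt
    (μ := μ.comap (Subtype.val : F → X)) (measure_ne_top _ _) hε2
  refine ⟨Subtype.val '' Q, ?_, hQ.image continuous_subtype_val, ?_⟩
  · rintro _ ⟨x, -, rfl⟩
    exact hFS' x.2
  have h1 : (Subtype.val '' Q)ᶜ ⊆ toMeasurable μ Sᶜ ∪ ((toMeasurable μ Sᶜ)ᶜ \ F) ∪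
      Subtype.val '' (Set.univ \ Q) := by
    intro x hx
    by_cases hxF : x ∈ F
    · exact Or.inr ⟨⟨x, hxF⟩, ⟨trivial, fun h => hx ⟨_, h, rfl⟩⟩, rfl⟩
    · by_cases hxT : x ∈ toMeasurable μ Sᶜ
      · exact Or.inl (Or.inl hxT)
      · exact Or.inl (Or.inr ⟨hxT, hxF⟩)
  rw [(MeasurableEmbedding.subtype_coe hFc.measurableSet).comap_apply] at hQε
  refine (measure_mono h1).trans ((measure_union_le _ _).trans ?_)
  calc _ ≤ (μ (toMeasurable μ Sᶜ) + μ ((toMeasurable μ Sᶜ)ᶜ \ F)) + ε / 2 :=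
        add_le_add (measure_union_le _ _) hQε.le
    _ ≤ (0 + ε / 2) + ε / 2 := by
        rw [measure_toMeasurable, hμS]
        gcongr
    _ = ε := by rw [zero_add, ENNReal.add_halves]

/-- The increments of a map into `ℝ^m` after changing a single coordinate. -/
theorem sum_sq_update_sub {ι : Type*} [Fintype ι] [DecidableEq ι] (f g : ι → ℝ) (i : ι)
    (s t : ℝ) :
    ∑ j, (Function.update f i s j - Function.update g i t j) ^ 2 =
      (s - t) ^ 2 + ∑ j ∈ Finset.univ.erase i, (f j - g j) ^ 2 := by
  rw [← Finset.add_sum_erase _ _ (Finset.mem_univ i)]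
  congr 1
  · simp
  · refine Finset.sum_congr rfl fun j hj => ?_
    simp [Finset.ne_of_mem_erase hj]

/-- A map into `ℝ^m` with Lipschitz constant less than `1` can be perturbed one coordinate at a
time so that the chosen coordinates take finitely many values on a set of almost full measure. -/
theorem exists_perturbation_finite_coordinates {X : Type*} [MetricSpace X] [CompleteSpace X]
    [MeasurableSpace X] [BorelSpace X] {S : Set X} (hSsep : TopologicalSpace.IsSeparable S)
    (hpu : ∀ (A : Set ℝ) (γ : ℝ → X) (K : NNReal),
      LipschitzOnWith K γ A → μH[1] (γ '' A ∩ S) = 0)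
    (μ : Measure X) [IsFiniteMeasure μ] (hμS : μ Sᶜ = 0) {ι : Type*} [Fintype ι] (s : Finset ι)
    {f : X → ι → ℝ} {M : ℝ} (hM : ∀ x i, |f x i| ≤ M) {L : ℝ} (hL0 : 0 < L) (hL1 : L < 1)
    (hf : ∀ x y, ∑ i, (f x i - f y i) ^ 2 ≤ (L * dist x y) ^ 2)
    {η : ℝ} (hη : 0 < η) {ε : ENNReal} (hε : ε ≠ 0) :
    ∃ (g : X → ι → ℝ) (B : Set X), (∃ L' : ℝ, 0 < L' ∧ L' < 1 ∧
        ∀ x y, ∑ i, (g x i - g y i) ^ 2 ≤ (L' * dist x y) ^ 2) ∧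
      (∀ x i, |g x i - f x i| ≤ η) ∧ (∀ i ∈ s, ((fun x => g x i) '' B).Finite) ∧ μ Bᶜ ≤ ε := by
  classical
  induction s using Finset.induction_on generalizing ε η with
  | empty => exact ⟨f, Set.univ, ⟨L, hL0, hL1, hf⟩, by simp [hη.le], by simp, by simp⟩
  | insert i s his ih =>
    obtain ⟨g, B, ⟨L', hL'0, hL'1, hg⟩, hgf, hgB, hB⟩ := ih (half_pos hη) (ENNReal.half_pos hε).ne'
    have hε4 : ε / 2 / 2 ≠ 0 := (ENNReal.half_pos (ENNReal.half_pos hε).ne').ne'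
    obtain ⟨K, hKS, hK, hKε⟩ := exists_isCompact_subset_measure_compl_le hSsep μ hμS hε4
    set l : ℝ := (1 + L') / 2 with hl
    have hl0 : 0 < l := by linarith
    have hL'l : L' < l := by linarith
    have hgM : ∀ x, |g x i| ≤ M + η / 2 := fun x => by
      have h1 := abs_le.1 (hM x i)
      have h2 := abs_le.1 (hgf x i)
      exact abs_le.2 ⟨by linarith, by linarith⟩
    let Q : X → X → ℝ := fun x y => ∑ j ∈ Finset.univ.erase i, (g x j - g y j) ^ 2
    have hQ0 : ∀ x y, 0 ≤ Q x y := fun x y => Finset.sum_nonneg fun _ _ => sq_nonneg _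
    have hQ : ∀ x y, (g x i - g y i) ^ 2 + Q x y ≤ (L' * dist x y) ^ 2 := fun x y => by
      have := hg x y
      rwa [← Finset.add_sum_erase _ _ (Finset.mem_univ i)] at this
    have hlL : 0 < l ^ 2 - L' ^ 2 := by nlinarith
    have hρ0 : ∀ x y, 0 ≤ (l * dist x y) ^ 2 - Q x y := fun x y => by
      nlinarith [hQ x y, sq_nonneg (g x i - g y i), mul_nonneg hlL.le (sq_nonneg (dist x y))]
    obtain ⟨v, B', hvg, hv, hvB', hB'⟩ := exists_perturbation_finite_image μ hK
      (fun A γ C hγ hγK => by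
        have := hpu A γ C hγ
        rwa [Set.inter_eq_left.2 (hγK.trans hKS)] at this)
      hgM (ρ := fun x y => √((l * dist x y) ^ 2 - Q x y))
      (fun x y => by
        have : Q x y = Q y x := Finset.sum_congr rfl fun j _ => by ring
        rw [this, dist_comm])
      (a := √(l ^ 2 - L' ^ 2)) (b := l) (θ := L' / l) (Real.sqrt_pos.2 hlL)
      (fun x y => by
        refine Real.le_sqrt_of_sq_le ?_
        rw [mul_pow, Real.sq_sqrt hlL.le]
        nlinarith [hQ x y, sq_nonneg (g x i - g y i)])
      (fun x y => Real.sqrt_le_iff.2 ⟨by positivity, by linarith [hQ0 x y]⟩)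
      (by positivity) ((div_lt_one hl0).2 hL'l)
      (fun x y => by
        refine abs_le_of_sq_le_sq ?_ (by positivity)
        rw [mul_pow, Real.sq_sqrt (hρ0 x y)]
        have h1 : (L' / l) ^ 2 * (l * dist x y) ^ 2 = (L' * dist x y) ^ 2 := by
          field_simp
        have h2 : (L' / l) ^ 2 ≤ 1 := by
          rw [div_pow, div_le_one (by positivity)]
          linarith
        nlinarith [hQ x y, hQ0 x y])
      (half_pos hη) hε4
    refine ⟨fun x => Function.update (g x) i (v x), B ∩ B', ⟨l, hl0, by linarith, fun x y => ?_⟩,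
      fun x j => ?_, fun j hj => ?_, ?_⟩
    · rw [sum_sq_update_sub]
      have h1 : (v x - v y) ^ 2 ≤ (l * dist x y) ^ 2 - Q x y := by
        rw [← Real.sq_sqrt (hρ0 x y)]
        exact sq_le_sq.2 ((hv x y).trans (le_abs_self _))
      have h2 : Q x y = ∑ j ∈ Finset.univ.erase i, (g x j - g y j) ^ 2 := rfl
      linarith
    · have h1 := abs_le.1 (hgf x j)
      rcases eq_or_ne j i with rfl | hji
      · have h2 := abs_le.1 (hvg x)
        simp only [Function.update_self]
        exact abs_le.2 ⟨by linarith, by linarith⟩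
      · simp only [Function.update_of_ne hji]
        exact abs_le.2 ⟨by linarith, by linarith⟩
    · rcases eq_or_ne j i with rfl | hji
      · simp only [Function.update_self]
        exact hvB'.subset (Set.image_mono Set.inter_subset_right)
      · simp only [Function.update_of_ne hji]
        exact (hgB j (Finset.mem_of_mem_insert_of_ne hj hji)).subset
          (Set.image_mono Set.inter_subset_left)
    · rw [Set.compl_inter]
      calc _ ≤ μ Bᶜ + μ B'ᶜ := measure_union_le _ _
        _ ≤ ε / 2 + (ε / 2 / 2 + ε / 2 / 2) :=
          add_le_add hB (hB'.trans (add_le_add hKε le_rfl))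
        _ = ε := by rw [ENNReal.add_halves, ENNReal.add_halves]

/-- A set covered, for all large `n`, by few balls of small radius has Hausdorff dimension zero. -/
theorem dimH_eq_zero_of_eventually_finset_cover {E : Type*} [MetricSpace E] {s : Set E}
    (F : ℕ → Finset E) (δ : ℕ → ℝ)
    (hδ : ∀ n, ENNReal.ofReal (2 * δ n) ≤ (1 / 2) ^ n)
    (hF : ∀ n, (F n).card * ENNReal.ofReal (2 * δ n) ^ (1 / ((n : ℝ) + 1)) ≤ (1 / 2) ^ n)
    (hs : ∀ᶠ n in atTop, ∀ x ∈ s, ∃ p ∈ F n, dist x p < δ n) : dimH s = 0 := by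
  borelize E
  have hpow : Tendsto (fun n : ℕ => (1 / 2 : ENNReal) ^ n) atTop (nhds 0) :=
    ENNReal.tendsto_pow_atTop_nhds_zero_of_lt_one (by simp)
  have hdiam : ∀ n, ∀ p : F n, Metric.ediam (Metric.ball (p : E) (δ n)) ≤
      ENNReal.ofReal (2 * δ n) := by
    intro n p
    rw [← Metric.eball_ofReal]
    refine Metric.ediam_eball_le.trans_eq ?_
    rw [ENNReal.ofReal_mul (by norm_num)]
    simp
  have hzero : ∀ d : NNReal, 0 < d → μH[(d : ℝ)] s = 0 := by
    intro d hd
    refine le_antisymm ?_ zero_le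
    refine (Measure.hausdorffMeasure_le_liminf_sum (d : ℝ) s (l := atTop) _ hpow
      (fun n (p : F n) => Metric.ball (p : E) (δ n))
      (Eventually.of_forall fun n p => (hdiam n p).trans (hδ n)) ?_).trans ?_
    · filter_upwards [hs] with n hn x hx
      obtain ⟨p, hp, hxp⟩ := hn x hx
      exact Set.mem_iUnion.2 ⟨⟨p, hp⟩, hxp⟩
    · rw [← hpow.liminf_eq]
      have hlarge : ∀ᶠ n : ℕ in atTop, 1 / ((n : ℝ) + 1) ≤ d :=
        (tendsto_one_div_add_atTop_nhds_zero_nat (𝕜 := ℝ)).eventually_le_const (by exact_mod_cast hd)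
      refine liminf_le_liminf ?_
      filter_upwards [hlarge] with n hn
      calc ∑ p : F n, Metric.ediam (Metric.ball (p : E) (δ n)) ^ (d : ℝ)
          ≤ ∑ _p : F n, ENNReal.ofReal (2 * δ n) ^ (1 / ((n : ℝ) + 1)) := by
            refine Finset.sum_le_sum fun p _ => ?_
            refine (ENNReal.rpow_le_rpow (hdiam n p) d.2).trans ?_
            refine ENNReal.rpow_le_rpow_of_exponent_ge ((hδ n).trans ?_) hn
            exact pow_le_one₀ zero_le (by simp)
        _ ≤ _ := by simpa using hF n
  refine le_antisymm ?_ zero_le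
  refine ENNReal.le_of_forall_pos_le_add fun d hd _ => ?_
  rw [zero_add]
  exact dimH_le_of_hausdorffMeasure_ne_top (by simp [hzero d hd])

/-- Scaling and perturbing the coordinates: maps with finite image on a set of almost full measure
are dense among the bounded `1`-Lipschitz maps. -/
theorem exists_dist_lt_finite_image {X : Type*} [MetricSpace X] [CompleteSpace X]
    [MeasurableSpace X] [BorelSpace X] {S : Set X} (hSsep : TopologicalSpace.IsSeparable S)
    (hpu : ∀ (A : Set ℝ) (γ : ℝ → X) (K : NNReal),
      LipschitzOnWith K γ A → μH[1] (γ '' A ∩ S) = 0)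
    (μ : Measure X) [IsFiniteMeasure μ] (hμS : μ Sᶜ = 0) {m : ℕ}
    {f : BoundedContinuousFunction X (EuclideanSpace ℝ (Fin m))} (hf : LipschitzWith 1 f)
    {δ : ℝ} (hδ : 0 < δ) {ε : ENNReal} (hε : ε ≠ 0) :
    ∃ g : BoundedContinuousFunction X (EuclideanSpace ℝ (Fin m)), LipschitzWith 1 g ∧
      dist g f < δ ∧ ∃ B : Set X, (g '' B).Finite ∧ μ Bᶜ ≤ ε := by
  have hfM : ∀ x i, |f x i| ≤ ‖f‖ := fun x i =>
    (PiLp.norm_apply_le (f x) i).trans (f.norm_coe_le_norm x)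
  set η : ℝ := δ / (4 * (m + 1)) with hη
  have hη0 : 0 < η := by positivity
  obtain ⟨a, ha0, ha1, ha⟩ : ∃ a : ℝ, 0 < a ∧ a < 1 ∧ a * ‖f‖ ≤ η := by
    refine ⟨min (1 / 2) (η / (‖f‖ + 1)), by positivity,
      (min_le_left _ _).trans_lt (by norm_num), ?_⟩
    calc _ ≤ η / (‖f‖ + 1) * (‖f‖ + 1) := by
          gcongr
          · exact min_le_right _ _
          · linarith
      _ = η := by field_simp
  have hsq : ∀ x y, ∑ i, (f x i - f y i) ^ 2 ≤ dist x y ^ 2 := fun x y => by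
    have h1 := hf.dist_le_mul x y
    rw [EuclideanSpace.dist_eq, NNReal.coe_one, one_mul, Real.sqrt_le_iff] at h1
    simpa [Real.dist_eq, sq_abs] using h1.2
  obtain ⟨g, B, ⟨L, hL0, hL1, hg⟩, hgf, hgB, hB⟩ := exists_perturbation_finite_coordinates hSsep
    hpu μ hμS Finset.univ (f := fun x i => (1 - a) * f x i) (M := ‖f‖) (L := 1 - a)
    (fun x i => by
      rw [abs_mul, abs_of_pos (by linarith)]
      exact (mul_le_of_le_one_left (abs_nonneg _) (by linarith)).trans (hfM x i))
    (by linarith) (by linarith)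
    (fun x y => by
      simp only [← mul_sub, mul_pow, ← Finset.mul_sum]
      exact mul_le_mul_of_nonneg_left (hsq x y) (sq_nonneg _))
    hη0 hε
  let G : X → EuclideanSpace ℝ (Fin m) := fun x => WithLp.toLp 2 (g x)
  have hG : LipschitzWith 1 G := by
    refine LipschitzWith.of_dist_le_mul fun x y => ?_
    rw [EuclideanSpace.dist_eq, NNReal.coe_one, one_mul, Real.sqrt_le_iff]
    refine ⟨dist_nonneg, ?_⟩
    simp only [G, Real.dist_eq, sq_abs]
    refine (hg x y).trans (pow_le_pow_left₀ (by positivity) ?_ 2)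
    exact mul_le_of_le_one_left dist_nonneg hL1.le
  have hGf : ∀ x, dist (G x) (f x) ≤ δ / 2 := by
    intro x
    rw [EuclideanSpace.dist_eq, Real.sqrt_le_iff]
    refine ⟨by positivity, ?_⟩
    calc ∑ i, dist (G x i) (f x i) ^ 2 ≤ ∑ _i : Fin m, (2 * η) ^ 2 := by
          refine Finset.sum_le_sum fun i _ => pow_le_pow_left₀ dist_nonneg ?_ 2
          rw [Real.dist_eq]
          have h1 := abs_le.1 (hgf x i)
          have h2 : |a * f x i| ≤ η := by
            rw [abs_mul, abs_of_pos ha0]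
            exact (mul_le_mul_of_nonneg_left (hfM x i) ha0.le).trans ha
          have h2 := abs_le.1 h2
          simp only [G]
          exact abs_le.2 ⟨by linarith, by linarith⟩
      _ = m * (2 * η) ^ 2 := by simp
      _ ≤ (m + 1) ^ 2 * (2 * η) ^ 2 := by gcongr; nlinarith [(Nat.cast_nonneg m : (0 : ℝ) ≤ m)]
      _ = (δ / 2) ^ 2 := by rw [hη]; field_simp; ring
  refine ⟨BoundedContinuousFunction.ofNormedAddCommGroup G hG.continuous (‖f‖ + δ / 2) fun x => ?_,
    hG, ?_, B, ?_, hB⟩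
  · have h1 := f.norm_coe_le_norm x
    have h2 := hGf x
    rw [dist_eq_norm] at h2
    linarith [norm_le_norm_add_norm_sub' (G x) (f x)]
  · refine lt_of_le_of_lt ((BoundedContinuousFunction.dist_le (by positivity)).2 hGf) ?_
    linarith
  · have hpi : (Set.univ.pi fun i => (fun x => g x i) '' B).Finite :=
      Set.Finite.pi fun i => hgB i (Finset.mem_univ i)
    refine (hpi.image (WithLp.toLp 2)).subset ?_
    rintro _ ⟨x, hx, rfl⟩
    exact ⟨g x, fun i _ => ⟨x, hx, rfl⟩, rfl⟩

/-- Let `X` be a complete metric space and `S ⊆ X` a separable, purely 1-unrectifiable subset.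
Then for every finite Borel measure `μ` on `X` supported on `S` and every `m ∈ ℕ`, the set of
bounded 1-Lipschitz maps `f : X → ℝ^m` for which there is a `μ`-null set `N ⊆ S` with
`dimH (f '' (S \ N)) = 0` is residual in `Lip₁(X, ℝ^m)`. -/
theorem stmt_1 (X : Type*) [MetricSpace X] [CompleteSpace X]
    [MeasurableSpace X] [BorelSpace X]
    (S : Set X) (hSsep : TopologicalSpace.IsSeparable S)
    (hpu : ∀ (A : Set ℝ) (γ : ℝ → X) (K : NNReal),
      LipschitzOnWith K γ A → μH[1] (γ '' A ∩ S) = 0)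
    (μ : Measure X) [IsFiniteMeasure μ] (hμS : μ Sᶜ = 0) (m : ℕ) :
    {f : {g : BoundedContinuousFunction X (EuclideanSpace ℝ (Fin m)) // LipschitzWith 1 ⇑g} |
        ∃ N ⊆ S, μ N = 0 ∧ dimH (⇑f.1 '' (S \ N)) = 0} ∈
      residual {g : BoundedContinuousFunction X (EuclideanSpace ℝ (Fin m)) // LipschitzWith 1 ⇑g} := by
  let U : ℕ → Set {g : BoundedContinuousFunction X (EuclideanSpace ℝ (Fin m)) //
      LipschitzWith 1 ⇑g} := fun n =>
    {f | ∃ (F : Finset (EuclideanSpace ℝ (Fin m))) (δ : ℝ) (B : Set X), μ Bᶜ ≤ (1 / 2) ^ n ∧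
      ENNReal.ofReal (2 * δ) ≤ (1 / 2) ^ n ∧
      F.card * ENNReal.ofReal (2 * δ) ^ (1 / ((n : ℝ) + 1)) ≤ (1 / 2) ^ n ∧
      ∃ g : {g : BoundedContinuousFunction X (EuclideanSpace ℝ (Fin m)) // LipschitzWith 1 ⇑g},
        dist f g < δ ∧ ∀ x ∈ B, g.1 x ∈ F}
  have hUo : ∀ n, IsOpen (U n) := by
    intro n
    refine isOpen_iff_mem_nhds.2 ?_
    rintro f ⟨F, δ, B, hB, hδ, hF, g, hfg, hg⟩
    filter_upwards [Metric.isOpen_ball.mem_nhds (Metric.mem_ball.2 hfg)] with f' hf'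
    exact ⟨F, δ, B, hB, hδ, hF, g, hf', hg⟩
  have hUd : ∀ n, Dense (U n) := by
    intro n
    refine Metric.dense_iff.2 fun f r hr => ?_
    have hε : (1 / 2 : ENNReal) ^ n ≠ 0 := pow_ne_zero _ (by simp)
    obtain ⟨g, hg, hgf, B, hgB, hB⟩ :=
      exists_dist_lt_finite_image hSsep hpu μ hμS f.2 hr hε
    refine ⟨⟨g, hg⟩, hgf, ?_⟩
    have h1 : Tendsto (fun δ : ℝ => ENNReal.ofReal (2 * δ)) (nhdsWithin 0 (Set.Ioi 0)) (nhds 0) := by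
      have : Continuous fun δ : ℝ => ENNReal.ofReal (2 * δ) :=
        ENNReal.continuous_ofReal.comp (continuous_const_mul 2)
      simpa using (this.tendsto 0).mono_left nhdsWithin_le_nhds
    have h2 : Tendsto (fun δ : ℝ => (hgB.toFinset.card : ENNReal) *
        ENNReal.ofReal (2 * δ) ^ (1 / ((n : ℝ) + 1))) (nhdsWithin 0 (Set.Ioi 0)) (nhds 0) := by
      have hs : (0 : ℝ) < 1 / ((n : ℝ) + 1) := by positivity
      have := ENNReal.Tendsto.const_mul (a := (hgB.toFinset.card : ENNReal))
        (((ENNReal.continuous_rpow_const (y := 1 / ((n : ℝ) + 1))).tendsto 0).comp h1)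
        (Or.inr (ENNReal.natCast_ne_top _))
      simpa only [ENNReal.zero_rpow_of_pos hs, mul_zero, Function.comp_def] using this
    obtain ⟨δ, ⟨hδ1, hδ2⟩, hδ0⟩ := ((h1.eventually_le_const (pos_iff_ne_zero.2 hε)).and
      (h2.eventually_le_const (pos_iff_ne_zero.2 hε))).and self_mem_nhdsWithin |>.exists
    exact ⟨hgB.toFinset, δ, B, hB, hδ1, hδ2, ⟨g, hg⟩, by simpa using hδ0,
      fun x hx => hgB.mem_toFinset.2 ⟨x, hx, rfl⟩⟩
  filter_upwards [countable_iInter_mem.2 fun n => residual_of_dense_open (hUo n) (hUd n)] with f hf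
  choose F δ B hB hδ hF g hfg hg using Set.mem_iInter.1 hf
  refine ⟨S ∩ limsup (fun n => (B n)ᶜ) atTop, Set.inter_subset_left, ?_, ?_⟩
  · refine measure_mono_null Set.inter_subset_right (measure_limsup_atTop_eq_zero ?_)
    refine ne_top_of_le_ne_top ?_ (ENNReal.tsum_le_tsum hB)
    rw [ENNReal.tsum_geometric]
    simp
  · have hsub : f.1 '' (S \ (S ∩ limsup (fun n => (B n)ᶜ) atTop)) ⊆
        ⋃ k, f.1 '' (⋂ n ≥ k, B n) := by
      rintro _ ⟨x, ⟨hxS, hx⟩, rfl⟩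
      have hx' : x ∉ limsup (fun n => (B n)ᶜ) atTop := fun h => hx ⟨hxS, h⟩
      rw [mem_limsup_iff_frequently_mem, not_frequently] at hx'
      obtain ⟨k, hk⟩ := eventually_atTop.1 hx'
      exact Set.mem_iUnion.2 ⟨k, x, Set.mem_iInter₂.2 fun n hn => not_not.1 (hk n hn), rfl⟩
    refine le_antisymm ((dimH_mono hsub).trans ?_) zero_le
    rw [dimH_iUnion]
    refine iSup_le fun k => le_of_eq ?_
    refine dimH_eq_zero_of_eventually_finset_cover F δ hδ hF ?_
    filter_upwards [eventually_ge_atTop k] with n hn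
    rintro _ ⟨x, hx, rfl⟩
    exact ⟨(g n).1 x, hg n x (Set.mem_iInter₂.1 hx n hn),
      (BoundedContinuousFunction.dist_coe_le_dist x).trans_lt (hfg n)⟩
end

section
/- Let X be a complete metric space and S ⊆ X a separable, purely 1-unrectifiable subset. Then for every finite Borel measure μ on X with μ(X ∖ S) = 0, every m ∈ ℕ, every p ∈ [1, ∞] and every L ≥ 0, the set {f ∈ Lip_L(X, ℓ_p^m) : there exists N ⊆ S with μ(N) = 0 and the Hausdorff dimension of f(S ∖ N) equal to 0} is residual in Lip_L(X, ℓ_p^m), where ℓ_p^m denotes ℝ^m equipped with the p-norm. -/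
open MeasureTheory Filter Set Topology

/-- A point between the first and the last term of a finite real sequence lies between two
consecutive terms. -/
lemma mem_uIcc_consecutive {a : ℕ → ℝ} {n : ℕ} {y : ℝ} (hy : y ∈ uIcc (a 0) (a n)) :
    y = a 0 ∨ ∃ i < n, y ∈ uIcc (a i) (a (i + 1)) := by
  induction n with
  | zero => left; simpa using hy
  | succ n ih =>
    rcases uIcc_subset_uIcc_union_uIcc hy with h | h
    · rcases ih h with h | ⟨i, hi, h⟩
      · exact Or.inl h
      · exact Or.inr ⟨i, by omega, h⟩
    · exact Or.inr ⟨n, by omega, h⟩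

/-- If the steps selected by `P` of a finite real sequence stay inside `W`, then the distance between its
ends is at most the measure of `W` plus the total length of the other steps. -/
lemma ofReal_sub_le_of_short_steps {a : ℕ → ℝ} {n : ℕ} (P : ℕ → Prop) [DecidablePred P]
    {W : Set ℝ} (h0 : a 0 ∈ W) (hW : ∀ i < n, P i → uIcc (a i) (a (i + 1)) ⊆ W) :
    ENNReal.ofReal (a 0 - a n) ≤
      volume W + ENNReal.ofReal (∑ i ∈ Finset.range n, if P i then 0 else |a i - a (i + 1)|) := by
  have hsub : uIcc (a 0) (a n) ⊆
      W ∪ ⋃ i ∈ Finset.range n, (if P i then ∅ else uIcc (a i) (a (i + 1))) := by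
    intro y hy
    rcases mem_uIcc_consecutive hy with rfl | ⟨i, hi, h⟩
    · exact Or.inl h0
    · by_cases hP : P i
      · exact Or.inl (hW i hi hP h)
      · right
        simp only [mem_iUnion]
        exact ⟨i, Finset.mem_range.2 hi, by simpa [hP] using h⟩
  calc ENNReal.ofReal (a 0 - a n) ≤ volume (uIcc (a 0) (a n)) := by
        rw [Real.volume_interval]
        exact ENNReal.ofReal_le_ofReal (by rw [abs_sub_comm]; exact le_abs_self _)
    _ ≤ _ := measure_mono hsub
    _ ≤ _ := measure_union_le _ _
    _ ≤ _ := by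
        gcongr
        rw [ENNReal.ofReal_sum_of_nonneg (fun i _ => by split_ifs <;> positivity)]
        refine (measure_biUnion_finset_le _ _).trans (Finset.sum_le_sum fun i _ => ?_)
        split_ifs
        · simp
        · rw [Real.volume_interval, abs_sub_comm]

/-- On a compact purely 1-unrectifiable set, a Lipschitz function varies little along a chain of
points, once its jumps over steps of length at least `r` and `δ` times the length of the chain are
discounted. Otherwise an ultralimit of chains parametrised by length is a Lipschitz curve fragment
in the set whose image under `f` is not null. -/
lemma exists_chain_bound {X : Type*} [MetricSpace X] [MeasurableSpace X] [BorelSpace X]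
    {K : Set X} (hK : IsCompact K)
    (hpu : ∀ (A : Set ℝ) (γ : ℝ → X), LipschitzOnWith 1 γ A → γ '' A ⊆ K → μH[1] (γ '' A) = 0)
    {f : X → ℝ} {C : NNReal} (hf : LipschitzWith C f) {δ ε : ℝ} (hδ : 0 < δ) (hε : 0 < ε) :
    ∃ r > 0, ∀ (n : ℕ) (x : ℕ → X), (∀ i, x i ∈ K) →
      f (x 0) - ε ≤ f (x n) + ∑ i ∈ Finset.range n, (δ * dist (x i) (x (i + 1)) +
        if dist (x i) (x (i + 1)) < r then 0 else |f (x i) - f (x (i + 1))|) := by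
  by_contra! hcon
  have hr (k : ℕ) : (0 : ℝ) < 1 / ((k : ℝ) + 1) := by positivity
  choose n x hxK hlt using fun k : ℕ => hcon _ (hr k)
  obtain ⟨B, hB⟩ := hK.exists_bound_of_continuousOn hf.continuous.continuousOn
  simp only [Real.norm_eq_abs] at hB
  set t : ℕ → ℕ → ℝ := fun k i => ∑ j ∈ Finset.range i, dist (x k j) (x k (j + 1)) with ht
  have htT (k i : ℕ) (hi : i ≤ n k) : t k i ∈ Icc 0 (2 * B / δ) := by
    refine ⟨Finset.sum_nonneg fun _ _ => dist_nonneg, ?_⟩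
    rw [le_div_iff₀ hδ]
    have h1 : t k i ≤ t k (n k) := Finset.sum_le_sum_of_subset_of_nonneg
      (Finset.range_subset_range.2 hi) fun _ _ _ => dist_nonneg
    have h2 : t k (n k) * δ ≤ ∑ i ∈ Finset.range (n k), (δ * dist (x k i) (x k (i + 1)) +
        if dist (x k i) (x k (i + 1)) < 1 / ((k : ℝ) + 1) then 0
        else |f (x k i) - f (x k (i + 1))|) := by
      rw [ht, Finset.sum_mul]
      refine Finset.sum_le_sum fun i _ => ?_
      rw [mul_comm]
      exact le_add_of_nonneg_right (by split_ifs <;> positivity)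
    have h3 := hlt k
    have h4 := abs_le.1 (hB _ (hxK k 0))
    have h5 := abs_le.1 (hB _ (hxK k (n k)))
    nlinarith
  have htlip (k i j : ℕ) : dist (x k i) (x k j) ≤ dist (t k i) (t k j) := by
    wlog hij : i ≤ j generalizing i j
    · rw [dist_comm, dist_comm (t k i)]
      exact this j i (by omega)
    refine (dist_le_Ico_sum_dist (x k) hij).trans ?_
    rw [Finset.sum_Ico_eq_sub _ hij, dist_comm, Real.dist_eq]
    exact le_abs_self _
  set U : Ultrafilter ℕ := hyperfilter ℕ
  set Γ : Set (ℝ × X) := {p | ∀ V ∈ 𝓝 p, ∀ᶠ k in (U : Filter ℕ), ∃ i ≤ n k, (t k i, x k i) ∈ V}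
    with hΓ
  have hΓlip : ∀ p ∈ Γ, ∀ q ∈ Γ, dist p.2 q.2 ≤ dist p.1 q.1 := by
    intro p hp q hq
    refine le_of_forall_pos_le_add fun e he => ?_
    obtain ⟨k, ⟨i, -, hi⟩, ⟨j, -, hj⟩⟩ :=
      ((hp _ (Metric.ball_mem_nhds p (by positivity : 0 < e / 4))).and
        (hq _ (Metric.ball_mem_nhds q (by positivity : 0 < e / 4)))).exists
    rw [Metric.mem_ball, Prod.dist_eq, max_lt_iff] at hi hj
    have h1 := htlip k i j
    have h2 := dist_triangle4 p.2 (x k i) (x k j) q.2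
    have h3 := dist_triangle4 (t k i) p.1 q.1 (t k j)
    rw [dist_comm p.2 (x k i)] at h2
    rw [dist_comm q.1] at h3
    linarith [hi.1, hi.2, hj.1, hj.2]
  have hΓclosed : IsClosed Γ := by
    refine isClosed_of_closure_subset fun p hp V hV => ?_
    obtain ⟨q, hqV, hq⟩ := mem_closure_iff_nhds.1 hp _ (interior_mem_nhds.2 hV)
    exact hq V (mem_interior_iff_mem_nhds.1 hqV)
  have hΓsub : Γ ⊆ Icc 0 (2 * B / δ) ×ˢ K := by
    intro p hp
    rw [← (isClosed_Icc.prod hK.isClosed).closure_eq, mem_closure_iff_nhds]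
    intro V hV
    obtain ⟨k, i, hi, hiV⟩ := (hp V hV).exists
    exact ⟨_, hiV, htT k i hi, hxK k i⟩
  have hcomp : IsCompact (Icc 0 (2 * B / δ) ×ˢ K) := isCompact_Icc.prod hK
  have hΓc : IsCompact Γ := hcomp.of_isClosed_subset hΓclosed hΓsub
  have hnull : μH[1] (Prod.snd '' Γ) = 0 := by
    have : Nonempty X := ⟨x 0 0⟩
    classical
    let γ : ℝ → X := fun s => if h : ∃ u, (s, u) ∈ Γ then h.choose else Classical.arbitrary X
    have hγ : ∀ p ∈ Γ, γ p.1 = p.2 := by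
      intro p hp
      have h : ∃ u, (p.1, u) ∈ Γ := ⟨p.2, hp⟩
      have h1 : γ p.1 = h.choose := dif_pos h
      rw [h1]
      have := hΓlip _ h.choose_spec p hp
      simpa using this
    have himg : γ '' (Prod.fst '' Γ) = Prod.snd '' Γ := by
      rw [image_image]
      exact image_congr hγ
    rw [← himg]
    refine hpu _ _ ?_ ?_
    · refine LipschitzOnWith.of_dist_le_mul ?_
      rintro _ ⟨p, hp, rfl⟩ _ ⟨q, hq, rfl⟩
      rw [hγ p hp, hγ q hq]
      simpa using hΓlip p hp q hq
    · rw [himg]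
      rintro _ ⟨p, hp, rfl⟩
      exact (hΓsub hp).2
  set Z : Set ℝ := f '' (Prod.snd '' Γ) with hZ
  have hZc : IsCompact Z := (hΓc.image continuous_snd).image hf.continuous
  have hZ0 : volume Z = 0 := by
    rw [← hausdorffMeasure_real]
    have := hf.hausdorffMeasure_image_le zero_le_one (Prod.snd '' Γ)
    rw [hnull, mul_zero] at this
    exact le_antisymm this zero_le
  obtain ⟨W, hZW, hWo, hWε⟩ := Z.exists_isOpen_lt_of_lt (ENNReal.ofReal ε) (μ := volume)
    (by rw [hZ0]; simpa using hε)
  obtain ⟨s, hs, hsW⟩ := hZc.exists_thickening_subset_open hWo hZW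
  have hnear : ∀ᶠ k in (U : Filter ℕ), ∀ i ≤ n k, f (x k i) ∈ Metric.thickening (s / 2) Z := by
    have hQ : IsCompact ((Icc 0 (2 * B / δ) ×ˢ K) ∩
        {p : ℝ × X | f p.2 ∈ (Metric.thickening (s / 2) Z)ᶜ}) :=
      hcomp.inter_right (Metric.isOpen_thickening.isClosed_compl.preimage
        (hf.continuous.comp continuous_snd))
    have key : ∀ᶠ k in (U : Filter ℕ), ∀ i ≤ n k, (t k i, x k i) ∉ ((Icc 0 (2 * B / δ) ×ˢ K) ∩
        {p : ℝ × X | f p.2 ∈ (Metric.thickening (s / 2) Z)ᶜ}) := by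
      refine hQ.induction_on (p := fun Q => ∀ᶠ k in (U : Filter ℕ), ∀ i ≤ n k, (t k i, x k i) ∉ Q)
        (by simp) ?_ ?_ ?_
      · intro Q Q' hQQ h
        filter_upwards [h] with k hk i hi hm using hk i hi (hQQ hm)
      · intro Q Q' h h'
        filter_upwards [h, h'] with k hk hk' i hi hm
        exact hm.elim (hk i hi) (hk' i hi)
      · rintro p ⟨-, hp⟩
        have hpΓ : p ∉ Γ := fun h => hp (Metric.self_subset_thickening (by positivity) _
          ⟨_, ⟨p, h, rfl⟩, rfl⟩)
        simp only [hΓ, mem_ofPred_eq, not_forall] at hpΓ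
        obtain ⟨V, hV, hVn⟩ := hpΓ
        refine ⟨V, mem_nhdsWithin_of_mem_nhds hV, ?_⟩
        filter_upwards [Ultrafilter.eventually_not.2 hVn] with k hk i hi hm using hk ⟨i, hi, hm⟩
    filter_upwards [key] with k hk i hi
    by_contra hm
    exact hk i hi ⟨⟨htT k i hi, hxK k i⟩, hm⟩
  have hsmall : ∀ᶠ k : ℕ in (U : Filter ℕ), (C : ℝ) * (1 / ((k : ℝ) + 1)) < s / 2 := by
    have : Tendsto (fun k : ℕ => (C : ℝ) * (1 / ((k : ℝ) + 1))) atTop (𝓝 0) := by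
      simpa using tendsto_one_div_add_atTop_nhds_zero_nat.const_mul (C : ℝ)
    exact (this.mono_left Nat.hyperfilter_le_atTop).eventually_lt_const (by positivity)
  obtain ⟨k, hk1, hk2⟩ := (hnear.and hsmall).exists
  have hmain := ofReal_sub_le_of_short_steps (a := fun i => f (x k i)) (n := n k)
    (fun i => dist (x k i) (x k (i + 1)) < 1 / ((k : ℝ) + 1)) (W := W)
    (hsW (Metric.thickening_mono (by linarith) _ (hk1 0 (Nat.zero_le _)))) (by
      intro i hi hd y hy
      refine hsW ?_
      obtain ⟨z, hz, hdz⟩ := Metric.mem_thickening_iff.1 (hk1 i hi.le)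
      refine Metric.mem_thickening_iff.2 ⟨z, hz, ?_⟩
      have h1 : dist (f (x k i)) (f (x k (i + 1))) ≤ C * (1 / ((k : ℝ) + 1)) :=
        (hf.dist_le_mul _ _).trans (by gcongr)
      have h2 : dist y (f (x k i)) ≤ dist (f (x k i)) (f (x k (i + 1))) := by
        rw [dist_comm (f (x k i))]
        rw [Real.dist_eq, Real.dist_eq]
        exact abs_sub_left_of_mem_uIcc hy
      linarith [dist_triangle y (f (x k i)) z])
  set σ := ∑ i ∈ Finset.range (n k), if dist (x k i) (x k (i + 1)) < 1 / ((k : ℝ) + 1) then 0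
        else |f (x k i) - f (x k (i + 1))| with hσ
  have hσ0 : 0 ≤ σ := Finset.sum_nonneg fun i _ => by split_ifs <;> positivity
  have hlt' := hlt k
  rw [Finset.sum_add_distrib, ← hσ] at hlt'
  have h6 : 0 ≤ ∑ i ∈ Finset.range (n k), δ * dist (x k i) (x k (i + 1)) :=
    Finset.sum_nonneg fun i _ => by positivity
  have h7 : ENNReal.ofReal (f (x k 0) - f (x k (n k))) < ENNReal.ofReal (ε + σ) := by
    rw [ENNReal.ofReal_add hε.le hσ0]
    exact hmain.trans_lt (ENNReal.add_lt_add_right ENNReal.ofReal_ne_top hWε)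
  have h8 := (ENNReal.ofReal_lt_ofReal_iff (by positivity)).1 h7
  linarith

/-- McShane-type extension with respect to the pseudometric `|f x - f y| + δ * dist x y`, staying
between `f - ε` and `f`. -/
lemma exists_extension_between {X : Type*} [MetricSpace X] {E : Set X} {f g : X → ℝ} {δ ε : ℝ}
    (hδ : 0 ≤ δ) (hε : 0 ≤ ε) (hgf : ∀ x ∈ E, g x ≤ f x) (hfg : ∀ x ∈ E, f x - ε ≤ g x)
    (hg : ∀ x ∈ E, ∀ y ∈ E, g x ≤ g y + (|f x - f y| + δ * dist x y)) :
    ∃ G : X → ℝ, EqOn G g E ∧ (∀ x, G x ≤ f x) ∧ (∀ x, f x - ε ≤ G x) ∧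
      ∀ x y, |G x - G y| ≤ |f x - f y| + δ * dist x y := by
  classical
  set g₀ : X → ℝ := fun y => if y ∈ E then g y else f y with hg₀
  have hg₀f (y : X) : g₀ y ≤ f y := by
    by_cases h : y ∈ E
    · simpa [hg₀, h] using hgf y h
    · simp [hg₀, h]
  have hfg₀ (y : X) : f y - ε ≤ g₀ y := by
    by_cases h : y ∈ E
    · simpa [hg₀, h] using hfg y h
    · simpa [hg₀, h] using hε
  have hlow (x y : X) : f x - ε ≤ g₀ y + (|f x - f y| + δ * dist x y) := by
    have := mul_nonneg hδ (dist_nonneg (x := x) (y := y))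
    linarith [le_abs_self (f x - f y), hfg₀ y]
  have hbdd (x : X) : BddBelow (range fun y => g₀ y + (|f x - f y| + δ * dist x y)) :=
    ⟨f x - ε, by rintro _ ⟨y, rfl⟩; exact hlow x y⟩
  have hle (x : X) : (⨅ y, (g₀ y + (|f x - f y| + δ * dist x y))) ≤ g₀ x := by
    simpa using ciInf_le (hbdd x) x
  have hlip (x y : X) : (⨅ z, (g₀ z + (|f x - f z| + δ * dist x z))) ≤
      (⨅ z, (g₀ z + (|f y - f z| + δ * dist y z))) + (|f x - f y| + δ * dist x y) := by
    have : Nonempty X := ⟨x⟩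
    rw [← sub_le_iff_le_add]
    refine le_ciInf fun z => ?_
    have h1 := ciInf_le (hbdd x) z
    have h2 := abs_sub_le (f x) (f y) (f z)
    have h3 := mul_le_mul_of_nonneg_left (dist_triangle x y z) hδ
    linarith
  refine ⟨fun x => ⨅ y, (g₀ y + (|f x - f y| + δ * dist x y)), ?_,
    fun x => (hle x).trans (hg₀f x), ?_, ?_⟩
  · intro x hx
    have : Nonempty X := ⟨x⟩
    refine le_antisymm ((hle x).trans_eq (by simp [hg₀, hx])) (le_ciInf fun y => ?_)
    by_cases hy : y ∈ E
    · simpa [hg₀, hy] using hg x hx y hy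
    · have := mul_nonneg hδ (dist_nonneg (x := x) (y := y))
      simp only [hg₀, hy, if_false]
      linarith [le_abs_self (f x - f y), hgf x hx]
  · intro x
    have : Nonempty X := ⟨x⟩
    exact le_ciInf (hlow x)
  · intro x y
    have h1 := hlip x y
    have h2 := hlip y x
    rw [abs_sub_comm (f y), dist_comm y] at h2
    rw [abs_sub_le_iff]
    constructor <;> linarith

/-- On a compact purely 1-unrectifiable set, a Lipschitz function can be perturbed to have small
Lipschitz constant at small scales, essentially without increasing any of its increments. -/
lemma exists_locally_flat {X : Type*} [MetricSpace X] [MeasurableSpace X] [BorelSpace X]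
    {K : Set X} (hK : IsCompact K)
    (hpu : ∀ (A : Set ℝ) (γ : ℝ → X), LipschitzOnWith 1 γ A → γ '' A ⊆ K → μH[1] (γ '' A) = 0)
    {f : X → ℝ} {C : NNReal} (hf : LipschitzWith C f) {δ ε : ℝ} (hδ : 0 < δ) (hε : 0 < ε) :
    ∃ g : X → ℝ, (∀ x, g x ≤ f x) ∧ (∀ x, f x - ε ≤ g x) ∧
      (∀ x y, |g x - g y| ≤ |f x - f y| + δ * dist x y) ∧
      ∃ r > 0, ∀ x ∈ K, ∀ y ∈ K, dist x y < r → |g x - g y| ≤ δ * dist x y := by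
  obtain ⟨r, hr, hchain⟩ := exists_chain_bound hK hpu hf hδ hε
  set c : X → X → ℝ := fun x y => δ * dist x y + if dist x y < r then 0 else |f x - f y| with hc
  have hcD (x y : X) : c x y ≤ |f x - f y| + δ * dist x y := by
    simp only [hc]
    split_ifs
    · linarith [abs_nonneg (f x - f y)]
    · linarith
  have hcs (x y : X) : c x y = c y x := by simp only [hc, dist_comm x y, abs_sub_comm (f x)]
  let V : X → Set ℝ := fun x => {v | ∃ (n : ℕ) (z : ℕ → X), (∀ i, z i ∈ K) ∧ z 0 = x ∧
    v = f (z n) + ∑ i ∈ Finset.range n, c (z i) (z (i + 1))}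
  have hlow (x : X) : ∀ v ∈ V x, f x - ε ≤ v := by
    rintro _ ⟨n, z, hz, rfl, rfl⟩
    exact hchain n z hz
  have hmem : ∀ x ∈ K, f x ∈ V x := fun x hx => ⟨0, fun _ => x, fun _ => hx, rfl, by simp⟩
  have hlip : ∀ x ∈ K, ∀ y ∈ K, sInf (V x) ≤ sInf (V y) + c x y := by
    intro x hx y hy
    rw [← sub_le_iff_le_add]
    refine le_csInf ⟨_, hmem y hy⟩ ?_
    rintro _ ⟨n, z, hz, rfl, rfl⟩
    rw [sub_le_iff_le_add]
    refine csInf_le ⟨_, hlow x⟩ ⟨n + 1, fun i => Nat.casesOn i x z, ?_, rfl, ?_⟩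
    · rintro (_ | i)
      exacts [hx, hz i]
    · rw [Finset.sum_range_succ']
      simp only [add_assoc]
      rfl
  obtain ⟨G, hGg, hGf, hfG, hG⟩ := exists_extension_between (E := K) (f := f)
    (g := fun x => sInf (V x)) hδ.le hε.le (fun x hx => csInf_le ⟨_, hlow x⟩ (hmem x hx))
    (fun x hx => le_csInf ⟨_, hmem x hx⟩ (hlow x))
    (fun x hx y hy => (hlip x hx y hy).trans (by gcongr; exact hcD x y))
  refine ⟨G, hGf, hfG, hG, r, hr, fun x hx y hy hxy => ?_⟩
  rw [hGg hx, hGg hy]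
  have h1 := hlip x hx y hy
  have h2 := hlip y hy x hx
  rw [hcs y x] at h2
  have h3 : c x y = δ * dist x y := by simp [hc, hxy]
  rw [abs_sub_le_iff]
  constructor <;> linarith

/-- Rounding down to a coarse grid of width `q` is `q`-Lipschitz on the reals whose integer part
avoids one residue class. -/
lemma exists_rounding {q : ℤ} (hq : 2 ≤ q) (j : ℤ) :
    ∃ R : ℤ → ℤ, (∀ v, R v ≤ v) ∧ (∀ v, v - q + 1 ≤ R v) ∧
      ∀ a b : ℝ, ⌊a⌋ % q ≠ j % q → ⌊b⌋ % q ≠ j % q →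
        |(R ⌊a⌋ : ℝ) - R ⌊b⌋| ≤ q * |a - b| := by
  have hq0 : (0 : ℤ) < q := by omega
  have hqR : (2 : ℝ) ≤ q := by exact_mod_cast hq
  have hdm (v : ℤ) := Int.emod_add_mul_ediv (v - j - 1) q
  have hm0 (v : ℤ) := Int.emod_nonneg (v - j - 1) hq0.ne'
  have hmq (v : ℤ) := Int.emod_lt_of_pos (v - j - 1) hq0
  refine ⟨fun v => q * ((v - j - 1) / q) + j + 1, fun v => by linarith [hdm v, hm0 v],
    fun v => by linarith [hdm v, Int.add_one_le_iff.2 (hmq v)], ?_⟩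
  have hmq' (v : ℤ) (hv : v % q ≠ j % q) : (v - j - 1) % q ≤ q - 2 := by
    by_contra! hcon
    have h1 : (v - j - 1) % q = q - 1 := by have := hmq v; omega
    have h2 := hdm v
    rw [h1] at h2
    exact hv (Int.emod_eq_emod_iff_emod_sub_eq_zero.2
      (Int.emod_eq_zero_of_dvd ⟨(v - j - 1) / q + 1, by linarith⟩))
  intro a b ha hb
  wlog hab : b ≤ a generalizing a b
  · rw [abs_sub_comm, abs_sub_comm a]
    exact this b a hb ha (le_of_not_ge hab)
  have hfl : ⌊b⌋ ≤ ⌊a⌋ := Int.floor_mono hab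
  have hk : (⌊b⌋ - j - 1) / q ≤ (⌊a⌋ - j - 1) / q := Int.ediv_le_ediv hq0 (by omega)
  rw [abs_of_nonneg (sub_nonneg.2 hab), abs_of_nonneg (by
    rw [sub_nonneg, Int.cast_le]; nlinarith)]
  obtain ⟨k, hk'⟩ : ∃ k : ℤ, k = (⌊a⌋ - j - 1) / q - (⌊b⌋ - j - 1) / q := ⟨_, rfl⟩
  have hk0 : 0 ≤ k := by omega
  have hLHS : (((q * ((⌊a⌋ - j - 1) / q) + j + 1 : ℤ) : ℝ) -
      ((q * ((⌊b⌋ - j - 1) / q) + j + 1 : ℤ) : ℝ)) = q * k := by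
    rw [hk']; push_cast; ring
  rw [hLHS]
  refine mul_le_mul_of_nonneg_left ?_ (by linarith)
  rcases hk0.eq_or_lt with h0 | h0
  · rw [← h0]; simpa using hab
  have h1 : k + 1 ≤ ⌊a⌋ - ⌊b⌋ := by
    have e1 := hdm ⌊a⌋
    have e2 := hdm ⌊b⌋
    have e3 := hm0 ⌊a⌋
    have e4 := hmq' ⌊b⌋ hb
    have e5 : ⌊a⌋ - ⌊b⌋ ≥ q * k - (q - 2) := by rw [hk']; linarith
    nlinarith
  have h2 : ((k : ℝ) + 1) ≤ ⌊a⌋ - ⌊b⌋ := by exact_mod_cast h1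
  linarith [Int.floor_le a, Int.lt_floor_add_one b]

/-- Pigeonhole: one of the `q` residue classes of an integer-valued map carries at most the fraction
`1 / q` of the measure. -/
lemma exists_measure_fiber_le {X : Type*} [MeasurableSpace X] (μ : Measure X) [IsFiniteMeasure μ]
    {q : ℕ} (hq : 0 < q) {v : X → ℤ} (hv : Measurable v) :
    ∃ j : ℤ, μ {x | v x % q = j % q} ≤ μ univ / q := by
  by_contra! hcon
  have hne : (Finset.range q).Nonempty := ⟨0, Finset.mem_range.2 hq⟩
  have hmeas (j : ℕ) : MeasurableSet {x | v x % q = (j : ℤ) % q} :=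
    hv (MeasurableSet.of_discrete (s := {a : ℤ | a % q = (j : ℤ) % q}))
  have h1 : ∑ j ∈ Finset.range q, μ {x | v x % q = (j : ℤ) % q} ≤ μ univ := by
    rw [← measure_biUnion_finset _ fun j _ => hmeas j]
    · exact measure_mono (subset_univ _)
    · intro i hi j hj hij
      refine disjoint_left.2 fun x (hx : v x % q = i % q) (hx' : v x % q = j % q) => hij ?_
      rw [hx] at hx'
      norm_cast at hx'
      rwa [Nat.mod_eq_of_lt (by simpa using hi), Nat.mod_eq_of_lt (by simpa using hj)] at hx'
  have h2 : ∑ _j ∈ Finset.range q, μ univ / q <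
      ∑ j ∈ Finset.range q, μ {x | v x % q = (j : ℤ) % q} :=
    ENNReal.sum_lt_sum_of_nonempty hne fun j _ => hcon j
  rw [Finset.sum_const, Finset.card_range, nsmul_eq_mul,
    ENNReal.mul_div_cancel (by exact_mod_cast hq.ne') (by simp)] at h2
  exact absurd h1 h2.not_ge

/-- A Lipschitz function can be perturbed, essentially without increasing any of its
increments, to take finitely many values on most of a compact purely 1-unrectifiable set. -/
lemma exists_finite_valued {X : Type*} [MetricSpace X] [MeasurableSpace X] [BorelSpace X]
    {K : Set X} (hK : IsCompact K)
    (hpu : ∀ (A : Set ℝ) (γ : ℝ → X), LipschitzOnWith 1 γ A → γ '' A ⊆ K → μH[1] (γ '' A) = 0)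
    (μ : Measure X) [IsFiniteMeasure μ]
    {f : X → ℝ} {C : NNReal} (hf : LipschitzWith C f) {δ ε : ℝ} (hδ : 0 < δ) (hε : 0 < ε)
    {q : ℕ} (hq : 2 ≤ q) :
    ∃ (g : X → ℝ) (E : Set X), μ (K \ E) ≤ μ univ / q ∧ (g '' E).Finite ∧
      (∀ x, |g x - f x| ≤ ε) ∧ ∀ x y, |g x - g y| ≤ |f x - f y| + δ * dist x y := by
  have hqR : (2 : ℝ) ≤ q := by exact_mod_cast hq
  have hδ' : 0 < δ / q := by positivity
  obtain ⟨g, hgf, hfg, hg, r, hr, hgr⟩ := exists_locally_flat hK hpu hf hδ' (half_pos hε)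
  set τ : ℝ := min (δ / 2 * r) (ε / 2) / q with hτ
  have hτ0 : 0 < τ := by positivity
  have hqτ : q * τ = min (δ / 2 * r) (ε / 2) := by rw [hτ]; field_simp
  have hqτ1 : q * τ ≤ δ / 2 * r := hqτ.trans_le (min_le_left _ _)
  have hqτ2 : q * τ ≤ ε / 2 := hqτ.trans_le (min_le_right _ _)
  have hδq : δ / q ≤ δ / 2 := by gcongr
  have hgcont : Continuous g := by
    refine LipschitzWith.continuous (K := C + (δ / q).toNNReal) (LipschitzWith.of_dist_le_mul ?_)
    intro x y
    have h1 := hf.dist_le_mul x y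
    rw [Real.dist_eq] at h1 ⊢
    rw [NNReal.coe_add, Real.coe_toNNReal _ hδ'.le]
    linarith [hg x y]
  obtain ⟨j, hj⟩ := exists_measure_fiber_le μ (by omega : 0 < q)
    (v := fun x => ⌊g x / τ⌋) (Int.measurable_floor.comp (hgcont.measurable.div_const τ))
  obtain ⟨R, hR1, hR2, hR3⟩ := exists_rounding (q := q) (by exact_mod_cast hq) j
  set E : Set X := K ∩ {x | ⌊g x / τ⌋ % q ≠ j % q} with hE
  set h : X → ℝ := fun x => τ * R ⌊g x / τ⌋ with hh
  have hhg (x : X) : h x ≤ g x := by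
    have h1 : (R ⌊g x / τ⌋ : ℝ) ≤ g x / τ :=
      (Int.cast_le.2 (hR1 _)).trans (Int.floor_le _)
    calc h x ≤ τ * (g x / τ) := mul_le_mul_of_nonneg_left h1 hτ0.le
      _ = g x := by field_simp
  have hgh (x : X) : g x - q * τ ≤ h x := by
    have h1 : (⌊g x / τ⌋ : ℝ) - q + 1 ≤ R ⌊g x / τ⌋ := by exact_mod_cast hR2 ⌊g x / τ⌋
    have h2 : g x / τ - q ≤ R ⌊g x / τ⌋ := by linarith [Int.lt_floor_add_one (g x / τ)]
    calc g x - q * τ = τ * (g x / τ - q) := by field_simp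
      _ ≤ h x := mul_le_mul_of_nonneg_left h2 hτ0.le
  obtain ⟨G, hGh, hGf, hfG, hG⟩ := exists_extension_between (E := E) (f := f) (g := h) hδ.le hε.le
    (fun x _ => (hhg x).trans (hgf x)) (fun x _ => by linarith [hfg x, hgh x]) (by
      intro x hx y hy
      by_cases hxy : dist x y < r
      · have h1 := hR3 (g x / τ) (g y / τ) hx.2 hy.2
        rw [← sub_div, abs_div, abs_of_pos hτ0] at h1
        have h2 : h x - h y ≤ q * |g x - g y| := by
          calc h x - h y = τ * (R ⌊g x / τ⌋ - R ⌊g y / τ⌋) := by simp only [hh]; ring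
            _ ≤ τ * (q * (|g x - g y| / τ)) := by
              gcongr
              exact (le_abs_self _).trans (by exact_mod_cast h1)
            _ = q * |g x - g y| := by field_simp
        have h3 : q * |g x - g y| ≤ q * (δ / q * dist x y) := by
          gcongr
          exact hgr x hx.1 y hy.1 hxy
        have h4 : q * (δ / q * dist x y) = δ * dist x y := by field_simp
        linarith [abs_nonneg (f x - f y)]
      · have h1 := (le_abs_self _).trans (hg x y)
        have h2 : δ / q * dist x y ≤ δ / 2 * dist x y := by gcongr
        have h3 : δ / 2 * r ≤ δ / 2 * dist x y := by gcongr; exact not_lt.1 hxy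
        linarith [hhg x, hgh y])
  refine ⟨G, E, ?_, ?_, fun x => ?_, hG⟩
  · refine (measure_mono ?_).trans hj
    rintro x ⟨hx, hxE⟩
    by_contra hcon
    exact hxE ⟨hx, hcon⟩
  · rw [hGh.image_eq]
    obtain ⟨B, hB⟩ := hK.exists_bound_of_continuousOn hgcont.continuousOn
    refine ((finite_Icc ⌊-B / τ⌋ ⌊B / τ⌋).image fun v : ℤ => τ * (R v : ℝ)).subset ?_
    rintro _ ⟨x, hx, rfl⟩
    have hb := abs_le.1 (hB x hx.1)
    exact ⟨⌊g x / τ⌋, ⟨Int.floor_mono (by gcongr; exact hb.1),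
      Int.floor_mono (by gcongr; exact hb.2)⟩, rfl⟩
  · rw [abs_le]
    constructor <;> linarith [hGf x, hfG x]

lemma PiLp.norm_le_norm_of_abs_le {ι : Type*} [Fintype ι] {p : ENNReal} [Fact (1 ≤ p)]
    {x y : PiLp p fun _ : ι => ℝ} (h : ∀ i, |x i| ≤ |y i|) : ‖x‖ ≤ ‖y‖ := by
  rcases eq_or_ne p ⊤ with rfl | hp
  · rw [PiLp.norm_eq_ciSup, PiLp.norm_eq_ciSup]
    exact ciSup_mono (finite_range _).bddAbove h
  · have hp0 : 0 < p.toReal :=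
      ENNReal.toReal_pos (zero_lt_one.trans_le (Fact.out : 1 ≤ p)).ne' hp
    rw [PiLp.norm_eq_sum hp0, PiLp.norm_eq_sum hp0]
    have h' (i : ι) : ‖x i‖ ≤ ‖y i‖ := h i
    gcongr with i
    exact h' i

lemma PiLp.norm_le_norm_add_of_abs_le {ι : Type*} [Fintype ι] {p : ENNReal} [Fact (1 ≤ p)]
    {x y : PiLp p fun _ : ι => ℝ} {c : ℝ} (hc : 0 ≤ c) (h : ∀ i, |x i| ≤ |y i| + c) :
    ‖x‖ ≤ ‖y‖ + Fintype.card ι * c := by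
  classical
  set z : PiLp p fun _ : ι => ℝ := WithLp.toLp p fun i => |y i| with hz
  set w : PiLp p fun _ : ι => ℝ := ∑ i, PiLp.single p i c with hw
  have hwi (i : ι) : w i = c := by
    simp [hw, Pi.single_apply]
  have h1 : ‖x‖ ≤ ‖z + w‖ := PiLp.norm_le_norm_of_abs_le fun i => by
    have : (z + w) i = |y i| + c := by rw [PiLp.add_apply, hwi]
    rw [this]
    exact (h i).trans (le_abs_self _)
  have h2 : ‖z‖ ≤ ‖y‖ := PiLp.norm_le_norm_of_abs_le fun i => by simp [hz]
  have h3 : ‖w‖ ≤ Fintype.card ι * c := by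
    refine (norm_sum_le _ _).trans ?_
    simp [PiLp.norm_single, abs_of_nonneg hc]
  linarith [norm_add_le z w]

/-- Bounded `L`-Lipschitz maps to `ℓ_p^m` taking finitely many values on most of a given compact
purely 1-unrectifiable set are dense. -/
lemma exists_near_finite_valued {X : Type*} [MetricSpace X] [MeasurableSpace X] [BorelSpace X]
    {K : Set X} (hK : IsCompact K)
    (hpu : ∀ (A : Set ℝ) (γ : ℝ → X), LipschitzOnWith 1 γ A → γ '' A ⊆ K → μH[1] (γ '' A) = 0)
    (μ : Measure X) [IsFiniteMeasure μ] {ι : Type*} [Fintype ι] {p : ENNReal} [Fact (1 ≤ p)]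
    {L : NNReal} (hL : 0 < L)
    (f : {g : BoundedContinuousFunction X (PiLp p fun _ : ι => ℝ) // LipschitzWith L ⇑g})
    {ε : ℝ} (hε : 0 < ε) {η : ENNReal} (hη : η ≠ 0) :
    ∃ g : {g : BoundedContinuousFunction X (PiLp p fun _ : ι => ℝ) // LipschitzWith L ⇑g},
      dist f g < ε ∧ ∃ E : Set X, μ (K \ E) ≤ η ∧ (⇑g.1 '' E).Finite := by
  obtain ⟨f, hf⟩ := f
  set m : ℝ := ((Fintype.card ι : ℕ) : ℝ) with hm
  have hm0 : 0 ≤ m := by positivity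
  -- shrinking `f` leaves room in the Lipschitz constant for the perturbation
  obtain ⟨θ, hθ0, hθ1, hθ⟩ : ∃ θ : ℝ, 0 < θ ∧ θ ≤ 1 ∧ θ * ‖f‖ ≤ ε / 4 := by
    refine ⟨min 1 (ε / (4 * (‖f‖ + 1))), by positivity, min_le_left _ _, ?_⟩
    have h1 : 0 ≤ ‖f‖ := norm_nonneg f
    calc _ ≤ ε / (4 * (‖f‖ + 1)) * (‖f‖ + 1) := by
          gcongr
          · exact min_le_right _ _
          · linarith
      _ = ε / 4 := by field_simp
  set δ : ℝ := θ * L / (m + 1) with hδ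
  have hδ0 : 0 < δ := by positivity
  have hmδ : m * δ ≤ θ * L := by
    rw [hδ, ← mul_div_assoc, div_le_iff₀ (by positivity)]
    nlinarith [mul_pos hθ0 (NNReal.coe_pos.2 hL)]
  set e : ℝ := ε / (4 * (m + 1)) with he
  have he0 : 0 < e := by positivity
  have hme : m * e ≤ ε / 4 := by
    rw [he, ← mul_div_assoc, div_le_iff₀ (by positivity)]
    nlinarith
  obtain ⟨q, hq2, hq⟩ : ∃ q : ℕ, 2 ≤ q ∧ Fintype.card ι * (μ univ / q) ≤ η := by
    have hfin : (Fintype.card ι * μ univ) / η ≠ ⊤ :=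
      ENNReal.div_ne_top (ENNReal.mul_ne_top (by simp) (measure_ne_top _ _)) hη
    obtain ⟨q, hq⟩ := ENNReal.exists_nat_gt hfin
    refine ⟨q + 2, by omega, ?_⟩
    rw [← mul_div_assoc]
    refine ENNReal.div_le_of_le_mul ?_
    rcases eq_or_ne η ⊤ with rfl | hηt
    · rw [ENNReal.top_mul (by simp)]
      exact le_top
    rw [mul_comm η]
    refine (ENNReal.div_le_iff_le_mul (Or.inl hη) (Or.inl hηt)).1 (hq.le.trans ?_)
    exact_mod_cast Nat.le_add_right q 2
  have hfi (i : ι) : LipschitzWith L fun x => (1 - θ) * f x i := by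
    refine LipschitzWith.of_dist_le_mul fun x y => ?_
    have h1 : |f x i - f y i| ≤ ‖f x - f y‖ := PiLp.norm_apply_le (f x - f y) i
    have h2 := hf.dist_le_mul x y
    rw [dist_eq_norm] at h2
    rw [Real.dist_eq, ← mul_sub, abs_mul, abs_of_nonneg (by linarith)]
    nlinarith [abs_nonneg (f x i - f y i)]
  choose g E hE hgE hgf hg using fun i => exists_finite_valued hK hpu μ (hfi i) hδ0 he0 hq2
  set G : X → PiLp p fun _ : ι => ℝ := fun x => WithLp.toLp p fun i => g i x with hG
  have hGlip : LipschitzWith L G := by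
    refine LipschitzWith.of_dist_le_mul fun x y => ?_
    rw [dist_eq_norm]
    have h1 := PiLp.norm_le_norm_add_of_abs_le (x := G x - G y) (y := (1 - θ) • (f x - f y))
      (c := δ * dist x y) (by positivity) (fun i => by
        have := hg i x y
        rw [← mul_sub] at this
        exact this)
    have h2 := hf.dist_le_mul x y
    rw [dist_eq_norm] at h2
    rw [norm_smul, Real.norm_eq_abs, abs_of_nonneg (by linarith), ← hm] at h1
    have h3 : m * δ * dist x y ≤ θ * L * dist x y := by gcongr
    have h4 : (1 - θ) * ‖f x - f y‖ ≤ (1 - θ) * (L * dist x y) :=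
      mul_le_mul_of_nonneg_left h2 (by linarith)
    linarith
  have hclose (x : X) : ‖G x - f x‖ ≤ ε / 2 := by
    have h1 := PiLp.norm_le_norm_add_of_abs_le (x := G x - f x) (y := θ • f x) (c := e) he0.le
      (fun i => by
        have h1 := hgf i x
        have h2 : (G x - f x) i = (g i x - (1 - θ) * f x i) - θ * f x i := by
          simp only [hG, PiLp.sub_apply]; ring
        have h3 : (θ • f x) i = θ * f x i := rfl
        rw [h2, h3]
        linarith [abs_sub (g i x - (1 - θ) * f x i) (θ * f x i)])
    rw [norm_smul, Real.norm_eq_abs, abs_of_pos hθ0, ← hm] at h1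
    have h2 : θ * ‖f x‖ ≤ θ * ‖f‖ := by gcongr; exact f.norm_coe_le_norm x
    linarith
  refine ⟨⟨BoundedContinuousFunction.ofNormedAddCommGroup G hGlip.continuous (‖f‖ + ε / 2) ?_,
    hGlip⟩, ?_, ⋂ i, E i, ?_, ?_⟩
  · intro x
    have h1 := norm_le_norm_add_norm_sub (f x) (G x)
    have h2 := f.norm_coe_le_norm x
    rw [norm_sub_rev] at h1
    linarith [hclose x, norm_sub_rev (G x) (f x)]
  · rw [Subtype.dist_eq]
    refine lt_of_le_of_lt ((BoundedContinuousFunction.dist_le (by positivity)).2 fun x => ?_)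
      (half_lt_self hε)
    rw [dist_comm, dist_eq_norm]
    exact hclose x
  · rw [sdiff_iInter]
    refine (measure_iUnion_fintype_le μ _).trans ((Finset.sum_le_sum fun i _ => hE i).trans ?_)
    simpa using hq
  · refine ((Finite.pi' hgE).image (WithLp.toLp p)).subset ?_
    rintro _ ⟨x, hx, rfl⟩
    exact ⟨fun i => g i x, fun i => ⟨x, mem_iInter.1 hx i, rfl⟩, rfl⟩

lemma exists_compact_subset_measure_compl_le {X : Type*} [MetricSpace X] [CompleteSpace X]
    [MeasurableSpace X] [BorelSpace X] {S : Set X} (hS : TopologicalSpace.IsSeparable S)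
    (μ : Measure X) [IsFiniteMeasure μ] (hμS : μ Sᶜ = 0) {η : ENNReal} (hη : η ≠ 0) :
    ∃ K ⊆ S, IsCompact K ∧ μ Kᶜ ≤ η := by
  set Y : Set X := closure S
  have hY : MeasurableSet Y := isClosed_closure.measurableSet
  have : CompleteSpace Y := isClosed_closure.completeSpace_coe
  have : TopologicalSpace.SeparableSpace Y := hS.closure.separableSpace
  have : SecondCountableTopology Y := UniformSpace.secondCountable_of_separable Y
  set T : Set X := (toMeasurable μ Sᶜ)ᶜ
  have hT : MeasurableSet T := (measurableSet_toMeasurable μ Sᶜ).compl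
  have hTS : T ⊆ S := compl_subset_comm.1 (subset_toMeasurable μ Sᶜ)
  have hTc : μ Tᶜ = 0 := by rw [compl_compl, measure_toMeasurable, hμS]
  set ν : Measure Y := μ.comap Subtype.val
  have hν (s : Set Y) : ν s = μ (Subtype.val '' s) := comap_subtype_coe_apply hY μ s
  have : IsFiniteMeasure ν := ⟨by rw [hν]; exact measure_lt_top _ _⟩
  obtain ⟨K, hKT, hK, hlt⟩ := (measurable_subtype_coe hT :
    MeasurableSet ((Subtype.val : Y → X) ⁻¹' T)).exists_isCompact_lt_add (μ := ν)
    (measure_ne_top _ _) hη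
  have himg : (Subtype.val : Y → X) '' (Subtype.val ⁻¹' T) = T := by
    rw [Subtype.image_preimage_coe]
    exact inter_eq_right.2 (hTS.trans subset_closure)
  have hKc : IsCompact ((Subtype.val : Y → X) '' K) := hK.image continuous_subtype_val
  have hKT' : (Subtype.val : Y → X) '' K ⊆ T := image_subset_iff.2 hKT
  refine ⟨Subtype.val '' K, hKT'.trans hTS, hKc, ?_⟩
  rw [hν, hν, himg] at hlt
  have h1 : ((Subtype.val : Y → X) '' K)ᶜ ⊆ Tᶜ ∪ (T \ Subtype.val '' K) := by
    intro x hx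
    by_cases h : x ∈ T
    exacts [Or.inr ⟨h, hx⟩, Or.inl h]
  refine (measure_mono h1).trans ((measure_union_le _ _).trans ?_)
  rw [hTc, zero_add, measure_sdiff hKT' hKc.measurableSet.nullMeasurableSet (measure_ne_top _ _)]
  exact tsub_le_iff_left.2 hlt.le

lemma dimH_eq_zero_of_small_covers {Y : Type*} [MetricSpace Y] {A : Set Y} {F : ℕ → Finset Y}
    {ρ : ℕ → ℝ} (hρ : ∀ n, 0 < ρ n) (hρ1 : ∀ n : ℕ, 2 * ρ n ≤ 1 / ((n : ℝ) + 1))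
    (hF : ∀ n : ℕ, (F n).card * (2 * ρ n) ^ (1 / ((n : ℝ) + 1)) ≤ 1 / ((n : ℝ) + 1))
    (hA : ∀ᶠ n in atTop, A ⊆ ⋃ y ∈ F n, Metric.ball y (ρ n)) : dimH A = 0 := by
  borelize Y
  have hlim : Tendsto (fun n : ℕ => ENNReal.ofReal (1 / ((n : ℝ) + 1))) atTop (𝓝 0) := by
    simpa using ENNReal.tendsto_ofReal tendsto_one_div_add_atTop_nhds_zero_nat
  have hmain (s : NNReal) (hs : 0 < s) : dimH A ≤ s := by
    refine dimH_le_of_hausdorffMeasure_ne_top (ne_top_of_le_ne_top ENNReal.zero_ne_top ?_)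
    have hdiam (n : ℕ) (y : F n) :
        Metric.ediam (Metric.ball (y : Y) (ρ n)) ≤ ENNReal.ofReal (2 * ρ n) := by
      rw [← Metric.eball_ofReal, ENNReal.ofReal_mul (by norm_num), ENNReal.ofReal_ofNat]
      exact Metric.ediam_eball_le
    refine (Measure.hausdorffMeasure_le_liminf_sum (ι := fun n => F n) (s : ℝ) A
      (fun n => ENNReal.ofReal (1 / ((n : ℝ) + 1))) hlim
      (fun n y => Metric.ball (y : Y) (ρ n)) ?_ ?_).trans ?_
    · exact Eventually.of_forall fun n y => (hdiam n y).trans (ENNReal.ofReal_le_ofReal (hρ1 n))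
    · filter_upwards [hA] with n hn
      refine hn.trans (iUnion₂_subset fun y hy => ?_)
      exact subset_iUnion (fun i : F n => Metric.ball (i : Y) (ρ n)) ⟨y, hy⟩
    · rw [← hlim.liminf_eq]
      refine liminf_le_liminf ?_
      filter_upwards [tendsto_one_div_add_atTop_nhds_zero_nat.eventually_le_const
        (NNReal.coe_pos.2 hs)] with n hn
      have hle1 : 2 * ρ n ≤ 1 := (hρ1 n).trans (by
        rw [div_le_one (by positivity)]; linarith [Nat.cast_nonneg (α := ℝ) n])
      have hpos : 0 < 2 * ρ n := by linarith [hρ n]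
      calc ∑ y : F n, Metric.ediam (Metric.ball (y : Y) (ρ n)) ^ (s : ℝ)
          ≤ ∑ y : F n, ENNReal.ofReal ((2 * ρ n) ^ (1 / ((n : ℝ) + 1))) := by
            refine Finset.sum_le_sum fun y _ => ?_
            refine (ENNReal.rpow_le_rpow (hdiam n y) s.2).trans ?_
            rw [ENNReal.ofReal_rpow_of_pos hpos]
            exact ENNReal.ofReal_le_ofReal (Real.rpow_le_rpow_of_exponent_ge hpos hle1 hn)
        _ = ENNReal.ofReal ((F n).card * (2 * ρ n) ^ (1 / ((n : ℝ) + 1))) := by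
            rw [ENNReal.ofReal_mul (by positivity)]
            simp
        _ ≤ _ := ENNReal.ofReal_le_ofReal (hF n)
  refine le_antisymm (le_of_forall_gt fun c hc => ?_) zero_le
  obtain ⟨s, hs0, hsc⟩ := ENNReal.lt_iff_exists_nnreal_btwn.1 hc
  exact (hmain s (by exact_mod_cast hs0)).trans_lt hsc

lemma exists_radius (n N : ℕ) : ∃ ρ : ℝ, 0 < ρ ∧ 2 * ρ ≤ 1 / ((n : ℝ) + 1) ∧
    N * (2 * ρ) ^ (1 / ((n : ℝ) + 1)) ≤ 1 / ((n : ℝ) + 1) := by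
  have hn : 0 < 1 / ((n : ℝ) + 1) := by positivity
  have h1 : Tendsto (fun ρ : ℝ => 2 * ρ) (𝓝[>] 0) (𝓝 0) := by
    have : Continuous fun ρ : ℝ => 2 * ρ := by fun_prop
    simpa using (this.tendsto 0).mono_left nhdsWithin_le_nhds
  have h2 : Tendsto (fun ρ : ℝ => N * (2 * ρ) ^ (1 / ((n : ℝ) + 1))) (𝓝[>] 0) (𝓝 0) := by
    have h3 := ((Real.continuous_rpow_const hn.le).tendsto 0).comp h1
    rw [Real.zero_rpow hn.ne'] at h3
    simpa using h3.const_mul (N : ℝ)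
  obtain ⟨ρ, hρ, h4, h5⟩ := ((eventually_mem_nhdsWithin (a := (0 : ℝ)) (s := Ioi 0)).and
    ((h1.eventually_le_const hn).and (h2.eventually_le_const hn))).exists
  exact ⟨ρ, hρ, h4, h5⟩

/-- Let `X` be a complete metric space and `S ⊆ X` a separable, purely 1-unrectifiable subset.
Then for every finite Borel measure `μ` on `X` supported on `S`, every `m ∈ ℕ`, every
`p ∈ [1, ∞]` and every `L ≥ 0`, the set of bounded `L`-Lipschitz maps `f : X → ℓ_p^m` for which
there is a `μ`-null set `N ⊆ S` with `dimH (f '' (S \ N)) = 0` is residual in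
`Lip_L(X, ℓ_p^m)`. -/
theorem stmt_3 (X : Type*) [MetricSpace X] [CompleteSpace X]
    [MeasurableSpace X] [BorelSpace X]
    (S : Set X) (hSsep : TopologicalSpace.IsSeparable S)
    (hpu : ∀ (A : Set ℝ) (γ : ℝ → X) (K : NNReal),
      LipschitzOnWith K γ A → μH[1] (γ '' A ∩ S) = 0)
    (μ : Measure X) [IsFiniteMeasure μ] (hμS : μ Sᶜ = 0)
    (m : ℕ) (p : ENNReal) [Fact (1 ≤ p)] (L : NNReal) :
    {f : {g : BoundedContinuousFunction X (PiLp p fun _ : Fin m => ℝ) // LipschitzWith L ⇑g} |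
        ∃ N ⊆ S, μ N = 0 ∧ dimH (⇑f.1 '' (S \ N)) = 0} ∈
      residual {g : BoundedContinuousFunction X (PiLp p fun _ : Fin m => ℝ) // LipschitzWith L ⇑g} := by
  rcases eq_or_ne L 0 with rfl | hL
  · refine Filter.mem_of_superset univ_mem fun f _ => ⟨∅, empty_subset _, measure_empty, ?_⟩
    refine dimH_subsingleton ?_
    rintro _ ⟨x, -, rfl⟩ _ ⟨y, -, rfl⟩
    simpa using f.2.dist_le_mul x y
  set 𝓛 := {g : BoundedContinuousFunction X (PiLp p fun _ : Fin m => ℝ) // LipschitzWith L ⇑g}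
  let O : ℕ → Set 𝓛 := fun n => {f | ∃ (E : Set X) (F : Finset (PiLp p fun _ : Fin m => ℝ)) (ρ : ℝ)
    (g : 𝓛), μ Eᶜ ≤ 2⁻¹ ^ n ∧ 0 < ρ ∧ 2 * ρ ≤ 1 / ((n : ℝ) + 1) ∧
      F.card * (2 * ρ) ^ (1 / ((n : ℝ) + 1)) ≤ 1 / ((n : ℝ) + 1) ∧ ⇑g.1 '' E ⊆ F ∧ dist f g < ρ}
  have hOopen (n : ℕ) : IsOpen (O n) := by
    refine Metric.isOpen_iff.2 ?_
    rintro f ⟨E, F, ρ, g, hE, hρ, hρ1, hF, hgF, hfg⟩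
    refine ⟨ρ - dist f g, by linarith, fun f' hf' => ⟨E, F, ρ, g, hE, hρ, hρ1, hF, hgF, ?_⟩⟩
    rw [Metric.mem_ball] at hf'
    linarith [dist_triangle f' f g]
  have hOdense (n : ℕ) : Dense (O n) := by
    refine Metric.dense_iff.2 fun f ε hε => ?_
    have hη : (2⁻¹ ^ n / 2 : ENNReal) ≠ 0 := by simp
    obtain ⟨K, hKS, hK, hKμ⟩ := exists_compact_subset_measure_compl_le hSsep μ hμS hη
    obtain ⟨g, hfg, E, hE, hgE⟩ := exists_near_finite_valued hK (fun A γ hγ hγK => by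
      have := hpu A γ 1 hγ
      rwa [inter_eq_left.2 (hγK.trans hKS)] at this) μ (pos_iff_ne_zero.2 hL) f hε hη
    obtain ⟨ρ, hρ, hρ1, hρ2⟩ := exists_radius n hgE.toFinset.card
    refine ⟨g, by rwa [Metric.mem_ball, dist_comm], E, hgE.toFinset, ρ, g, ?_, hρ, hρ1, hρ2,
      by simp, by simpa using hρ⟩
    have hsub : Eᶜ ⊆ Kᶜ ∪ (K \ E) := by
      intro x hx
      by_cases h : x ∈ K
      exacts [Or.inr ⟨h, hx⟩, Or.inl h]
    calc μ Eᶜ ≤ μ Kᶜ + μ (K \ E) := (measure_mono hsub).trans (measure_union_le _ _)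
      _ ≤ 2⁻¹ ^ n / 2 + 2⁻¹ ^ n / 2 := add_le_add hKμ hE
      _ = 2⁻¹ ^ n := ENNReal.add_halves _
  refine Filter.mem_of_superset
    (countable_iInter_mem.2 fun n => residual_of_dense_open (hOopen n) (hOdense n)) fun f hf => ?_
  choose E F ρ g hE hρ hρ1 hF hgF hfg using fun n => mem_iInter.1 hf n
  have hB : μ {x | ∃ᶠ n in atTop, x ∈ (E n)ᶜ} = 0 := by
    refine measure_setOfPred_frequently_eq_zero (ne_top_of_le_ne_top ?_ (ENNReal.tsum_le_tsum hE))
    rw [ENNReal.tsum_geometric]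
    simp
  refine ⟨S ∩ {x | ∃ᶠ n in atTop, x ∈ (E n)ᶜ}, inter_subset_left,
    measure_mono_null inter_subset_right hB, ?_⟩
  have hsub : ⇑f.1 '' (S \ (S ∩ {x | ∃ᶠ n in atTop, x ∈ (E n)ᶜ})) ⊆
      ⋃ M : ℕ, ⇑f.1 '' {x | ∀ n ≥ M, x ∈ E n} := by
    rintro _ ⟨x, ⟨hxS, hx⟩, rfl⟩
    have h1 : ¬ ∃ᶠ n in atTop, x ∈ (E n)ᶜ := fun h => hx ⟨hxS, h⟩
    rw [not_frequently] at h1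
    obtain ⟨M, hM⟩ := eventually_atTop.1 h1
    exact mem_iUnion.2 ⟨M, x, fun n hn => not_not.1 (hM n hn), rfl⟩
  refine le_antisymm ((dimH_mono hsub).trans ?_) zero_le
  rw [dimH_iUnion]
  refine iSup_le fun M => (dimH_eq_zero_of_small_covers hρ hρ1 hF ?_).le
  filter_upwards [eventually_ge_atTop M] with n hn
  rintro _ ⟨x, hx, rfl⟩
  refine mem_iUnion₂.2 ⟨(g n).1 x, hgF n ⟨x, hx n hn, rfl⟩, ?_⟩
  exact (BoundedContinuousFunction.dist_coe_le_dist x).trans_lt (hfg n)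
end

section
/- Let (R, Σ) be a measurable space and let μ and ν be finite measures on (R, Σ) with μ absolutely continuous with respect to ν. Then for every α > 0 there exists ε > 0 such that: whenever ν̃ is a finite measure on (R, Σ) with ν̃ ≤ ν and ν(R) − ν̃(R) ≤ ε, there is a measurable set E ⊆ R with μ(R ∖ E) ≤ α such that the restriction μ|_E is absolutely continuous with respect to ν̃. -/
open MeasureTheory

open scoped ENNReal

/-- A finite measure `μ ≪ ν` is uniformly small on sets of small `ν`-measure. -/
theorem exists_pos_measure_lt_of_absolutelyContinuous {R : Type*} [MeasurableSpace R]
    {μ ν : Measure R} [IsFiniteMeasure μ] [SigmaFinite ν] (hac : μ ≪ ν)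
    {a : ℝ≥0∞} (ha : a ≠ 0) :
    ∃ δ > 0, ∀ s, ν s < δ → μ s < a := by
  obtain ⟨δ, hδ, h⟩ := exists_pos_setLIntegral_lt_of_measure_lt
    (Measure.lintegral_rnDeriv_lt_top μ ν).ne ha
  refine ⟨δ, hδ, fun s hs => ?_⟩
  rw [← Measure.setLIntegral_rnDeriv hac s]
  exact h s hs

/-- A measure with a Lebesgue decomposition with respect to `ν` is absolutely continuous with
respect to `ν` off a `ν`-null set. -/
theorem exists_restrict_absolutelyContinuous {R : Type*} [MeasurableSpace R]
    (μ ν : Measure R) [μ.HaveLebesgueDecomposition ν] :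
    ∃ E, MeasurableSet E ∧ ν Eᶜ = 0 ∧ μ.restrict E ≪ ν := by
  have hs := Measure.mutuallySingular_singularPart μ ν
  refine ⟨hs.nullSet, hs.measurableSet_nullSet, hs.measure_compl_nullSet, ?_⟩
  nth_rewrite 1 [Measure.haveLebesgueDecomposition_add μ ν]
  rw [Measure.restrict_add, hs.restrict_nullSet, zero_add]
  exact Measure.restrict_le_self.absolutelyContinuous.trans
    (withDensity_absolutelyContinuous ν _)

/-- If `ν' ≤ ν`, then a `ν'`-null set has `ν`-measure at most the total mass defect. -/
theorem measure_le_mass_sub_of_null {R : Type*} [MeasurableSpace R]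
    {ν ν' : Measure R} [IsFiniteMeasure ν'] (hle : ν' ≤ ν) {s : Set R}
    (hs : MeasurableSet s) (h0 : ν' s = 0) :
    ν s ≤ ν Set.univ - ν' Set.univ := by
  refine ENNReal.le_sub_of_add_le_right (measure_ne_top ν' _) ?_
  rw [← measure_add_measure_compl hs (μ := ν), ← measure_add_measure_compl hs (μ := ν'), h0,
    zero_add]
  gcongr

/-- Let `μ ≪ ν` be finite measures. For every `α > 0` there is `ε > 0` such that whenever
`ν̃ ≤ ν` is a finite measure with `ν(R) − ν̃(R) ≤ ε`, there is a measurable set `E` with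
`μ(R ∖ E) ≤ α` and `μ|_E ≪ ν̃`. -/
theorem stmt_5 {R : Type*} [MeasurableSpace R] (μ ν : Measure R)
    [IsFiniteMeasure μ] [IsFiniteMeasure ν] (hac : μ ≪ ν)
    (α : ℝ) (hα : 0 < α) :
    ∃ ε : ℝ, 0 < ε ∧ ∀ ν' : Measure R, IsFiniteMeasure ν' → ν' ≤ ν →
      ν Set.univ - ν' Set.univ ≤ ENNReal.ofReal ε →
      ∃ E : Set R, MeasurableSet E ∧ μ Eᶜ ≤ ENNReal.ofReal α ∧ μ.restrict E ≪ ν' := by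
  obtain ⟨δ, hδ, hsmall⟩ := exists_pos_measure_lt_of_absolutelyContinuous hac
    (ENNReal.ofReal_pos.2 hα).ne'
  obtain ⟨ε, hε, hεδ⟩ := ENNReal.lt_iff_exists_nnreal_btwn.1 hδ
  refine ⟨ε, by exact_mod_cast hε, fun ν' _ hle hdefect => ?_⟩
  obtain ⟨E, hE, hnull, hEac⟩ := exists_restrict_absolutelyContinuous μ ν'
  refine ⟨E, hE, (hsmall _ ?_).le, hEac⟩
  rw [ENNReal.ofReal_coe_nnreal] at hdefect
  exact ((measure_le_mass_sub_of_null hle hE.compl hnull).trans hdefect).trans_lt hεδ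
end

section
/- For every η > 0 there exists L ∈ [1, ∞) such that the following holds: for every D > 0, every r > 0, every Borel probability measure μ on [−D, D] and every ε > 0, there exists a map h : [−D, D] → ℝ such that (1) |h(t) − t| < ε for all t ∈ [−D, D]; (2) h is L-Lipschitz; (3) |h(s) − h(t)| ≤ |s − t| whenever s, t ∈ [−D, D] satisfy |s − t| ≥ r; (4) there is a compact set E ⊆ [−D, D] with μ(E) ≥ 1 − η such that h(E) is a finite set. -/
open MeasureTheory

/-- The staircase that climbs by one on the first `1 / N` of each unit interval, and is constant
on the rest of it. -/
noncomputable def staircase (N : ℕ) (x : ℝ) : ℝ :=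
  ⌊x⌋ + min 1 (N * Int.fract x)

section Staircase

variable {N : ℕ}

theorem le_staircase (hN : 1 ≤ N) (x : ℝ) : x ≤ staircase N x := by
  have hN' : (1 : ℝ) ≤ N := by exact_mod_cast hN
  have h : Int.fract x ≤ min 1 (N * Int.fract x) :=
    le_min (Int.fract_lt_one x).le (by nlinarith [Int.fract_nonneg x])
  have := Int.floor_add_fract x
  unfold staircase
  linarith

theorem staircase_le_add_one (x : ℝ) : staircase N x ≤ x + 1 := by
  have h := min_le_left 1 ((N : ℝ) * Int.fract x)
  have := Int.floor_le x
  unfold staircase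
  linarith

theorem staircase_mono : Monotone (staircase N) := by
  intro x y hxy
  unfold staircase
  rcases (Int.floor_mono hxy).eq_or_lt with h | h
  · have hf : Int.fract x ≤ Int.fract y := by
      unfold Int.fract
      rw [h]
      linarith
    rw [h]
    gcongr
  · have h' : (⌊x⌋ : ℝ) + 1 ≤ ⌊y⌋ := by exact_mod_cast h
    have hx := min_le_left 1 ((N : ℝ) * Int.fract x)
    have hy : 0 ≤ min 1 ((N : ℝ) * Int.fract y) :=
      le_min zero_le_one (mul_nonneg N.cast_nonneg (Int.fract_nonneg y))
    linarith

theorem staircase_sub_le (hN : 1 ≤ N) {x y : ℝ} (hxy : x ≤ y) :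
    staircase N y - staircase N x ≤ N * (y - x) := by
  have hN' : (1 : ℝ) ≤ N := by exact_mod_cast hN
  have hx := Int.floor_add_fract x
  have hy := Int.floor_add_fract y
  have hmy := min_le_right 1 ((N : ℝ) * Int.fract y)
  have hNx : (N : ℝ) * x = N * ⌊x⌋ + N * Int.fract x := by rw [← mul_add, hx]
  have hNy : (N : ℝ) * y = N * ⌊y⌋ + N * Int.fract y := by rw [← mul_add, hy]
  unfold staircase
  rcases (Int.floor_mono hxy).eq_or_lt with h | h
  · have hf : Int.fract x ≤ Int.fract y := by
      unfold Int.fract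
      rw [h]
      linarith
    have hNf : (N : ℝ) * Int.fract x ≤ N * Int.fract y := by gcongr
    have hm1 := min_le_left 1 ((N : ℝ) * Int.fract y)
    rw [h] at hNx ⊢
    rcases min_cases 1 ((N : ℝ) * Int.fract x) with ⟨h1, -⟩ | ⟨h1, -⟩ <;> rw [h1] <;> linarith
  · have h' : (⌊x⌋ : ℝ) + 1 ≤ ⌊y⌋ := by exact_mod_cast h
    have hfx : (N : ℝ) * Int.fract x ≤ N := by nlinarith [Int.fract_lt_one x]
    have hprod : 0 ≤ ((N : ℝ) - 1) * (⌊y⌋ - ⌊x⌋ - 1) :=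
      mul_nonneg (by linarith) (by linarith)
    rcases min_cases 1 ((N : ℝ) * Int.fract x) with ⟨h1, -⟩ | ⟨h1, -⟩ <;> rw [h1] <;> linarith

theorem abs_staircase_sub_le (hN : 1 ≤ N) (x y : ℝ) :
    |staircase N x - staircase N y| ≤ N * |x - y| := by
  rcases le_total x y with h | h
  · rw [abs_sub_comm, abs_sub_comm x, abs_of_nonneg (sub_nonneg.2 (staircase_mono h)),
      abs_of_nonneg (sub_nonneg.2 h)]
    exact staircase_sub_le hN h
  · rw [abs_of_nonneg (sub_nonneg.2 (staircase_mono h)), abs_of_nonneg (sub_nonneg.2 h)]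
    exact staircase_sub_le hN h

theorem abs_staircase_sub_le_add_one (hN : 1 ≤ N) (x y : ℝ) :
    |staircase N x - staircase N y| ≤ |x - y| + 1 := by
  have := le_staircase hN x
  have := le_staircase hN y
  have := staircase_le_add_one (N := N) x
  have := staircase_le_add_one (N := N) y
  rw [abs_le]
  constructor <;> linarith [le_abs_self (x - y), neg_abs_le (x - y)]

theorem continuous_staircase (hN : 1 ≤ N) : Continuous (staircase N) :=
  (LipschitzWith.of_dist_le_mul (K := (N : NNReal)) fun x y => by
    simpa [Real.dist_eq] using abs_staircase_sub_le hN x y).continuous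

/-- Where a staircase shifted by `j / N` is not integer-valued, the shift `j` can be recovered. -/
theorem floor_emod_eq_of_staircase_notMem_range (hN : 1 ≤ N) {j : ℕ} (hj : j < N) {x : ℝ}
    (h : staircase N (x - j / N) ∉ Set.range ((↑) : ℤ → ℝ)) :
    ⌊N * x⌋ % (N : ℤ) = j := by
  have hN' : (0 : ℝ) < N := by exact_mod_cast hN
  set u := x - j / N with hu
  have hlt : (N : ℝ) * Int.fract u < 1 := by
    by_contra! hge
    exact h ⟨⌊u⌋ + 1, by simp [staircase, min_eq_left hge]⟩
  have hnn : 0 ≤ (N : ℝ) * Int.fract u := mul_nonneg hN'.le (Int.fract_nonneg u)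
  have hNx : (N : ℝ) * x = N * ⌊u⌋ + j + N * Int.fract u := by
    have : x = u + j / N := by rw [hu]; ring
    rw [this]
    nth_rewrite 1 [← Int.floor_add_fract u]
    field_simp
    ring
  have hfl : ⌊(N : ℝ) * x⌋ = j + N * ⌊u⌋ := by
    rw [Int.floor_eq_iff]
    push_cast
    constructor <;> linarith
  rw [hfl, Int.add_mul_emod_self_left]
  exact Int.emod_eq_of_lt (by positivity) (by exact_mod_cast hj)

end Staircase

/-- Among `N` disjoint measurable sets, one has probability at most `1 / N`. -/
theorem exists_measureReal_fiber_le {Ω : Type*} [MeasurableSpace Ω] (μ : Measure Ω)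
    [IsProbabilityMeasure μ] {φ : Ω → ℤ} (hφ : Measurable φ) {N : ℕ} (hN : 1 ≤ N) :
    ∃ j < N, μ.real (φ ⁻¹' {(j : ℤ)}) ≤ 1 / N := by
  have hN' : (0 : ℝ) < N := by exact_mod_cast hN
  have hsum : ∑ j ∈ Finset.range N, μ.real (φ ⁻¹' {(j : ℤ)}) ≤
      ∑ _j ∈ Finset.range N, (1 / N : ℝ) := by
    rw [← measureReal_biUnion_finset]
    · refine measureReal_le_one.trans (le_of_eq ?_)
      simp [hN'.ne']
    · intro i _ j _ hij
      exact Disjoint.preimage φ (by simpa using hij)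
    · exact fun j _ => hφ (measurableSet_singleton _)
  obtain ⟨j, hj, hle⟩ := Finset.exists_le_of_sum_le ⟨0, Finset.mem_range.2 hN⟩ hsum
  exact ⟨j, Finset.mem_range.1 hj, hle⟩

/-- For every `η > 0` there is `L ≥ 1` such that for every `D > 0`, `r > 0`, every Borel
probability measure `μ` on `[−D, D]` and every `ε > 0`, there is `h : [−D, D] → ℝ` which is
within `ε` of the identity, `L`-Lipschitz, 1-Lipschitz at scales `≥ r`, and maps a compact set
of `μ`-measure `≥ 1 − η` onto a finite set. -/
theorem stmt_7 (η : ℝ) (hη : 0 < η) :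
    ∃ L : NNReal, 1 ≤ L ∧
      ∀ D : ℝ, 0 < D → ∀ r : ℝ, 0 < r →
        ∀ μ : Measure ℝ, IsProbabilityMeasure μ → μ (Set.Icc (-D) D)ᶜ = 0 →
          ∀ ε : ℝ, 0 < ε →
            ∃ h : ℝ → ℝ,
              (∀ t ∈ Set.Icc (-D) D, |h t - t| < ε) ∧
              LipschitzOnWith L h (Set.Icc (-D) D) ∧
              (∀ s ∈ Set.Icc (-D) D, ∀ t ∈ Set.Icc (-D) D, r ≤ |s - t| →
                |h s - h t| ≤ |s - t|) ∧
              ∃ E ⊆ Set.Icc (-D) D, IsCompact E ∧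
                ENNReal.ofReal (1 - η) ≤ μ E ∧ (h '' E).Finite := by
  obtain ⟨n, hn⟩ := exists_nat_one_div_lt hη
  obtain ⟨N, hNn⟩ : ∃ N, N = n + 1 := ⟨_, rfl⟩
  have hN : 1 ≤ N := by omega
  have hN' : (0 : ℝ) < N := by exact_mod_cast hN
  have hNη : (1 / N : ℝ) < η := by rw [hNn]; exact_mod_cast hn
  refine ⟨N, by exact_mod_cast hN, ?_⟩
  intro D hD r hr μ hμ hsupp ε hε
  -- `1 - δ` is the contraction factor, `p` the period of the staircase
  obtain ⟨δ, hδ0, hδ1, hδD⟩ : ∃ δ : ℝ, 0 < δ ∧ δ < 1 ∧ δ * D < ε / 2 := by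
    refine ⟨ε / (2 * D + ε), by positivity, ?_, ?_⟩
    · rw [div_lt_one (by positivity)]
      linarith
    · rw [div_mul_eq_mul_div, div_lt_div_iff₀ (by positivity) two_pos]
      nlinarith [sq_pos_of_pos hε]
  obtain ⟨p, hp0, hpε, hpr⟩ : ∃ p : ℝ, 0 < p ∧ p ≤ ε / 2 ∧ p ≤ δ * r :=
    ⟨min (ε / 2) (δ * r), lt_min (by positivity) (by positivity), min_le_left _ _,
      min_le_right _ _⟩
  have hφ : Measurable fun t : ℝ => ⌊N * (t / p)⌋ % (N : ℤ) :=
    (measurable_of_countable fun k : ℤ => k % (N : ℤ)).comp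
      (Int.measurable_floor.comp (by fun_prop))
  obtain ⟨j, hj, hμj⟩ := exists_measureReal_fiber_le μ hφ hN
  have hc0 : (0 : ℝ) ≤ j / N := by positivity
  have hc1 : (j / N : ℝ) ≤ 1 := by
    rw [div_le_one hN']
    exact_mod_cast hj.le
  set c : ℝ := j / N
  set f : ℝ → ℝ := fun t => staircase N (t / p - c) with hf
  have hfc : Continuous f := (continuous_staircase hN).comp (by fun_prop)
  have hsub (s t : ℝ) : p * |s / p - c - (t / p - c)| = |s - t| := by
    rw [sub_sub_sub_cancel_right, ← sub_div, abs_div, abs_of_pos hp0]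
    field_simp
  have habs (s t : ℝ) : |(1 - δ) * (p * f s) - (1 - δ) * (p * f t)| =
      (1 - δ) * (p * |f s - f t|) := by
    rw [← mul_sub, ← mul_sub, abs_mul, abs_mul, abs_of_pos hp0, abs_of_pos (by linarith)]
  refine ⟨fun t => (1 - δ) * (p * f t), ?_, ?_, ?_, ?_⟩
  · rintro t ⟨ht1, ht2⟩
    have h1 := mul_le_mul_of_nonneg_left (le_staircase hN (t / p - c)) hp0.le
    have h2 := mul_le_mul_of_nonneg_left (staircase_le_add_one (N := N) (t / p - c)) hp0.le
    have hpt : p * (t / p) = t := by field_simp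
    rw [mul_sub, hpt] at h1
    rw [mul_add, mul_sub, hpt] at h2
    have hg : |p * f t - t| ≤ p := by
      rw [abs_le]
      constructor <;> simp only [hf] <;> nlinarith
    have ht : |t| ≤ D := abs_le.2 ⟨ht1, ht2⟩
    calc |(1 - δ) * (p * f t) - t| = |(1 - δ) * (p * f t - t) - δ * t| := by ring_nf
      _ ≤ |(1 - δ) * (p * f t - t)| + |δ * t| := abs_sub _ _
      _ = (1 - δ) * |p * f t - t| + δ * |t| := by
        rw [abs_mul, abs_mul, abs_of_pos hδ0, abs_of_pos (by linarith : 0 < 1 - δ)]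
      _ ≤ 1 * p + δ * D := by gcongr; linarith
      _ < ε := by linarith
  · refine LipschitzOnWith.of_dist_le_mul fun s _ t _ => ?_
    rw [Real.dist_eq, Real.dist_eq, habs, ← hsub s t]
    calc (1 - δ) * (p * |f s - f t|)
        ≤ 1 * (p * (N * |s / p - c - (t / p - c)|)) := by
          gcongr
          · linarith
          · exact abs_staircase_sub_le hN _ _
      _ = (N : NNReal) * (p * |s / p - c - (t / p - c)|) := by push_cast; ring
  · intro s _ t _ hst
    rw [habs]
    have h1 : p * |f s - f t| ≤ |s - t| + p := by
      rw [← hsub s t, ← mul_add_one]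
      gcongr
      exact abs_staircase_sub_le_add_one hN _ _
    have h2 : δ * r ≤ δ * |s - t| := by gcongr
    calc (1 - δ) * (p * |f s - f t|) ≤ (1 - δ) * (|s - t| + p) := by gcongr
      _ ≤ |s - t| := by nlinarith
  · set E : Set ℝ := Set.Icc (-D) D ∩ f ⁻¹' Set.range ((↑) : ℤ → ℝ)
    have hEc : IsCompact E :=
      isCompact_Icc.inter_right (Int.isClosedEmbedding_coe_real.isClosed_range.preimage hfc)
    refine ⟨E, Set.inter_subset_left, hEc, ?_, ?_⟩
    · have hcover : (Set.univ : Set ℝ) ⊆ E ∪ (fun t : ℝ => ⌊N * (t / p)⌋ % (N : ℤ)) ⁻¹' {(j : ℤ)} ∪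
          (Set.Icc (-D) D)ᶜ := by
        intro t _
        by_cases htI : t ∈ Set.Icc (-D) D
        · by_cases hft : f t ∈ Set.range ((↑) : ℤ → ℝ)
          · exact Or.inl (Or.inl ⟨htI, hft⟩)
          · exact Or.inl (Or.inr (floor_emod_eq_of_staircase_notMem_range hN hj hft))
        · exact Or.inr htI
      have h0 : μ.real (Set.Icc (-D) D)ᶜ = 0 := by simp [Measure.real, hsupp]
      have h1 := (measureReal_mono (μ := μ) hcover).trans
        ((measureReal_union_le _ _).trans (add_le_add_left (measureReal_union_le _ _) _))
      rw [probReal_univ, h0] at h1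
      rw [ENNReal.ofReal_le_iff_le_toReal (measure_ne_top _ _)]
      change 1 - η ≤ μ.real E
      linarith
    · have hfE : (f '' E).Finite := by
        obtain ⟨M, hM⟩ := (hEc.image hfc).isBounded.exists_norm_le
        refine ((Set.finite_Icc ⌈-M⌉ ⌊M⌋).image ((↑) : ℤ → ℝ)).subset ?_
        rintro _ ⟨t, ht, rfl⟩
        obtain ⟨k, hk⟩ := ht.2
        have hb := abs_le.1 (hM _ ⟨t, ht, rfl⟩)
        rw [← hk] at hb
        exact ⟨k, ⟨Int.ceil_le.2 hb.1, Int.le_floor.2 hb.2⟩, hk⟩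
      simpa only [Set.image_image] using hfE.image fun y => (1 - δ) * (p * y)
end

section
/- Fix t₀ ∈ ℝ, R > 0 and an integer N ≥ 1. Let G = ⋃_{k ∈ ℤ} [t₀ + kR, t₀ + kR + R/N) and define g : ℝ → ℝ by g(t) = ∫_{t₀}^{t} N·1_G(u) du. Then for all s, t ∈ ℝ with |s − t| ≥ 2R, one has |g(s) − g(t)| ≤ ((⌊|s − t|/R⌋ + 1)/(⌊|s − t|/R⌋ − 1)) · |s − t|. -/
open MeasureTheory intervalIntegral

/-- The union of the left `N`-th parts of the cells of a grid of mesh `R` based at `t₀`. -/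
def gridSet (t₀ R : ℝ) (N : ℕ) : Set ℝ :=
  ⋃ k : ℤ, Set.Ico (t₀ + k * R) (t₀ + k * R + R / N)

/-- The density `N · 1_G` of the set `G = gridSet t₀ R N`. -/
noncomputable def gridDensity (t₀ R : ℝ) (N : ℕ) (u : ℝ) : ℝ :=
  (N : ℝ) * (gridSet t₀ R N).indicator 1 u

lemma measurableSet_gridSet (t₀ R : ℝ) (N : ℕ) : MeasurableSet (gridSet t₀ R N) :=
  MeasurableSet.iUnion fun _ => measurableSet_Ico

lemma add_mem_gridSet_iff (t₀ R : ℝ) (N : ℕ) (u : ℝ) :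
    u + R ∈ gridSet t₀ R N ↔ u ∈ gridSet t₀ R N := by
  simp only [gridSet, Set.mem_iUnion, Set.mem_Ico]
  constructor
  · rintro ⟨k, h₁, h₂⟩
    refine ⟨k - 1, ?_, ?_⟩ <;> push_cast <;> linarith
  · rintro ⟨k, h₁, h₂⟩
    refine ⟨k + 1, ?_, ?_⟩ <;> push_cast <;> linarith

lemma gridDensity_periodic (t₀ R : ℝ) (N : ℕ) : Function.Periodic (gridDensity t₀ R N) R := by
  intro u
  classical
  simp only [gridDensity, Set.indicator_apply, add_mem_gridSet_iff]
  rfl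

lemma gridDensity_nonneg (t₀ R : ℝ) (N : ℕ) (u : ℝ) : 0 ≤ gridDensity t₀ R N u :=
  mul_nonneg N.cast_nonneg (Set.indicator_nonneg (fun _ _ => zero_le_one) u)

lemma intervalIntegrable_gridDensity (t₀ R : ℝ) (N : ℕ) (a b : ℝ) :
    IntervalIntegrable (gridDensity t₀ R N) volume a b := by
  refine IntervalIntegrable.const_mul ?_ _
  rw [intervalIntegrable_iff]
  have h : IntegrableOn (fun _ : ℝ => (1 : ℝ)) (Set.uIoc a b) :=
    intervalIntegrable_iff.1 intervalIntegrable_const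
  exact h.indicator (measurableSet_gridSet t₀ R N)

lemma mem_gridSet_iff_of_mem_Ico {t₀ R : ℝ} (hR : 0 < R) {N : ℕ} (hN : 1 ≤ N) {u : ℝ}
    (hu : u ∈ Set.Ico t₀ (t₀ + R)) : u ∈ gridSet t₀ R N ↔ u < t₀ + R / N := by
  simp only [gridSet, Set.mem_iUnion, Set.mem_Ico]
  constructor
  · rintro ⟨k, h₁, h₂⟩
    have hdiv : R / N ≤ R := div_le_self hR.le (by exact_mod_cast hN)
    have hk₁ : (k : ℝ) < 1 := by nlinarith [hu.2]
    have hk₂ : (-1 : ℝ) < k := by nlinarith [hu.1]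
    have hk : k = 0 := by
      have h₃ : k < 1 := by exact_mod_cast hk₁
      have h₄ : -1 < k := by exact_mod_cast hk₂
      omega
    simpa [hk] using h₂
  · intro h
    exact ⟨0, by simpa using hu.1, by simpa using h⟩

lemma integral_gridDensity_period {t₀ R : ℝ} (hR : 0 < R) {N : ℕ} (hN : 1 ≤ N) :
    ∫ u in t₀..t₀ + R, gridDensity t₀ R N u = R := by
  have hN₀ : (0 : ℝ) < N := by exact_mod_cast hN
  have hdiv : R / N ≤ R := div_le_self hR.le (by exact_mod_cast hN)
  have hpos : 0 < R / N := div_pos hR hN₀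
  rw [← integral_add_adjacent_intervals
    (intervalIntegrable_gridDensity t₀ R N t₀ (t₀ + R / N))
    (intervalIntegrable_gridDensity t₀ R N (t₀ + R / N) (t₀ + R))]
  have h₁ : ∫ u in t₀..t₀ + R / N, gridDensity t₀ R N u = ∫ _ in t₀..t₀ + R / N, (N : ℝ) := by
    refine integral_congr_Ioo_of_le (by linarith) fun u hu => ?_
    have hmem := (mem_gridSet_iff_of_mem_Ico (t₀ := t₀) hR hN
      ⟨hu.1.le, by linarith [hu.2]⟩).2 hu.2
    simp [gridDensity, hmem]
  have h₂ : ∫ u in t₀ + R / N..t₀ + R, gridDensity t₀ R N u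
      = ∫ _ in t₀ + R / N..t₀ + R, (0 : ℝ) := by
    refine integral_congr_Ioo_of_le (by linarith) fun u hu => ?_
    have hmem : u ∉ gridSet t₀ R N := fun h => hu.1.not_gt
      ((mem_gridSet_iff_of_mem_Ico hR hN ⟨by linarith [hu.1], hu.2⟩).1 h)
    simp [gridDensity, hmem]
  rw [h₁, h₂]
  simp only [intervalIntegral.integral_const, smul_eq_mul, mul_zero, add_zero]
  field_simp
  ring

/-- Covering `[a, b]` by `⌊(b - a) / R⌋ + 1` periods bounds the mass of the density on it. -/
lemma integral_gridDensity_le {t₀ R : ℝ} (hR : 0 < R) {N : ℕ} (hN : 1 ≤ N) {a b : ℝ}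
    (hab : a ≤ b) :
    ∫ u in a..b, gridDensity t₀ R N u ≤ ((⌊(b - a) / R⌋ : ℝ) + 1) * R := by
  set n : ℤ := ⌊(b - a) / R⌋
  have hb : b ≤ a + (n + 1 : ℤ) • R := by
    have := (div_lt_iff₀ hR).1 (Int.lt_floor_add_one ((b - a) / R))
    rw [zsmul_eq_mul]
    push_cast
    linarith
  calc ∫ u in a..b, gridDensity t₀ R N u
      ≤ ∫ u in a..a + (n + 1 : ℤ) • R, gridDensity t₀ R N u :=
        integral_mono_interval le_rfl hab hb
          (Filter.Eventually.of_forall (gridDensity_nonneg t₀ R N))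
          (intervalIntegrable_gridDensity t₀ R N _ _)
    _ = ((n : ℝ) + 1) * R := by
        rw [(gridDensity_periodic t₀ R N).intervalIntegral_add_zsmul_eq,
          (gridDensity_periodic t₀ R N).intervalIntegral_add_eq a t₀,
          integral_gridDensity_period hR hN, zsmul_eq_mul]
        · push_cast
          rfl
        · exact intervalIntegrable_gridDensity t₀ R N

lemma abs_integral_gridDensity_le {t₀ R : ℝ} (hR : 0 < R) {N : ℕ} (hN : 1 ≤ N) (a b : ℝ) :
    |∫ u in a..b, gridDensity t₀ R N u| ≤ ((⌊|b - a| / R⌋ : ℝ) + 1) * R := by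
  wlog hab : a ≤ b generalizing a b
  · rw [integral_symm, abs_neg, abs_sub_comm]
    exact this b a (le_of_not_ge hab)
  · rw [abs_of_nonneg (integral_nonneg hab fun u _ => gridDensity_nonneg t₀ R N u),
      abs_of_nonneg (sub_nonneg.2 hab)]
    exact integral_gridDensity_le hR hN hab

/-- Large-scale Lipschitz estimate for the concentrating map `g` of the real line. -/
theorem stmt_8 (t₀ R : ℝ) (hR : 0 < R) (N : ℕ) (hN : 1 ≤ N)
    (G : Set ℝ) (hG : G = ⋃ k : ℤ, Set.Ico (t₀ + k * R) (t₀ + k * R + R / N))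
    (g : ℝ → ℝ) (hg : g = fun t => ∫ u in t₀..t, (N : ℝ) * G.indicator 1 u)
    (s t : ℝ) (hst : 2 * R ≤ |s - t|) :
    |g s - g t| ≤
      (((⌊|s - t| / R⌋ : ℝ) + 1) / ((⌊|s - t| / R⌋ : ℝ) - 1)) * |s - t| := by
  have hgs : g s - g t = ∫ u in t..s, gridDensity t₀ R N u := by
    rw [hg, hG]
    exact integral_interval_sub_left (intervalIntegrable_gridDensity t₀ R N t₀ s)
      (intervalIntegrable_gridDensity t₀ R N t₀ t)
  have hn : (2 : ℝ) ≤ ⌊|s - t| / R⌋ := by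
    exact_mod_cast Int.le_floor.2 ((le_div_iff₀ hR).2 (by exact_mod_cast hst))
  have hnR := (le_div_iff₀ hR).1 (Int.floor_le (|s - t| / R))
  rw [hgs]
  refine (abs_integral_gridDensity_le hR hN t s).trans ?_
  rw [div_mul_eq_mul_div, mul_div_assoc]
  refine mul_le_mul_of_nonneg_left ?_ (by linarith)
  rw [le_div_iff₀ (by linarith)]
  linarith
end

section
/- Let X be a finite-dimensional strictly convex real normed space, let γ : K → X be a curve fragment with H¹(K) > 0, and let C ⊆ X be a convex set containing an open neighbourhood of γ(K). Then for every δ > 0 there exists ε > 0 such that: whenever f : C → X is 1-Lipschitz and sup_{x ∈ C} ‖f(x) − x‖ < ε, the set of t ∈ K at which both γ and f∘γ have derivatives within K and these derivatives satisfy ‖(f∘γ)'(t) − γ'(t)‖ ≥ δ has H¹-measure at most δ · H¹(K). -/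
open MeasureTheory Filter Topology

/-- In a finite-dimensional strictly convex space, strict convexity is uniform on bounded sets. -/
theorem exists_norm_add_add_le_two_mul_norm {X : Type*} [NormedAddCommGroup X] [NormedSpace ℝ X]
    [FiniteDimensional ℝ X] [StrictConvexSpace ℝ X] (L : ℝ) {δ : ℝ} (hδ : 0 < δ) :
    ∃ η > 0, ∀ v w : X, ‖v‖ ≤ L → ‖w‖ ≤ ‖v‖ → δ ≤ ‖w - v‖ → ‖v + w‖ + η ≤ 2 * ‖v‖ := by
  have : ProperSpace X := FiniteDimensional.proper ℝ X
  let S : Set (X × X) := {q | ‖q.1‖ ≤ L} ∩ ({q | ‖q.2‖ ≤ ‖q.1‖} ∩ {q | δ ≤ ‖q.2 - q.1‖})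
  have hScl : IsClosed S :=
    (isClosed_le (by fun_prop) (by fun_prop)).inter
      ((isClosed_le (by fun_prop) (by fun_prop)).inter
        (isClosed_le (by fun_prop) (by fun_prop)))
  have hS : IsCompact S := by
    refine (isCompact_closedBall (0 : X × X) L).of_isClosed_subset hScl fun q hq => ?_
    rw [mem_closedBall_zero_iff, Prod.norm_def]
    exact max_le hq.1 (hq.2.1.trans hq.1)
  have hpos : ∀ q ∈ S, 0 < 2 * ‖q.1‖ - ‖q.1 + q.2‖ := by
    rintro ⟨v, w⟩ ⟨-, hwv, hd⟩
    have hne : v ≠ w := by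
      rintro rfl
      have hd' : δ ≤ ‖v - v‖ := hd
      rw [sub_self, norm_zero] at hd'
      linarith
    have h := norm_combo_lt_of_ne le_rfl hwv hne (a := 1 / 2) (b := 1 / 2) (by norm_num)
      (by norm_num) (by norm_num)
    rw [← smul_add, norm_smul, Real.norm_of_nonneg (by norm_num)] at h
    dsimp only
    linarith
  rcases S.eq_empty_or_nonempty with hemp | hne
  · refine ⟨1, one_pos, fun v w hv hw hd => ?_⟩
    have : (v, w) ∈ S := ⟨hv, hw, hd⟩
    simp [hemp] at this
  · obtain ⟨q, hq, hmin⟩ := hS.exists_isMinOn hne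
      (f := fun q : X × X => 2 * ‖q.1‖ - ‖q.1 + q.2‖) (by fun_prop)
    refine ⟨_, hpos q hq, fun v w hv hw hd => ?_⟩
    have := hmin (show (v, w) ∈ S from ⟨hv, hw, hd⟩)
    simp only [Set.mem_ofPred_eq] at this
    linarith

/-- Uniformly small functions with a common Lipschitz constant have derivatives of small integral
over any fixed set of finite measure. -/
theorem eventually_abs_setIntegral_deriv_le {E : Set ℝ} (hE : MeasurableSet E)
    (hEfin : volume E ≠ ⊤) (M : NNReal) {τ : ℝ} (hτ : 0 < τ) :
    ∀ᶠ ε in 𝓝[>] (0 : ℝ), ∀ h : ℝ → ℝ, LipschitzWith M h → (∀ t, |h t| ≤ ε) →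
      |∫ t in E, deriv h t| ≤ τ := by
  have hmem : MemLp (E.indicator fun _ => (1 : ℝ)) 1 volume :=
    memLp_indicator_const 1 hE 1 (Or.inr hEfin)
  have hσ : 0 < τ / (2 * (M + 1)) := by positivity
  obtain ⟨u, hucs, husm, hu⟩ := hmem.exist_eLpNorm_sub_le (by simp) le_rfl hσ
  obtain ⟨Cu, hCu⟩ := ContDiff.lipschitzWith_of_hasCompactSupport hucs husm (by simp)
  have hui : Integrable u := husm.continuous.integrable_of_hasCompactSupport hucs
  have hmi : Integrable (E.indicator fun _ => (1 : ℝ)) := memLp_one_iff_integrable.1 hmem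
  have hdu : Integrable (deriv u) :=
    (husm.continuous_deriv (by simp)).integrable_of_hasCompactSupport hucs.deriv
  have hnorm : ∫ t, ‖E.indicator (fun _ => (1 : ℝ)) t - u t‖ ≤ τ / (2 * (M + 1)) := by
    rw [integral_norm_eq_lintegral_enorm (f := fun t => E.indicator (fun _ => (1 : ℝ)) t - u t)
      (hmi.sub hui).aestronglyMeasurable]
    rw [eLpNorm_one_eq_lintegral_enorm] at hu
    exact ENNReal.toReal_le_of_le_ofReal hσ.le hu
  have hsmall : ∀ᶠ ε in 𝓝[>] (0 : ℝ), ε * ∫ t, ‖deriv u t‖ < τ / 2 := by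
    refine nhdsWithin_le_nhds (ContinuousAt.eventually_lt (by fun_prop) (by fun_prop) ?_)
    simpa using hτ
  filter_upwards [hsmall] with ε hε h hh hhε
  have hb : ∀ t, ‖deriv h t‖ ≤ M := fun t => norm_deriv_le_of_lipschitz hh
  have hparts : ∫ t, deriv h t * u t = -∫ t, deriv u t * h t := by
    have lineDeriv_one : ∀ (k : ℝ → ℝ) (t : ℝ), lineDeriv ℝ k t 1 = deriv k t := fun k t => by
      simp [lineDeriv, deriv_comp_const_add]
    have := LipschitzWith.integral_lineDeriv_mul_eq (μ := volume) hh hCu hucs (1 : ℝ)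
    rw [← integral_neg]
    simpa [lineDeriv_neg, lineDeriv_one] using this
  have hui' : Integrable fun t => deriv h t * u t :=
    hui.bdd_mul (measurable_deriv h).aestronglyMeasurable (ae_of_all _ hb)
  have hmi' : Integrable fun t => deriv h t * E.indicator (fun _ => (1 : ℝ)) t :=
    hmi.bdd_mul (measurable_deriv h).aestronglyMeasurable (ae_of_all _ hb)
  have hsplit : ∫ t in E, deriv h t =
      (∫ t, deriv h t * (E.indicator (fun _ => (1 : ℝ)) t - u t)) - ∫ t, deriv u t * h t := by
    simp_rw [mul_sub]
    rw [integral_sub hmi' hui', hparts, ← integral_indicator hE]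
    rw [sub_neg_eq_add, add_sub_cancel_right]
    congr with t
    by_cases ht : t ∈ E <;> simp [ht]
  have hfst : |∫ t, deriv h t * (E.indicator (fun _ => (1 : ℝ)) t - u t)| ≤ τ / 2 := by
    calc _ ≤ ∫ t, M * ‖E.indicator (fun _ => (1 : ℝ)) t - u t‖ := by
          rw [← Real.norm_eq_abs]
          refine norm_integral_le_of_norm_le (g := fun t => M * ‖E.indicator (fun _ => (1 : ℝ)) t - u t‖)
            ((hmi.sub hui).norm.const_mul _) (ae_of_all _ ?_)
          intro t
          rw [norm_mul]
          exact mul_le_mul_of_nonneg_right (hb t) (norm_nonneg _)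
      _ ≤ M * (τ / (2 * (M + 1))) := by
          rw [integral_const_mul]
          gcongr
      _ ≤ τ / 2 := by
          rw [mul_div_assoc', div_le_div_iff₀ (by positivity) (by norm_num)]
          nlinarith [M.coe_nonneg]
  have hsnd : |∫ t, deriv u t * h t| ≤ τ / 2 := by
    calc _ ≤ ∫ t, ε * ‖deriv u t‖ := by
          rw [← Real.norm_eq_abs]
          refine norm_integral_le_of_norm_le (hdu.norm.const_mul _) (ae_of_all _ ?_)
          intro t
          rw [norm_mul, mul_comm]
          exact mul_le_mul_of_nonneg_right (hhε t) (norm_nonneg _)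
      _ ≤ τ / 2 := by
          rw [integral_const_mul]
          exact hε.le
  rw [hsplit]
  calc _ ≤ _ := abs_sub _ _
    _ ≤ τ := by linarith

/-- Almost every point of a set of reals is an accumulation point of it. -/
theorem ae_mem_imp_accPt (K : Set ℝ) : ∀ᵐ t, t ∈ K → AccPt t (𝓟 K) := by
  have hc : {t ∈ K | 𝓝[K ∩ Set.Ioi t] t = ⊥}.Countable := countable_setOfPred_isolated_right_within
  filter_upwards [hc.ae_notMem volume] with t ht htK
  have hne : (𝓝[K ∩ Set.Ioi t] t).NeBot := ⟨fun h => ht ⟨htK, h⟩⟩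
  rw [accPt_principal_iff_nhdsWithin]
  exact hne.mono (nhdsWithin_mono _ fun s hs => ⟨hs.1, ne_of_gt hs.2⟩)

theorem norm_le_of_hasDerivWithinAt_of_dist_le {X Y : Type*} [NormedAddCommGroup X] [NormedSpace ℝ X]
    [NormedAddCommGroup Y] [NormedSpace ℝ Y] {K : Set ℝ} {γ : ℝ → X} {g : ℝ → Y} {t : ℝ}
    {v : X} {w : Y} (ht : t ∈ K) (hacc : AccPt t (𝓟 K)) (hγ : HasDerivWithinAt γ v K t)
    (hg : HasDerivWithinAt g w K t)
    (hle : ∀ s ∈ K, ∀ r ∈ K, dist (g s) (g r) ≤ dist (γ s) (γ r)) : ‖w‖ ≤ ‖v‖ := by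
  rw [accPt_principal_iff_nhdsWithin] at hacc
  rw [hasDerivWithinAt_iff_tendsto_slope] at hγ hg
  refine le_of_tendsto_of_tendsto hg.norm hγ.norm ?_
  filter_upwards [self_mem_nhdsWithin] with s hs
  have := hle s hs.1 t ht
  rw [dist_eq_norm, dist_eq_norm] at this
  simp only [slope_def_module, norm_smul]
  gcongr


/-- On a piece `E` of `K` where `γ'` is close to a fixed vector `p` normed by `φ`, the set where the
derivative of a contracted curve `g` differs from that of `γ` by at least `δ` is small, provided that
`g` is uniformly close to `γ`. -/
theorem eventually_volume_derivs_far_inter_le {X : Type*} [NormedAddCommGroup X] [NormedSpace ℝ X]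
    [FiniteDimensional ℝ X] {K E : Set ℝ} (hE : MeasurableSet E) (hEK : E ⊆ K)
    (hEfin : volume E ≠ ⊤) {γ : ℝ → X} {Lγ : NNReal} (hγ : LipschitzOnWith Lγ γ K)
    {φ : StrongDual ℝ X} (hφ : ‖φ‖ ≤ 1) {p : X} (hp : φ p = ‖p‖) {δ η ρ τ : ℝ}
    (hη : 0 < η) (hτ : 0 < τ)
    (hE' : ∀ t ∈ E, ∀ v, AccPt t (𝓟 K) → HasDerivWithinAt γ v K t → ‖v - p‖ ≤ ρ)
    (hconv : ∀ t ∈ E, ∀ v w : X, AccPt t (𝓟 K) → HasDerivWithinAt γ v K t →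
      ‖w‖ ≤ ‖v‖ → δ ≤ ‖w - v‖ → ‖v + w‖ + η ≤ 2 * ‖v‖) :
    ∀ᶠ ε in 𝓝[>] (0 : ℝ), ∀ g : ℝ → X,
      (∀ s ∈ K, ∀ r ∈ K, dist (g s) (g r) ≤ dist (γ s) (γ r)) → (∀ t ∈ K, ‖g t - γ t‖ ≤ ε) →
      η * (volume ({t ∈ K | ∃ v w, HasDerivWithinAt γ v K t ∧
          HasDerivWithinAt g w K t ∧ δ ≤ ‖w - v‖} ∩ E)).toReal ≤
        4 * ρ * (volume E).toReal + τ := by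
  filter_upwards [eventually_abs_setIntegral_deriv_le hE hEfin (Lγ + Lγ) hτ, self_mem_nhdsWithin]
    with ε hε hε0 g hg hgε
  have hε0 : 0 < ε := hε0
  have hφle : ∀ x, φ x ≤ ‖x‖ := fun x =>
    (le_abs_self _).trans ((φ.le_of_opNorm_le hφ x).trans_eq (one_mul _))
  have hgL : LipschitzOnWith Lγ g K := LipschitzOnWith.of_dist_le_mul fun s hs r hr =>
    (hg s hs r hr).trans (hγ.dist_le_mul s hs r hr)
  have hdL : LipschitzOnWith (Lγ + Lγ) (fun t => φ (g t - γ t)) K := by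
    refine ((φ.lipschitz.weaken (K' := 1) hφ).comp_lipschitzOnWith (hgL.sub hγ)).weaken ?_
    rw [one_mul]
  obtain ⟨h₀, hh₀, heq₀⟩ := hdL.extend_real
  let h : ℝ → ℝ := fun t => max (-ε) (min ε (h₀ t))
  have hh : LipschitzWith (Lγ + Lγ) h := (hh₀.const_min ε).const_max (-ε)
  have heq : Set.EqOn h (fun t => φ (g t - γ t)) K := by
    intro t ht
    have h1 : |φ (g t - γ t)| ≤ ε :=
      (φ.le_of_opNorm_le hφ _).trans ((one_mul _).trans_le (hgε t ht))
    have h2 := abs_le.1 h1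
    simp only [h, ← heq₀ ht]
    rw [min_eq_right h2.2, max_eq_right h2.1]
  have hint := hε h hh fun t => abs_le.2
    ⟨le_max_left _ _, max_le (by linarith) (min_le_left _ _)⟩
  have hderiv : ∀ t ∈ K, AccPt t (𝓟 K) → DifferentiableAt ℝ h t → ∀ v w,
      HasDerivWithinAt γ v K t → HasDerivWithinAt g w K t → deriv h t = φ (w - v) := by
    intro t ht hacc hdiff v w hv hw
    have h1 : HasDerivWithinAt h (φ (w - v)) K t :=
      ((φ.hasFDerivAt.comp_hasDerivWithinAt t (hw.sub hv)).congr heq (heq ht))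
    exact (uniqueDiffWithinAt_iff_accPt.2 hacc).eq_deriv K hdiff.hasDerivAt.hasDerivWithinAt h1
  have hφp : ∀ v, ‖v - p‖ ≤ ρ → ‖v‖ - φ v ≤ 2 * ρ := by
    intro v hv
    have h1 := hφle (p - v)
    rw [map_sub, hp, norm_sub_rev] at h1
    have h2 := norm_sub_norm_le v p
    linarith
  have hnonneg : 0 ≤ᵐ[volume.restrict E] fun t => 4 * ρ - deriv h t := by
    refine (ae_restrict_iff' hE).2 ?_
    filter_upwards [ae_mem_imp_accPt K, hh.ae_differentiableAt_real,
      hγ.ae_differentiableWithinAt_of_mem_real, hgL.ae_differentiableWithinAt_of_mem_real]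
      with t hacc hdiff hdγ hdg htE
    have htK := hEK htE
    have hv := (hdγ htK).hasDerivWithinAt
    have hw := (hdg htK).hasDerivWithinAt
    have hd := hderiv t htK (hacc htK) hdiff _ _ hv hw
    have hle := norm_le_of_hasDerivWithinAt_of_dist_le htK (hacc htK) hv hw hg
    have hvp := hE' t htE _ (hacc htK) hv
    have h1 := hφp _ hvp
    have h2 := hφle (derivWithin g K t)
    have h3 := (norm_nonneg _).trans hvp
    rw [map_sub] at hd
    simp only [Pi.zero_apply]
    linarith
  have hdi : IntegrableOn (deriv h) E :=
    Measure.integrableOn_of_bounded hEfin (measurable_deriv h).aestronglyMeasurable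
      (ae_of_all _ fun t => norm_deriv_le_of_lipschitz hh)
  have hci : IntegrableOn (fun _ : ℝ => 4 * ρ) E := integrableOn_const hEfin
  have hmarkov := mul_meas_ge_le_integral_of_nonneg hnonneg (hci.sub hdi) η
  rw [integral_sub hci hdi, setIntegral_const, smul_eq_mul, measureReal_def, measureReal_def]
    at hmarkov
  have hsub : volume ({t ∈ K | ∃ v w, HasDerivWithinAt γ v K t ∧
      HasDerivWithinAt g w K t ∧ δ ≤ ‖w - v‖} ∩ E) ≤
      volume.restrict E {t | η ≤ 4 * ρ - deriv h t} := by
    rw [Measure.restrict_apply' hE]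
    refine measure_mono_ae ?_
    filter_upwards [ae_mem_imp_accPt K, hh.ae_differentiableAt_real] with t hacc hdiff
    rintro ⟨⟨htK, v, w, hv, hw, hvw⟩, htE⟩
    refine ⟨?_, htE⟩
    have hd := hderiv t htK (hacc htK) hdiff _ _ hv hw
    have hle := norm_le_of_hasDerivWithinAt_of_dist_le htK (hacc htK) hv hw hg
    have h1 := hφp _ (hE' t htE _ (hacc htK) hv)
    have h2 := hconv t htE v w (hacc htK) hv hle hvw
    have h3 := hφle (v + w)
    rw [map_add] at h3
    rw [map_sub] at hd
    change η ≤ 4 * ρ - deriv h t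
    linarith
  have hreal := ENNReal.toReal_mono
    (measure_ne_top_of_subset (Set.subset_univ _) (by simpa using hEfin)) hsub
  have := abs_le.1 hint
  nlinarith [mul_le_mul_of_nonneg_left hreal hη.le]

/-- If `γ` is Lipschitz on a set `K` of finite positive measure, then contracted curves uniformly
close to `γ` have derivative within `K` close to that of `γ`, up to a set of small measure. -/
theorem eventually_volume_derivs_far_le {X : Type*} [NormedAddCommGroup X] [NormedSpace ℝ X]
    [FiniteDimensional ℝ X] [StrictConvexSpace ℝ X] {K : Set ℝ} (hK : MeasurableSet K)
    (hKpos : volume K ≠ 0) (hKfin : volume K ≠ ⊤) {γ : ℝ → X} {Lγ : NNReal}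
    (hγ : LipschitzOnWith Lγ γ K) {δ : ℝ} (hδ : 0 < δ) :
    ∀ᶠ ε in 𝓝[>] (0 : ℝ), ∀ g : ℝ → X,
      (∀ s ∈ K, ∀ r ∈ K, dist (g s) (g r) ≤ dist (γ s) (γ r)) → (∀ t ∈ K, ‖g t - γ t‖ ≤ ε) →
      volume {t ∈ K | ∃ v w, HasDerivWithinAt γ v K t ∧
          HasDerivWithinAt g w K t ∧ δ ≤ ‖w - v‖} ≤ ENNReal.ofReal δ * volume K := by
  borelize X
  have : ProperSpace X := FiniteDimensional.proper ℝ X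
  obtain ⟨Γ, hΓ, hΓeq⟩ := hγ.extend_finite_dimension
  set L : NNReal := lipschitzExtensionConstant X * Lγ
  obtain ⟨η, hη, hconv⟩ := exists_norm_add_add_le_two_mul_norm (X := X) L hδ
  have hκ : 0 < (volume K).toReal := ENNReal.toReal_pos hKpos hKfin
  set κ := (volume K).toReal
  let ρ := η * δ / 8
  have hρ : 0 < ρ := by positivity
  obtain ⟨P, -, hPfin, hPcov⟩ :=
    (isCompact_closedBall (0 : X) L).finite_cover_balls hρ
  obtain ⟨N, c, hc⟩ : ∃ (N : ℕ) (c : Fin N → X), Set.range c = P := hPfin.fin_param.imp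
    fun n ⟨c, _, hc⟩ => ⟨c, hc⟩
  let τ := η * δ * κ / (2 * (N + 1))
  have hτ : 0 < τ := by positivity
  -- The points where `Γ` is differentiable carry the whole measure of `K`.
  let G : Set ℝ := {t | DifferentiableAt ℝ Γ t}
  have hG : MeasurableSet G := measurableSet_of_differentiableAt ℝ Γ
  let S : Fin N → Set ℝ := fun i => (K ∩ G) ∩ deriv Γ ⁻¹' Metric.ball (c i) ρ
  have hS : ∀ i, MeasurableSet (S i) := fun i =>
    (hK.inter hG).inter (measurable_deriv Γ Metric.isOpen_ball.measurableSet)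
  let E : Fin N → Set ℝ := disjointed S
  have hE : ∀ i, MeasurableSet (E i) := fun i =>
    disjointedRec (fun _ j ht => ht.diff (hS j)) (hS i)
  have hES : ∀ i, E i ⊆ S i := fun i => disjointed_subset S i
  have hEK : ∀ i, E i ⊆ K := fun i t ht => (hES i ht).1.1
  have hEfin : ∀ i, volume (E i) ≠ ⊤ := fun i => measure_ne_top_of_subset (hEK i) hKfin
  have hcover : K ∩ G ⊆ ⋃ i, E i := by
    rw [iUnion_disjointed]
    intro t ht
    have : deriv Γ t ∈ Metric.closedBall (0 : X) L :=
      mem_closedBall_zero_iff.2 (norm_deriv_le_of_lipschitz hΓ)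
    obtain ⟨x, hx, hxt⟩ := Set.mem_iUnion₂.1 (hPcov this)
    rw [← hc] at hx
    obtain ⟨i, rfl⟩ := hx
    exact Set.mem_iUnion.2 ⟨i, ht, hxt⟩
  have hsum : ∑ i, (volume (E i)).toReal ≤ κ := by
    rw [← ENNReal.toReal_sum fun i _ => hEfin i, ← tsum_fintype (L := .unconditional _),
      ← measure_iUnion (disjoint_disjointed S) hE]
    exact ENNReal.toReal_mono hKfin (measure_mono (Set.iUnion_subset hEK))
  have hderiv : ∀ i, ∀ t ∈ E i, ∀ v, AccPt t (𝓟 K) → HasDerivWithinAt γ v K t →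
      v = deriv Γ t := by
    intro i t ht v hacc hv
    have h1 : HasDerivWithinAt Γ v K t :=
      hv.congr (fun s hs => (hΓeq hs).symm) (hΓeq (hEK i ht)).symm
    have h2 : DifferentiableAt ℝ Γ t := (hES i ht).1.2
    exact (uniqueDiffWithinAt_iff_accPt.2 hacc).eq_deriv K h1 h2.hasDerivAt.hasDerivWithinAt
  choose φ hφ hφp using fun i => exists_dual_vector'' ℝ (c i)
  have hpieces := eventually_all.2 fun i => eventually_volume_derivs_far_inter_le (hE i) (hEK i)
    (hEfin i) hγ (hφ i) (hφp i) (δ := δ) (ρ := ρ) hη hτ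
    (fun t ht v hacc hv => by
      rw [hderiv i t ht v hacc hv, ← dist_eq_norm]
      exact (Metric.mem_ball.1 (hES i ht).2).le)
    (fun t ht v w hacc hv => hconv v w (by
      rw [hderiv i t ht v hacc hv]
      exact norm_deriv_le_of_lipschitz hΓ))
  filter_upwards [hpieces] with ε hε g hg hgε
  set B := {t ∈ K | ∃ v w, HasDerivWithinAt γ v K t ∧
          HasDerivWithinAt g w K t ∧ δ ≤ ‖w - v‖}
  have hB : volume B ≤ ∑ i, volume (B ∩ E i) := by
    calc volume B ≤ volume (⋃ i, B ∩ E i) := by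
          refine measure_mono_ae ?_
          filter_upwards [hΓ.ae_differentiableAt_real] with t ht htB
          obtain ⟨i, hi⟩ := Set.mem_iUnion.1 (hcover ⟨htB.1, ht⟩)
          exact Set.mem_iUnion.2 ⟨i, htB, hi⟩
      _ ≤ _ := measure_iUnion_fintype_le _ _
  have hBfin : ∀ i, volume (B ∩ E i) ≠ ⊤ := fun i =>
    measure_ne_top_of_subset Set.inter_subset_right (hEfin i)
  have hBreal : (volume B).toReal ≤ ∑ i, (volume (B ∩ E i)).toReal := by
    rw [← ENNReal.toReal_sum fun i _ => hBfin i]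
    exact ENNReal.toReal_mono (ENNReal.sum_ne_top.2 fun i _ => hBfin i) hB
  have hBle : η * (volume B).toReal ≤ η * (δ * κ) := by
    calc η * (volume B).toReal ≤ ∑ i, η * (volume (B ∩ E i)).toReal := by
          rw [← Finset.mul_sum]
          gcongr
      _ ≤ ∑ i, (4 * ρ * (volume (E i)).toReal + τ) :=
          Finset.sum_le_sum fun i _ => hε i g hg hgε
      _ = 4 * ρ * ∑ i, (volume (E i)).toReal + N * τ := by
          rw [Finset.sum_add_distrib, ← Finset.mul_sum]
          simp
      _ ≤ 4 * ρ * κ + η * δ * κ / 2 := by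
          gcongr
          simp only [τ]
          rw [mul_div_assoc', div_le_div_iff₀ (by positivity) (by norm_num)]
          nlinarith [show 0 < η * δ * κ by positivity]
      _ = η * (δ * κ) := by
          simp only [ρ]
          ring
  have hBtop : volume B ≠ ⊤ := measure_ne_top_of_subset (fun t ht => ht.1) hKfin
  rw [← ENNReal.ofReal_toReal hBtop, ← ENNReal.ofReal_toReal hKfin, ← ENNReal.ofReal_mul hδ.le]
  exact ENNReal.ofReal_le_ofReal (le_of_mul_le_mul_left hBle hη)


/-- Let `X` be a finite-dimensional strictly convex real normed space, `γ : K → X` a curve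
fragment with `H¹(K) > 0`, and `C ⊆ X` a convex set containing an open neighbourhood of
`γ(K)`. Then for each `δ > 0` there is `ε > 0` such that for every 1-Lipschitz `f : C → X`
uniformly `ε`-close to the identity, the set of `t ∈ K` where the derivatives (within `K`) of
`γ` and `f ∘ γ` exist and differ by at least `δ` has `H¹`-measure at most `δ · H¹(K)`. -/
theorem stmt_9 {X : Type*} [NormedAddCommGroup X] [NormedSpace ℝ X]
    [FiniteDimensional ℝ X] [StrictConvexSpace ℝ X]
    (K : Set ℝ) (hKsub : K ⊆ Set.Icc 0 1) (hKcomp : IsCompact K) (hKne : K.Nonempty)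
    (γ : ℝ → X) (Lγ : NNReal) (hγ : LipschitzOnWith Lγ γ K)
    (hKpos : 0 < μH[1] K)
    (C : Set X) (hC : Convex ℝ C) (hnbhd : ∃ U, IsOpen U ∧ γ '' K ⊆ U ∧ U ⊆ C)
    (δ : ℝ) (hδ : 0 < δ) :
    ∃ ε > (0 : ℝ), ∀ f : X → X, LipschitzOnWith 1 f C → (∀ x ∈ C, ‖f x - x‖ < ε) →
      μH[1] {t ∈ K | ∃ v w, HasDerivWithinAt γ v K t ∧
          HasDerivWithinAt (f ∘ γ) w K t ∧ δ ≤ ‖w - v‖} ≤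
        ENNReal.ofReal δ * μH[1] K := by

  obtain ⟨U, -, hγU, hUC⟩ := hnbhd
  have hmem : ∀ t ∈ K, γ t ∈ C := fun t ht => hUC (hγU (Set.mem_image_of_mem γ ht))
  rw [hausdorffMeasure_real] at hKpos ⊢
  obtain ⟨ε, hε, hε0⟩ := ((eventually_volume_derivs_far_le hKcomp.measurableSet hKpos.ne'
    hKcomp.measure_lt_top.ne hγ hδ).and self_mem_nhdsWithin).exists
  refine ⟨ε, hε0, fun f hf hfε => hε (f ∘ γ) (fun s hs r hr => ?_) fun t ht =>
    (hfε _ (hmem t ht)).le⟩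
  simpa using hf.dist_le_mul _ (hmem s hs) _ (hmem r hr)
end

section
/- Let X be a metric space, δ > 0, and φ : X → ℝ a Lipschitz map. For every ε > 0 there is ε₀ > 0 such that: for any set S ⊆ X and any g : S → ℝ satisfying |g(y) − g(z)| ≤ |φ(y) − φ(z)| + δ·d(y,z) for all y, z ∈ S, and |g(x) − φ(x)| < ε₀ for all x ∈ S, there exists an extension G : X → ℝ of g such that |G(y) − G(z)| ≤ |φ(y) − φ(z)| + δ·d(y,z) for all y, z ∈ X and |G(x) − φ(x)| < ε for all x ∈ X. -/
/-- A real function that is `1`-Lipschitz on `S` and `c`-close there to a `1`-Lipschitz function `φ`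
extends to a `1`-Lipschitz function that is `c`-close to `φ` everywhere. -/
theorem LipschitzOnWith.exists_extend_real_abs_sub_le {Y : Type*} [PseudoMetricSpace Y]
    {S : Set Y} {g φ : Y → ℝ} {c : ℝ} (hg : LipschitzOnWith 1 g S) (hφ : LipschitzWith 1 φ)
    (hc : 0 ≤ c) (hgφ : ∀ x ∈ S, |g x - φ x| ≤ c) :
    ∃ G : Y → ℝ, Set.EqOn G g S ∧ LipschitzWith 1 G ∧ ∀ x, |G x - φ x| ≤ c := by
  obtain ⟨f, hf, hfg⟩ := hg.extend_real
  have hshift (a : ℝ) : LipschitzWith 1 fun x ↦ φ x + a := by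
    simpa using hφ.add (LipschitzWith.const a)
  refine ⟨fun x ↦ max (φ x + -c) (min (φ x + c) (f x)), fun x hx ↦ ?_, ?_, fun x ↦ ?_⟩
  · have h := abs_le.1 (hgφ x hx)
    simp only [← hfg hx]
    rw [min_eq_right (by linarith), max_eq_right (by linarith)]
  · simpa using (hshift (-c)).max ((hshift c).min hf)
  · refine abs_le.2 ⟨?_, ?_⟩
    · linarith [le_max_left (φ x + -c) (min (φ x + c) (f x))]
    · have : max (φ x + -c) (min (φ x + c) (f x)) ≤ φ x + c :=
        max_le (by linarith) (min_le_left _ _)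
      linarith

/-- The pseudometric `|φ y - φ z| + δ * dist y z`. -/
abbrev PseudoMetricSpace.absSubAddMulDist {X : Type*} [PseudoMetricSpace X] (φ : X → ℝ) {δ : ℝ}
    (hδ : 0 ≤ δ) : PseudoMetricSpace X where
  dist y z := |φ y - φ z| + δ * dist y z
  dist_self x := by simp
  dist_comm x y := by rw [abs_sub_comm, dist_comm]
  dist_triangle x y z := by
    nlinarith [abs_sub_le (φ x) (φ y) (φ z),
      mul_le_mul_of_nonneg_left (dist_triangle x y z) hδ]

/-- Extension lemma: maps satisfying `|g(y) − g(z)| ≤ |φ(y) − φ(z)| + δ d(y,z)` on `S` and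
uniformly `ε₀`-close to `φ` on `S` extend to `X` keeping the modulus and `ε`-closeness. -/
theorem stmt_10 {X : Type*} [MetricSpace X] (δ : ℝ) (hδ : 0 < δ)
    (φ : X → ℝ) (Lφ : NNReal) (hφ : LipschitzWith Lφ φ)
    (ε : ℝ) (hε : 0 < ε) :
    ∃ ε₀ : ℝ, 0 < ε₀ ∧ ∀ (S : Set X) (g : X → ℝ),
      (∀ y ∈ S, ∀ z ∈ S, |g y - g z| ≤ |φ y - φ z| + δ * dist y z) →
      (∀ x ∈ S, |g x - φ x| < ε₀) →
      ∃ G : X → ℝ, (∀ x ∈ S, G x = g x) ∧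
        (∀ y z : X, |G y - G z| ≤ |φ y - φ z| + δ * dist y z) ∧
        ∀ x : X, |G x - φ x| < ε := by
  refine ⟨ε / 2, half_pos hε, fun S g hg hgφ ↦ ?_⟩
  have hd (y z : X) : 0 ≤ δ * dist y z := mul_nonneg hδ.le dist_nonneg
  let m : PseudoMetricSpace X := PseudoMetricSpace.absSubAddMulDist φ hδ.le
  have hφm : @LipschitzWith X ℝ m.toPseudoEMetricSpace _ 1 φ :=
    @LipschitzWith.mk_one X ℝ m _ φ fun y z ↦
      le_add_of_nonneg_right (hd y z)
  have hgm : @LipschitzOnWith X ℝ m.toPseudoEMetricSpace _ 1 g S :=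
    @LipschitzOnWith.mk_one X ℝ m _ S g hg
  obtain ⟨G, hGg, hG, hGφ⟩ := @LipschitzOnWith.exists_extend_real_abs_sub_le X m S g φ (ε / 2)
    hgm hφm (half_pos hε).le fun x hx ↦ (hgφ x hx).le
  refine ⟨G, hGg, fun y z ↦ ?_, fun x ↦ (hGφ x).trans_lt (half_lt_self hε)⟩
  have h := @LipschitzWith.dist_le_mul X ℝ m _ 1 G hG y z
  rw [NNReal.coe_one, one_mul] at h
  exact h
end
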